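/- (Theorem 3.) Consider a global solution (λ, μ, φ) on [1,∞) of the plane symmetric (k = 0) Einstein–scalar field system in areal coordinates with f ≡ 0, arising from periodic initial data at t = 1. Let τ ↦ (t(τ), r(τ), w(τ), F) be a maximally extended solution on (τ₋, τ₊) of the geodesic system dt/dτ = e^{−μ}√(m² + w² + F/t²), dr/dτ = e^{−λ} w, dw/dτ = −∂_tλ·p⁰·w − e^{2μ−λ}∂_rμ·(p⁰)² (with p⁰ = e^{−μ}√(m² + w² + F/t²)), dF/dτ = 0, with t(τ₀) = 1 for some τ₀, where either m > 0 (timelike) or m = 0 and p⁰(τ₀) > 0 (null). Then t(τ) → ∞ as τ → τ₊ and the proper time integral ∫₁^∞ e^{μ(t, r(t))} (m² + w(t)² + F/t²)^{−1/2} dt diverges; hence τ₊ = +∞, i.e., the spacetime is timelike and null geodesically complete in the expanding direction. -/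

import Mathlib

open MeasureTheory Real Filter

noncomputable section

/-- Partial derivative with respect to the first (time) variable. -/
def ptd (u : ℝ → ℝ → ℝ) (t r : ℝ) : ℝ := deriv (fun s => u s r) t

/-- Partial derivative with respect to the second (space) variable. -/
def prd (u : ℝ → ℝ → ℝ) (t r : ℝ) : ℝ := deriv (fun x => u t x) r

/-- The kinematic factor `√(1 + w² + F/t²)`. -/
def vq (t w F : ℝ) : ℝ := Real.sqrt (1 + w ^ 2 + F / t ^ 2)

/-- The energy density ρ. -/
def rho (lam mu phi : ℝ → ℝ → ℝ) (f : ℝ → ℝ → ℝ → ℝ → ℝ) (t r : ℝ) : ℝ :=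
  Real.pi / t ^ 2 * (∫ w : ℝ, ∫ F in Set.Ioi (0 : ℝ), vq t w F * f t r w F)
    + (1 / 2) * (Real.exp (-2 * mu t r) * (ptd phi t r) ^ 2
      + Real.exp (-2 * lam t r) * (prd phi t r) ^ 2)

/-- The radial pressure p. -/
def pres (lam mu phi : ℝ → ℝ → ℝ) (f : ℝ → ℝ → ℝ → ℝ → ℝ) (t r : ℝ) : ℝ :=
  Real.pi / t ^ 2 * (∫ w : ℝ, ∫ F in Set.Ioi (0 : ℝ), w ^ 2 / vq t w F * f t r w F)
    + (1 / 2) * (Real.exp (-2 * mu t r) * (ptd phi t r) ^ 2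
      + Real.exp (-2 * lam t r) * (prd phi t r) ^ 2)

/-- The momentum density j. -/
def jmom (lam mu phi : ℝ → ℝ → ℝ) (f : ℝ → ℝ → ℝ → ℝ → ℝ) (t r : ℝ) : ℝ :=
  Real.pi / t ^ 2 * (∫ w : ℝ, ∫ F in Set.Ioi (0 : ℝ), w * f t r w F)
    - Real.exp (-(lam t r + mu t r)) * ptd phi t r * prd phi t r

/-- The tangential pressure q. -/
def qmom (lam mu phi : ℝ → ℝ → ℝ) (f : ℝ → ℝ → ℝ → ℝ → ℝ) (t r : ℝ) : ℝ :=
  Real.pi / t ^ 4 * (∫ w : ℝ, ∫ F in Set.Ioi (0 : ℝ), F / vq t w F * f t r w F)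
    + Real.exp (-2 * mu t r) * (ptd phi t r) ^ 2
    - Real.exp (-2 * lam t r) * (prd phi t r) ^ 2

/-- Membership in the time domain `[1, T)` (with `T ≤ ∞` an extended real). -/
def InDom (T : EReal) (t : ℝ) : Prop := 1 ≤ t ∧ (t : EReal) < T

/-- A regular solution of the surface-symmetric Einstein–Vlasov–scalar field system
in areal coordinates on the time interval `[1, T)`, with curvature parameter `k`.
All unknowns are periodic of period 1 in `r`, `f` is nonnegative with bounded
support in `(w, F)` locally uniformly in `t`, and the Vlasov, Einstein and wave
equations hold on the domain. -/
structure IsEVS (k : ℝ) (T : EReal) (lam mu phi : ℝ → ℝ → ℝ)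
    (f : ℝ → ℝ → ℝ → ℝ → ℝ) : Prop where
  hT : (1 : EReal) < T
  f_nonneg : ∀ t r w F, 0 ≤ f t r w F
  per_lam : ∀ t r, lam t (r + 1) = lam t r
  per_mu : ∀ t r, mu t (r + 1) = mu t r
  per_phi : ∀ t r, phi t (r + 1) = phi t r
  per_f : ∀ t r w F, f t (r + 1) w F = f t r w F
  supp_bdd : ∀ T' : ℝ, 1 ≤ T' → (T' : EReal) < T →
    ∃ C : ℝ, ∀ t r w F, 1 ≤ t → t ≤ T' → f t r w F ≠ 0 → |w| ≤ C ∧ F ≤ C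
  reg_lam_t : ∀ t r, InDom T t → DifferentiableAt ℝ (fun s => lam s r) t
  reg_lam_r : ∀ t r, InDom T t → DifferentiableAt ℝ (fun x => lam t x) r
  reg_lam_tt : ∀ t r, InDom T t → DifferentiableAt ℝ (fun s => ptd lam s r) t
  reg_mu_t : ∀ t r, InDom T t → DifferentiableAt ℝ (fun s => mu s r) t
  reg_mu_r : ∀ t r, InDom T t → DifferentiableAt ℝ (fun x => mu t x) r
  reg_mu_rr : ∀ t r, InDom T t → DifferentiableAt ℝ (fun x => prd mu t x) r
  reg_phi_t : ∀ t r, InDom T t → DifferentiableAt ℝ (fun s => phi s r) t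
  reg_phi_r : ∀ t r, InDom T t → DifferentiableAt ℝ (fun x => phi t x) r
  reg_phi_tt : ∀ t r, InDom T t → DifferentiableAt ℝ (fun s => ptd phi s r) t
  reg_phi_rr : ∀ t r, InDom T t → DifferentiableAt ℝ (fun x => prd phi t x) r
  reg_f : ∀ t r w F, InDom T t → 0 ≤ F →
    DifferentiableAt ℝ (fun s => f s r w F) t ∧
    DifferentiableAt ℝ (fun x => f t x w F) r ∧
    DifferentiableAt ℝ (fun v => f t r v F) w
  vlasov : ∀ t r w F, InDom T t → 0 ≤ F →
    deriv (fun s => f s r w F) t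
      + Real.exp (mu t r - lam t r) * w / vq t w F * deriv (fun x => f t x w F) r
      - (ptd lam t r * w + Real.exp (mu t r - lam t r) * prd mu t r * vq t w F)
        * deriv (fun v => f t r v F) w = 0
  ee1 : ∀ t r, InDom T t →
    Real.exp (-2 * mu t r) * (2 * t * ptd lam t r + 1) + k
      = 8 * Real.pi * t ^ 2 * rho lam mu phi f t r
  ee2 : ∀ t r, InDom T t →
    Real.exp (-2 * mu t r) * (2 * t * ptd mu t r - 1) - k
      = 8 * Real.pi * t ^ 2 * pres lam mu phi f t r
  ee3 : ∀ t r, InDom T t →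
    prd mu t r = -(4 * Real.pi) * t * Real.exp (lam t r + mu t r) * jmom lam mu phi f t r
  ee4 : ∀ t r, InDom T t →
    Real.exp (-2 * lam t r)
        * (deriv (fun x => prd mu t x) r + prd mu t r * (prd mu t r - prd lam t r))
      - Real.exp (-2 * mu t r)
        * (deriv (fun s => ptd lam s r) t + (ptd lam t r + 1 / t) * (ptd lam t r - ptd mu t r))
      = 4 * Real.pi * qmom lam mu phi f t r
  wave : ∀ t r, InDom T t →
    Real.exp (-2 * lam t r) * deriv (fun x => prd phi t x) r
      - Real.exp (-2 * mu t r) * deriv (fun s => ptd phi s r) t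
      - Real.exp (-2 * mu t r) * (ptd lam t r - ptd mu t r + 2 / t) * ptd phi t r
      - Real.exp (-2 * lam t r) * (prd lam t r - prd mu t r) * prd phi t r = 0

/-- A regular solution on `[1, T)` is right maximal if it is not the restriction of a
regular solution on a strictly larger interval `[1, T')`. -/
def RightMaximal (k : ℝ) (T : EReal) (lam mu phi : ℝ → ℝ → ℝ)
    (f : ℝ → ℝ → ℝ → ℝ → ℝ) : Prop :=
  IsEVS k T lam mu phi f ∧
  ∀ (T' : EReal) (lam' mu' phi' : ℝ → ℝ → ℝ) (f' : ℝ → ℝ → ℝ → ℝ → ℝ),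
    T < T' → IsEVS k T' lam' mu' phi' f' →
    ¬ (∀ t r w F, InDom T t →
        lam' t r = lam t r ∧ mu' t r = mu t r ∧ phi' t r = phi t r ∧
        f' t r w F = f t r w F)

/-- The geodesic system in the plane symmetric spacetime, parameterized by proper
time (timelike, mass `m > 0`) or an affine parameter (null, `m = 0`), on the
parameter interval `(a, b)`. -/
def GeoSys (lam mu : ℝ → ℝ → ℝ) (m F : ℝ) (a b : EReal) (tt rr ww : ℝ → ℝ) : Prop :=
  ∀ τ : ℝ, a < (τ : EReal) → (τ : EReal) < b →
    HasDerivAt tt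
      (Real.exp (-(mu (tt τ) (rr τ)))
        * Real.sqrt (m ^ 2 + ww τ ^ 2 + F / tt τ ^ 2)) τ
    ∧ HasDerivAt rr (Real.exp (-(lam (tt τ) (rr τ))) * ww τ) τ
    ∧ HasDerivAt ww
      (-(ptd lam (tt τ) (rr τ))
          * (Real.exp (-(mu (tt τ) (rr τ)))
              * Real.sqrt (m ^ 2 + ww τ ^ 2 + F / tt τ ^ 2)) * ww τ
        - Real.exp (2 * mu (tt τ) (rr τ) - lam (tt τ) (rr τ)) * prd mu (tt τ) (rr τ)
          * (Real.exp (-(mu (tt τ) (rr τ)))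
              * Real.sqrt (m ^ 2 + ww τ ^ 2 + F / tt τ ^ 2)) ^ 2) τ

/-- A geodesic on `(a, b)` is maximally extended to the future if it is not the
restriction of a geodesic on `(a, b')` with `b' > b`. -/
def GeoRightMax (lam mu : ℝ → ℝ → ℝ) (m F : ℝ) (a b : EReal)
    (tt rr ww : ℝ → ℝ) : Prop :=
  GeoSys lam mu m F a b tt rr ww ∧
  ∀ (b' : EReal) (tt' rr' ww' : ℝ → ℝ), b < b' →
    GeoSys lam mu m F a b' tt' rr' ww' →
    ¬ (∀ τ : ℝ, a < (τ : EReal) → (τ : EReal) < b →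
        tt' τ = tt τ ∧ rr' τ = rr τ ∧ ww' τ = ww τ)

open Topology in
/-- P-type pointwise condition with uniform parameter N. -/
def CondP (K : ℝ) (ψ p : ℝ → ℝ → ℝ) (N : ℕ) (ξ η : ℝ) : Prop :=
  ∀ k : ℝ, |k| * (N + 1) < 1 →
    |ψ (ξ + k) (η + k) - ψ (ξ - k) (η + k) - 2 * k * p ξ η| ≤ K * k ^ 2 ∧
    ∀ α β : ℝ, |α| ≤ |k| → |β| ≤ |k| →
      (ψ (ξ + β) (η + k) - ψ (ξ + α) (η + k) - (β - α) * p ξ η) ^ 2 ≤ N * |k| ^ 3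

theorem CondP.reflect {K : ℝ} {ψ p : ℝ → ℝ → ℝ} {N : ℕ} {ξ η : ℝ} (h : CondP K ψ p N ξ (-η)) :
    CondP K (fun a b => ψ a (-b)) (fun a b => p a (-b)) N ξ η := by
  intro k hk
  have h1 := h (-k) (by simpa using hk)
  obtain ⟨h2, h3⟩ := h1
  constructor
  · have e : -η + -k = -(η + k) := by ring
    rw [e] at h2
    rw [show (-k)^2 = k^2 by ring] at h2
    rw [abs_le] at h2 ⊢
    simp only [sub_neg_eq_add] at h2
    have : ξ + -k = ξ - k := by ring
    rw [this] at h2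
    constructor <;> nlinarith [h2.1, h2.2]
  · intro α β ha hb
    have := h3 α β (by simpa using ha) (by simpa using hb)
    have e : -η + -k = -(η + k) := by ring
    rw [e, abs_neg] at this
    exact this

/-- two points at the same vertical line -/
theorem CondP.two {K : ℝ} {ψ p : ℝ → ℝ → ℝ} {N : ℕ} {ξ η η' : ℝ} (hK : 0 ≤ K) (hle : η < η')
    (h : CondP K ψ p N ξ η) (h' : CondP K ψ p N ξ η') (hs : (η' - η) * (N + 1) < 1) :
    |p ξ η' - p ξ η| ≤ K * (η' - η) := by
  set k := (η' - η) / 2 with hk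
  have kpos : 0 < k := by rw [hk]; linarith
  have hN : (0:ℝ) ≤ N := Nat.cast_nonneg N
  have hk1 : |k| * (N + 1) < 1 := by
    rw [abs_of_pos kpos]; nlinarith
  have h1 := (h k hk1).1
  have h2 := (h' (-k) (by simpa using hk1)).1
  have e : η + k = η' + -k := by rw [hk]; ring
  rw [e] at h1
  rw [show ξ + -k = ξ - k by ring, show ξ - -k = ξ + k by ring] at h2
  rw [abs_le] at h1 h2 ⊢
  have : η' - η = 2 * k := by rw [hk]; ring
  rw [this]
  constructor
  · have : k * (-(K * k)) ≤ k * (p ξ η' - p ξ η) := by nlinarith [h1.1, h1.2, h2.1, h2.2]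
    have := le_of_mul_le_mul_left this kpos
    nlinarith [mul_nonneg hK kpos.le]
  · have : k * (p ξ η' - p ξ η) ≤ k * (K * k) := by nlinarith [h1.1, h1.2, h2.1, h2.2]
    have := le_of_mul_le_mul_left this kpos
    nlinarith [mul_nonneg hK kpos.le]

open Topology in
/-- p is continuous along points satisfying CondP N. -/
theorem CondP.tend {K : ℝ} {ψ p : ℝ → ℝ → ℝ} (hK : 0 ≤ K)
    (hc : Continuous (fun z : ℝ × ℝ => ψ z.1 z.2)) {N M : ℕ}
    {z : ℝ × ℝ} (hz : CondP K ψ p M z.1 z.2) (S : Set (ℝ × ℝ))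
    (hS : ∀ w ∈ S, CondP K ψ p N w.1 w.2) :
    Tendsto (fun w : ℝ × ℝ => p w.1 w.2) (𝓝[S] z) (𝓝 (p z.1 z.2)) := by
  rw [Metric.tendsto_nhds]
  intro ε hε
  have hN : (0:ℝ) ≤ N := Nat.cast_nonneg N
  have hM : (0:ℝ) ≤ M := Nat.cast_nonneg M
  obtain ⟨k, k0, hk1, hk2, hk3⟩ : ∃ k : ℝ, 0 < k ∧ k * (N + 1) < 1 ∧ k * (M + 1) < 1 ∧ K * k < ε / 2 := by
    have e1 : ∀ c : ℝ, ∀ d : ℝ, 0 < d → ∀ᶠ k : ℝ in 𝓝[>] 0, k * c < d := by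
      intro c d hd
      have : Tendsto (fun k : ℝ => k * c) (𝓝[>] 0) (𝓝 (0 * c)) :=
        (tendsto_nhdsWithin_of_tendsto_nhds (by exact (continuous_id.mul continuous_const).tendsto 0))
      rw [zero_mul] at this
      exact this.eventually (gt_mem_nhds hd)
    have := ((e1 (N+1) 1 one_pos).and ((e1 (M+1) 1 one_pos).and (e1 K (ε/2) (by linarith)))).and
      self_mem_nhdsWithin
    obtain ⟨k, ⟨a, b, c⟩, d⟩ := this.exists
    exact ⟨k, d, a, b, by linarith [mul_comm K k]⟩
  let A : ℝ × ℝ → ℝ := fun w => ψ (w.1 + k) (w.2 + k) - ψ (w.1 - k) (w.2 + k)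
  have hA : Continuous A := by
    have c1 : Continuous (fun w : ℝ × ℝ => ψ (w.1 + k) (w.2 + k)) :=
      hc.comp (by fun_prop : Continuous (fun w : ℝ × ℝ => (w.1 + k, w.2 + k)))
    have c2 : Continuous (fun w : ℝ × ℝ => ψ (w.1 - k) (w.2 + k)) :=
      hc.comp (by fun_prop : Continuous (fun w : ℝ × ℝ => (w.1 - k, w.2 + k)))
    exact c1.sub c2
  have ev : ∀ᶠ w in 𝓝[S] z, |A w - A z| < k * ε := by
    have := (Metric.tendsto_nhds.1 (hA.tendsto z)) (k * ε) (by positivity)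
    exact (this.filter_mono nhdsWithin_le_nhds)
  filter_upwards [ev, self_mem_nhdsWithin] with w hw hwS
  have h1 := (hS w hwS k (by rwa [abs_of_pos k0])).1
  have h2 := (hz k (by rwa [abs_of_pos k0])).1
  rw [Real.dist_eq]
  rw [abs_le] at h1 h2
  rw [abs_lt] at hw ⊢
  simp only [A] at hw
  have hkk : k * (K * k) < k * (ε / 2) := mul_lt_mul_of_pos_left hk3 k0
  constructor
  · have : k * (-ε) < k * (p w.1 w.2 - p z.1 z.2) := by nlinarith [h1.1, h1.2, h2.1, h2.2]
    exact lt_of_mul_lt_mul_left this k0.le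
  · have : k * (p w.1 w.2 - p z.1 z.2) < k * ε := by nlinarith [h1.1, h1.2, h2.1, h2.2]
    exact lt_of_mul_lt_mul_left this k0.le

open Topology in
/-- closedness of CondP -/
theorem CondP.closed {K : ℝ} {ψ p : ℝ → ℝ → ℝ} (hK : 0 ≤ K)
    (hc : Continuous (fun z : ℝ × ℝ => ψ z.1 z.2)) {N M : ℕ}
    {z : ℝ × ℝ} (hz : CondP K ψ p M z.1 z.2) (S : Set (ℝ × ℝ))
    (hS : ∀ w ∈ S, CondP K ψ p N w.1 w.2) (hcl : z ∈ closure S) : CondP K ψ p N z.1 z.2 := by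
  have ht := CondP.tend hK hc hz S hS
  have : (𝓝[S] z).NeBot := mem_closure_iff_nhdsWithin_neBot.1 hcl
  have cψ : ∀ a b : ℝ, Tendsto (fun w : ℝ × ℝ => ψ (w.1 + a) (w.2 + b)) (𝓝[S] z)
      (𝓝 (ψ (z.1 + a) (z.2 + b))) := by
    intro a b
    have : Continuous (fun w : ℝ × ℝ => ψ (w.1 + a) (w.2 + b)) :=
      hc.comp (by fun_prop : Continuous (fun w : ℝ × ℝ => (w.1 + a, w.2 + b)))
    exact (this.tendsto z).mono_left nhdsWithin_le_nhds
  intro k hk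
  constructor
  · have := (((cψ k k).sub (cψ (-k) k)).sub (ht.const_mul (2 * k))).abs
    refine le_of_tendsto this ?_
    filter_upwards [self_mem_nhdsWithin] with w hw
    exact (hS w hw k hk).1
  · intro α β ha hb
    have := (((cψ β k).sub (cψ α k)).sub (ht.const_mul (β - α))).pow 2
    refine le_of_tendsto this ?_
    filter_upwards [self_mem_nhdsWithin] with w hw
    exact (hS w hw k hk).2 α β ha hb


open Topology in
theorem lipP_up {K : ℝ} {ψ p : ℝ → ℝ → ℝ} (hK : 0 ≤ K)
    (hc : Continuous (fun z : ℝ × ℝ => ψ z.1 z.2)) (O : Set (ℝ × ℝ)) (hO : IsOpen O)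
    (hD : ∀ ξ η, (ξ, η) ∈ O → HasDerivAt (fun x => ψ x η) (p ξ η) ξ)
    (hL : ∀ ξ η η', η ≤ η' → (∀ l ∈ Set.Icc η η', (ξ, l) ∈ O) → |p ξ η' - p ξ η| ≤ K * (η' - η))
    (N : ℕ) (ξc ηc r : ℝ)
    (hB : ∀ ξ η, |ξ - ξc| < r → |η - ηc| < r → (ξ, η) ∉ O → CondP K ψ p N ξ η)
    {ξ η1 η2 : ℝ} (hξ : |ξ - ξc| < r) (hη1 : |η1 - ηc| < r) (hη2 : |η2 - ηc| < r)
    (hlt : η1 < η2) (h1 : (ξ, η1) ∉ O) (h2 : ∀ l ∈ Set.Ioc η1 η2, (ξ, l) ∈ O) :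
    |p ξ η2 - p ξ η1| ≤ K * (η2 - η1) := by
  apply le_of_forall_pos_le_add
  intro ε' hε'
  obtain ⟨ε, hε, hεe⟩ : ∃ ε : ℝ, 0 < ε ∧ ε' = 3 * ε := ⟨ε' / 3, by linarith, by ring⟩
  subst hεe
  have hN : (0:ℝ) ≤ N := Nat.cast_nonneg N
  -- continuity of p along bad points
  set S : Set (ℝ × ℝ) := {w | |w.1 - ξc| < r ∧ |w.2 - ηc| < r ∧ w ∉ O} with hS
  have hSC : ∀ w ∈ S, CondP K ψ p N w.1 w.2 := fun w hw => hB w.1 w.2 hw.1 hw.2.1 hw.2.2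
  have ht := CondP.tend hK hc (z := (ξ, η1)) (hB ξ η1 hξ hη1 h1) S hSC
  rw [Metric.tendsto_nhdsWithin_nhds] at ht
  obtain ⟨δ, hδ, htδ⟩ := ht ε hε
  -- derivative at the top
  have hd := (hD ξ η2 (h2 η2 ⟨hlt, le_refl _⟩)).isLittleO
  have hd2 := hd.def hε
  rw [Metric.eventually_nhds_iff] at hd2
  obtain ⟨ω1, hω1, hd3⟩ := hd2
  -- tube
  obtain ⟨ε1, hε1, hε1a, hε1b⟩ : ∃ e : ℝ, 0 < e ∧ e < δ ∧ e ≤ (η2 - η1) / 2 :=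
    ⟨min (δ / 2) ((η2 - η1) / 2), lt_min (by linarith) (by linarith),
      lt_of_le_of_lt (min_le_left _ _) (by linarith), min_le_right _ _⟩
  have htube : ∃ ω0 > 0, ∀ x, |x - ξ| < ω0 → ∀ l ∈ Set.Icc (η1 + ε1) η2, (x, l) ∈ O := by
    have : ({ξ} : Set ℝ) ×ˢ Set.Icc (η1 + ε1) η2 ⊆ O := by
      rintro ⟨x, l⟩ ⟨hx, hl⟩
      simp only [Set.mem_singleton_iff] at hx
      subst hx
      exact h2 l ⟨by have := hl.1; simp at this; linarith, hl.2⟩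
    obtain ⟨u, v, hu, hv, hu1, hv1, huv⟩ :=
      generalized_tube_lemma isCompact_singleton isCompact_Icc hO this
    have hu2 : u ∈ 𝓝 ξ := hu.mem_nhds (hu1 rfl)
    rw [Metric.mem_nhds_iff] at hu2
    obtain ⟨ω0, h0, hb⟩ := hu2
    exact ⟨ω0, h0, fun x hx l hl => huv ⟨hb (by simpa [Real.dist_eq] using hx), hv1 hl⟩⟩
  obtain ⟨ω0, hω0, htube⟩ := htube
  -- choose omega
  obtain ⟨ω, hω, a1, a2, a3, a4, a5, a6, a7⟩ : ∃ ω : ℝ, 0 < ω ∧ ω < ω0 ∧ ω < ω1 ∧ ω < δ ∧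
      2 * ω * (N + 1) < 1 ∧ ω < r - |ξ - ξc| ∧ 2 * N * ω < ε ^ 2 ∧ 2 * ω < (η2 - η1) / 2 := by
    have e1 : ∀ c : ℝ, ∀ d : ℝ, 0 < d → ∀ᶠ k : ℝ in 𝓝[>] 0, k * c < d := by
      intro c d hd
      have : Tendsto (fun k : ℝ => k * c) (𝓝[>] 0) (𝓝 (0 * c)) :=
        (tendsto_nhdsWithin_of_tendsto_nhds (by exact (continuous_id.mul continuous_const).tendsto 0))
      rw [zero_mul] at this
      exact this.eventually (gt_mem_nhds hd)
    have := ((e1 1 ω0 hω0).and ((e1 1 ω1 hω1).and ((e1 1 δ hδ).and ((e1 (2*(N+1)) 1 one_pos).and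
      ((e1 1 (r - |ξ - ξc|) (by linarith)).and ((e1 (2*N) (ε^2) (by positivity)).and
      (e1 2 ((η2-η1)/2) (by linarith)))))))).and
      self_mem_nhdsWithin
    obtain ⟨k, ⟨b1, b2, b3, b4, b5, b6, b7⟩, d⟩ := this.exists
    exact ⟨k, d, by linarith, by linarith, by linarith, by linarith, by linarith, by linarith, by linarith⟩
  -- maximal bad point
  set T : Set (ℝ × ℝ) := (Set.Icc (ξ - ω) (ξ + ω) ×ˢ Set.Icc η1 η2) \ O with hT
  have hTc : IsCompact T := (isCompact_Icc.prod isCompact_Icc).diff hO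
  have hTn : T.Nonempty := ⟨(ξ, η1), ⟨⟨by constructor <;> simp <;> linarith, by constructor <;> simp <;> linarith⟩, h1⟩⟩
  obtain ⟨z2, hz2, hmax⟩ := hTc.exists_isMaxOn hTn continuous_snd.continuousOn
  obtain ⟨⟨⟨hz2a, hz2b⟩, hz2c, hz2d⟩, hz2O⟩ := hz2
  have hζ : z2.2 < η1 + ε1 := by
    by_contra hcon
    push Not at hcon
    exact hz2O (htube z2.1 (by rw [abs_lt]; constructor <;> linarith) z2.2 ⟨hcon, hz2d⟩)
  have hz2S : z2 ∈ S := by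
    refine ⟨?_, ?_, hz2O⟩
    · have : |z2.1 - ξ| ≤ ω := by rw [abs_le]; constructor <;> linarith
      calc |z2.1 - ξc| = |(z2.1 - ξ) + (ξ - ξc)| := by ring_nf
        _ ≤ |z2.1 - ξ| + |ξ - ξc| := abs_add_le _ _
        _ < r := by linarith
    · rw [abs_lt] at hη1 hη2 ⊢
      constructor <;> linarith
  have hpz := htδ hz2S (by
    rw [Prod.dist_eq, Real.dist_eq, Real.dist_eq]
    apply max_lt
    · simp only; rw [abs_lt]; constructor <;> linarith
    · simp only; rw [abs_lt]; constructor <;> linarith)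
  rw [Real.dist_eq] at hpz
  simp only at hpz
  -- L2 at z2
  have hL2 := (hSC z2 hz2S (2 * ω) (by rw [abs_of_pos (by linarith)]; linarith)).2
    (ξ - ω - z2.1) (ξ + ω - z2.1)
    (by rw [abs_of_pos (by linarith : 0 < 2 * ω), abs_le]; constructor <;> linarith)
    (by rw [abs_of_pos (by linarith : 0 < 2 * ω), abs_le]; constructor <;> linarith)
  rw [abs_of_pos (by linarith : 0 < 2 * ω)] at hL2
  rw [show z2.1 + (ξ + ω - z2.1) = ξ + ω by ring, show z2.1 + (ξ - ω - z2.1) = ξ - ω by ring,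
    show (ξ + ω - z2.1 - (ξ - ω - z2.1)) = 2 * ω by ring] at hL2
  set ℓ := z2.2 + 2 * ω with hℓ
  have hgood : ∀ x ∈ Set.Icc (ξ - ω) (ξ + ω), ∀ l ∈ Set.Icc ℓ η2, (x, l) ∈ O := by
    intro x hx l hl
    by_contra hcon
    have : (x, l) ∈ T := ⟨⟨hx, ⟨by have := hl.1; linarith, hl.2⟩⟩, hcon⟩
    have h3 := hmax this
    simp at h3
    have := hl.1
    linarith
  have hℓ2 : ℓ ≤ η2 := by linarith
  have hL3 : |ψ (ξ + ω) ℓ - ψ (ξ - ω) ℓ - 2 * ω * p z2.1 z2.2| ≤ 2 * ω * ε := by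
    apply abs_le_of_sq_le_sq _ (by positivity)
    calc _ ≤ N * (2 * ω) ^ 3 := hL2
      _ = (2 * N * ω) * (4 * ω ^ 2) := by ring
      _ ≤ ε ^ 2 * (4 * ω ^ 2) := by gcongr
      _ = _ := by ring
  -- mean value
  have hMV : |(ψ (ξ + ω) η2 - ψ (ξ + ω) ℓ) - (ψ (ξ - ω) η2 - ψ (ξ - ω) ℓ)| ≤ K * (η2 - η1) * (2 * ω) := by
    have := (convex_Icc (ξ - ω) (ξ + ω)).norm_image_sub_le_of_norm_hasDerivWithin_le
      (f := fun x => ψ x η2 - ψ x ℓ) (f' := fun x => p x η2 - p x ℓ) (C := K * (η2 - η1))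
      (x := ξ - ω) (y := ξ + ω)
      (fun x hx => ((hD x η2 (hgood x hx _ ⟨hℓ2, le_rfl⟩)).sub
        (hD x ℓ (hgood x hx _ ⟨le_rfl, hℓ2⟩))).hasDerivWithinAt)
      (fun x hx => by
        rw [Real.norm_eq_abs]
        refine (hL x ℓ η2 hℓ2 (fun l hl => hgood x hx l hl)).trans ?_
        gcongr; linarith)
      ⟨le_rfl, by linarith⟩ ⟨by linarith, le_rfl⟩
    rw [Real.norm_eq_abs, Real.norm_eq_abs, show ξ + ω - (ξ - ω) = 2 * ω by ring,
      abs_of_pos (by linarith : 0 < 2 * ω)] at this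
    exact this
  have hda := hd3 (y := ξ + ω) (by simp [Real.dist_eq, abs_of_pos hω]; exact a2)
  have hdb := hd3 (y := ξ - ω) (by simp [Real.dist_eq, abs_of_pos hω]; exact a2)
  simp only [smul_eq_mul, Real.norm_eq_abs] at hda hdb
  rw [show ξ + ω - ξ = ω by ring, abs_of_pos hω] at hda
  rw [show ξ - ω - ξ = -ω by ring, abs_neg, abs_of_pos hω] at hdb
  rw [abs_le] at hda hdb hMV hL3 ⊢
  rw [abs_lt] at hpz
  have q1 : 2 * ω * (p ξ η2 - p ξ η1) ≤ 2 * ω * (K * (η2 - η1) + 3 * ε) := by nlinarith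
  have q2 : 2 * ω * (-(K * (η2 - η1) + 3 * ε)) ≤ 2 * ω * (p ξ η2 - p ξ η1) := by nlinarith
  exact ⟨le_of_mul_le_mul_left q2 (by linarith), le_of_mul_le_mul_left q1 (by linarith)⟩


theorem lipP_down {K : ℝ} {ψ p : ℝ → ℝ → ℝ} (hK : 0 ≤ K)
    (hc : Continuous (fun z : ℝ × ℝ => ψ z.1 z.2)) (O : Set (ℝ × ℝ)) (hO : IsOpen O)
    (hD : ∀ ξ η, (ξ, η) ∈ O → HasDerivAt (fun x => ψ x η) (p ξ η) ξ)
    (hL : ∀ ξ η η', η ≤ η' → (∀ l ∈ Set.Icc η η', (ξ, l) ∈ O) → |p ξ η' - p ξ η| ≤ K * (η' - η))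
    (N : ℕ) (ξc ηc r : ℝ)
    (hB : ∀ ξ η, |ξ - ξc| < r → |η - ηc| < r → (ξ, η) ∉ O → CondP K ψ p N ξ η)
    {ξ η1 η2 : ℝ} (hξ : |ξ - ξc| < r) (hη1 : |η1 - ηc| < r) (hη2 : |η2 - ηc| < r)
    (hlt : η1 < η2) (h1 : (ξ, η2) ∉ O) (h2 : ∀ l ∈ Set.Ico η1 η2, (ξ, l) ∈ O) :
    |p ξ η2 - p ξ η1| ≤ K * (η2 - η1) := by
  have hnn : Continuous (fun z : ℝ × ℝ => (z.1, -z.2)) := by fun_prop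
  have := lipP_up (K := K) (ψ := fun a b => ψ a (-b)) (p := fun a b => p a (-b)) hK
    (hc.comp hnn) ((fun z : ℝ × ℝ => (z.1, -z.2)) ⁻¹' O) (hO.preimage hnn)
    (fun ξ η h => hD ξ (-η) h)
    (fun ξ η η' hle h => by
      have := hL ξ (-η') (-η) (by linarith) (fun l hl => by
        have := h (-l) ⟨by have := hl.2; linarith, by have := hl.1; linarith⟩
        simpa using this)
      rw [abs_sub_comm]
      simpa [add_comm, sub_eq_add_neg] using this)
    N ξc (-ηc) r
    (fun ξ η ha hb hn => CondP.reflect (hB ξ (-η) ha (by rw [← abs_neg]; convert hb using 2; ring) hn))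
    (ξ := ξ) (η1 := -η2) (η2 := -η1) hξ
    (by rw [← abs_neg]; convert hη2 using 2; ring)
    (by rw [← abs_neg]; convert hη1 using 2; ring) (by linarith) (by simpa using h1)
    (fun l hl => h2 (-l) ⟨by have := hl.2; linarith, by have := hl.1; linarith⟩)
  rw [abs_sub_comm]
  simpa [add_comm, sub_eq_add_neg] using this

theorem lipP_box {K : ℝ} {ψ p : ℝ → ℝ → ℝ} (hK : 0 ≤ K)
    (hc : Continuous (fun z : ℝ × ℝ => ψ z.1 z.2)) (O : Set (ℝ × ℝ)) (hO : IsOpen O)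
    (hD : ∀ ξ η, (ξ, η) ∈ O → HasDerivAt (fun x => ψ x η) (p ξ η) ξ)
    (hL : ∀ ξ η η', η ≤ η' → (∀ l ∈ Set.Icc η η', (ξ, l) ∈ O) → |p ξ η' - p ξ η| ≤ K * (η' - η))
    (N : ℕ) (ξc ηc r : ℝ) (hr : 2 * r * (N + 1) < 1)
    (hB : ∀ ξ η, |ξ - ξc| < r → |η - ηc| < r → (ξ, η) ∉ O → CondP K ψ p N ξ η)
    {ξ η1 η2 : ℝ} (hξ : |ξ - ξc| < r) (hη1 : |η1 - ηc| < r) (hη2 : |η2 - ηc| < r)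
    (hlt : η1 ≤ η2) :
    |p ξ η2 - p ξ η1| ≤ K * (η2 - η1) := by
  have hN : (0:ℝ) ≤ N := Nat.cast_nonneg N
  have hbox : ∀ l, η1 ≤ l → l ≤ η2 → |l - ηc| < r := by
    intro l h1 h2
    rw [abs_lt] at hη1 hη2 ⊢
    constructor <;> linarith
  set T : Set ℝ := Set.Icc η1 η2 ∩ (fun l => (ξ, l)) ⁻¹' Oᶜ with hT
  have hTc : IsCompact T := isCompact_Icc.inter_right (hO.isClosed_compl.preimage (by fun_prop))
  rcases T.eq_empty_or_nonempty with he | hne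
  · apply hL _ _ _ hlt
    intro l hl
    by_contra hcon
    have : l ∈ T := ⟨hl, hcon⟩
    rw [he] at this
    exact this
  · obtain ⟨la, hla, hmin⟩ := hTc.exists_isMinOn hne continuous_id.continuousOn
    obtain ⟨lb, hlb, hmax⟩ := hTc.exists_isMaxOn hne continuous_id.continuousOn
    have hab : la ≤ lb := hmin hlb
    have i1 : |p ξ la - p ξ η1| ≤ K * (la - η1) := by
      rcases hla.1.1.eq_or_lt with h | h
      · simp [h]
      · refine lipP_down hK hc O hO hD hL N ξc ηc r hB hξ hη1 (hbox _ hla.1.1 hla.1.2) h hla.2 ?_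
        intro l hl
        by_contra hcon
        have : l ∈ T := ⟨⟨hl.1, hl.2.le.trans hla.1.2⟩, hcon⟩
        have := hmin this
        simp at this
        linarith [hl.2]
    have i2 : |p ξ η2 - p ξ lb| ≤ K * (η2 - lb) := by
      rcases hlb.1.2.eq_or_lt with h | h
      · simp [h]
      · refine lipP_up hK hc O hO hD hL N ξc ηc r hB hξ (hbox _ hlb.1.1 hlb.1.2) hη2 h hlb.2 ?_
        intro l hl
        by_contra hcon
        have : l ∈ T := ⟨⟨hlb.1.1.trans hl.1.le, hl.2⟩, hcon⟩
        have := hmax this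
        simp at this
        linarith [hl.1]
    have i3 : |p ξ lb - p ξ la| ≤ K * (lb - la) := by
      rcases hab.eq_or_lt with h | h
      · simp [h]
      · refine CondP.two hK h (hB _ _ hξ (hbox _ hla.1.1 hla.1.2) hla.2)
          (hB _ _ hξ (hbox _ hlb.1.1 hlb.1.2) hlb.2) ?_
        have h1 := hbox _ hla.1.1 hla.1.2
        have h2 := hbox _ hlb.1.1 hlb.1.2
        rw [abs_lt] at h1 h2
        have : lb - la < 2 * r := by linarith
        nlinarith
    rw [abs_le] at *
    constructor <;> linarith [i1.1, i1.2, i2.1, i2.2, i3.1, i3.2]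

/-- Local Lipschitz with constant K implies Lipschitz on segments. -/
theorem lip_of_local {K : ℝ} (hK : 0 ≤ K) (f : ℝ → ℝ) {a b : ℝ} (hab : a ≤ b)
    (h : ∀ l ∈ Set.Icc a b, ∃ r > 0, ∀ x, |x - l| < r → |f x - f l| ≤ K * |x - l|) :
    |f b - f a| ≤ K * (b - a) := by
  have hcont : ContinuousOn f (Set.Icc a b) := by
    intro l hl
    apply ContinuousAt.continuousWithinAt
    obtain ⟨r, hr, hh⟩ := h l hl
    rw [Metric.continuousAt_iff]
    intro ε hε
    refine ⟨min r (ε / (K + 1)), lt_min hr (by positivity), ?_⟩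
    intro x hx
    rw [Real.dist_eq] at *
    have h1 := hh x (lt_of_lt_of_le hx (min_le_left _ _))
    have h2 := lt_of_lt_of_le hx (min_le_right _ _)
    rw [lt_div_iff₀ (by positivity)] at h2
    nlinarith [abs_nonneg (x - l)]
  have := image_le_of_liminf_slope_right_le_deriv_boundary (f := fun x => |f x - f a|)
    (a := a) (b := b) (hcont.sub continuousOn_const).abs
    (B := fun x => K * (x - a)) (B' := fun _ => K) (by simp)
    (by fun_prop)
    (by intro x hx; simpa using (((hasDerivAt_id x).sub_const a).const_mul K).hasDerivWithinAt)
    (by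
      intro x hx r hr
      obtain ⟨r0, hr0, hh⟩ := h x ⟨hx.1, hx.2.le⟩
      apply Eventually.frequently
      have : Set.Ioo x (x + r0) ∈ nhdsWithin x (Set.Ioi x) := Ioo_mem_nhdsGT (by linarith)
      filter_upwards [this] with z hz
      simp only [slope, vsub_eq_sub, smul_eq_mul]
      have hzx : 0 < z - x := by linarith [hz.1]
      have h1 := hh z (by rw [abs_of_pos hzx]; linarith [hz.2])
      have h2 : |f z - f a| - |f x - f a| ≤ |f z - f x| := by
        have := abs_sub_abs_le_abs_sub (f z - f a) (f x - f a)
        simpa using this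
      rw [abs_of_pos hzx] at h1
      rw [inv_mul_lt_iff₀ hzx]
      nlinarith)
  exact this ⟨hab, le_rfl⟩


open Topology in
/-- chain rule for functions with continuous partial derivatives along curves -/
theorem partial_curve {f f1 f2 : ℝ → ℝ → ℝ} {g1 g2 : ℝ → ℝ} {g1' g2' τ : ℝ}
    (d1 : ∀ᶠ v : ℝ × ℝ in 𝓝 (g1 τ, g2 τ), HasDerivAt (fun a => f a v.2) (f1 v.1 v.2) v.1)
    (d2 : ∀ᶠ v : ℝ × ℝ in 𝓝 (g1 τ, g2 τ), HasDerivAt (fun a => f v.1 a) (f2 v.1 v.2) v.2)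
    (c1 : ContinuousAt (fun v : ℝ × ℝ => f1 v.1 v.2) (g1 τ, g2 τ))
    (c2 : ContinuousAt (fun v : ℝ × ℝ => f2 v.1 v.2) (g1 τ, g2 τ))
    (h1 : HasDerivAt g1 g1' τ) (h2 : HasDerivAt g2 g2' τ) :
    HasDerivAt (fun s => f (g1 s) (g2 s)) (f1 (g1 τ) (g2 τ) * g1' + f2 (g1 τ) (g2 τ) * g2') τ := by
  have hs := hasStrictFDerivAt_uncurry_coprod (𝕜 := ℝ) (u := (g1 τ, g2 τ)) (f := f)
    (f₁ := fun a b => ContinuousLinearMap.toSpanSingleton ℝ (f1 a b))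
    (f₂ := fun a b => ContinuousLinearMap.toSpanSingleton ℝ (f2 a b))
    (d1.mono fun v hv => hv.hasFDerivAt) (d2.mono fun v hv => hv.hasFDerivAt)
    (by
      exact ((ContinuousLinearMap.toSpanSingletonCLE (𝕜 := ℝ) (E := ℝ)).continuous.continuousAt).comp c1)
    (by
      exact ((ContinuousLinearMap.toSpanSingletonCLE (𝕜 := ℝ) (E := ℝ)).continuous.continuousAt).comp c2)
  have := hs.hasFDerivAt.comp_hasDerivAt τ (h1.prodMk h2)
  refine HasDerivAt.congr_deriv (f := fun s => f (g1 s) (g2 s)) this ?_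
  simp [Function.HasUncurry.uncurry, mul_comm]

/-- abstract null-coordinates regularity package -/
structure NullReg (Ω : Set (ℝ × ℝ)) (K : ℝ) (ψ p q : ℝ → ℝ → ℝ) : Prop where
  op : IsOpen Ω
  hK : 0 ≤ K
  cont : Continuous (fun z : ℝ × ℝ => ψ z.1 z.2)
  D1 : ∀ ξ η, (ξ, η) ∈ Ω → HasDerivAt (fun h => ψ (ξ + h) (η + h)) (p ξ η + q ξ η) 0
  D2 : ∀ ξ η, (ξ, η) ∈ Ω → HasDerivAt (fun h => ψ (ξ + h) (η - h)) (p ξ η - q ξ η) 0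
  CT : ∀ ξ η, (ξ, η) ∈ Ω → ContinuousAt (fun h => p (ξ + h) (η + h) + q (ξ + h) (η + h)) 0
  CP : ∀ ξ η, (ξ, η) ∈ Ω → ∃ N, CondP K ψ p N ξ η
  CQ : ∀ ξ η, (ξ, η) ∈ Ω → ∃ N, CondP K (fun a b => ψ b a) (fun a b => q b a) N η ξ

theorem NullReg.swap {Ω : Set (ℝ × ℝ)} {K : ℝ} {ψ p q : ℝ → ℝ → ℝ} (h : NullReg Ω K ψ p q) :
    NullReg (Prod.swap ⁻¹' Ω) K (fun a b => ψ b a) (fun a b => q b a) (fun a b => p b a) where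
  op := h.op.preimage continuous_swap
  hK := h.hK
  cont := h.cont.comp continuous_swap
  D1 := fun ξ η hz => by simpa [add_comm] using h.D1 η ξ hz
  D2 := fun ξ η hz => by
    have h1 := h.D2 η ξ hz
    have h2 : HasDerivAt (fun x : ℝ => -x) (-1) 0 := hasDerivAt_neg 0
    have h3 := HasDerivAt.comp (0:ℝ) (by simpa using h1) h2
    have e : (fun x : ℝ => ψ (η - x) (ξ + x)) = (fun x => ψ (η + x) (ξ - x)) ∘ fun x => -x := by
      ext x; simp [sub_eq_add_neg]
    rw [← e] at h3
    exact h3.congr_deriv (by ring)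
  CT := fun ξ η hz => by simpa [add_comm] using h.CT η ξ hz
  CP := fun ξ η hz => h.CQ η ξ hz
  CQ := fun ξ η hz => h.CP η ξ hz

open Topology in
theorem NullReg.contP {Ω : Set (ℝ × ℝ)} {K : ℝ} {ψ p q : ℝ → ℝ → ℝ} (h : NullReg Ω K ψ p q)
    {ξc ηc r : ℝ} (hB : ∀ ξ η, |ξ - ξc| < r → |η - ηc| < r → (ξ, η) ∈ Ω)
    (hp : ∀ ξ η η', |ξ - ξc| < r → |η - ηc| < r → |η' - ηc| < r → |p ξ η' - p ξ η| ≤ K * |η' - η|)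
    (hq : ∀ ξ ξ' η, |ξ - ξc| < r → |ξ' - ξc| < r → |η - ηc| < r → |q ξ' η - q ξ η| ≤ K * |ξ' - ξ|)
    {ξ0 η0 : ℝ} (hξ : |ξ0 - ξc| < r) (hη : |η0 - ηc| < r) :
    ContinuousAt (fun w : ℝ × ℝ => p w.1 w.2) (ξ0, η0) := by
  have hK := h.hK
  rw [Metric.continuousAt_iff]
  intro ε hε
  obtain ⟨d, hd, hd1, hd2⟩ : ∃ d : ℝ, 0 < d ∧ d < r - |η0 - ηc| ∧ K * d < ε / 4 := by
    have hKp : 0 < K + 1 := by linarith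
    refine ⟨min ((r - |η0 - ηc|) / 2) (ε / (4 * (K + 1))) / 2, ?_, ?_, ?_⟩
    · have : 0 < min ((r - |η0 - ηc|) / 2) (ε / (4 * (K + 1))) := lt_min (by linarith) (by positivity)
      linarith
    · have := min_le_left ((r - |η0 - ηc|) / 2) (ε / (4 * (K + 1)))
      linarith
    · have h1 := min_le_right ((r - |η0 - ηc|) / 2) (ε / (4 * (K + 1)))
      have h2 : ε / (4 * (K + 1)) * (K + 1) = ε / 4 := by field_simp
      have h3 : 0 < ε / (4 * (K + 1)) := by positivity
      have h4 : 0 < min ((r - |η0 - ηc|) / 2) (ε / (4 * (K + 1))) := lt_min (by linarith) (by positivity)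
      nlinarith
  have hbox : ∀ l, |l - η0| ≤ d → |l - ηc| < r := by
    intro l hl
    calc |l - ηc| = |(l - η0) + (η0 - ηc)| := by ring_nf
      _ ≤ |l - η0| + |η0 - ηc| := abs_add_le _ _
      _ < r := by linarith
  -- Baire on the slice
  let cl : ℝ → ℝ := fun l => max (η0 - d) (min l (η0 + d))
  have hcl : Continuous cl := by fun_prop
  have hcl1 : ∀ l, |cl l - η0| ≤ d := by
    intro l
    rw [abs_le]
    constructor
    · have : η0 - d ≤ cl l := le_max_left _ _
      linarith
    · have : cl l ≤ η0 + d := max_le (by linarith) (min_le_right _ _)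
      linarith
  let CQ : ℕ → ℝ × ℝ → Prop := fun N w => CondP K (fun a b => ψ b a) (fun a b => q b a) N w.1 w.2
  have hcs := h.swap.cont
  let A : ℕ → Set ℝ := fun N => {l | CQ N (cl l, ξ0)}
  have hAc : ∀ N, IsClosed (A N) := by
    intro N
    apply isClosed_of_closure_subset
    intro x hx
    obtain ⟨M, hM⟩ := h.CQ ξ0 (cl x) (hB _ _ hξ (hbox _ (hcl1 x)))
    have hcm : Continuous (fun l => (cl l, ξ0)) := by fun_prop
    have := image_closure_subset_closure_image hcm (s := A N) ⟨x, hx, rfl⟩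
    refine CondP.closed hK hcs (z := (cl x, ξ0)) hM ((fun l => (cl l, ξ0)) '' A N) ?_ this
    rintro w ⟨l, hl, rfl⟩
    exact hl
  have hAU : ⋃ N, A N = Set.univ := by
    apply Set.eq_univ_of_forall
    intro x
    obtain ⟨M, hM⟩ := h.CQ ξ0 (cl x) (hB _ _ hξ (hbox _ (hcl1 x)))
    exact Set.mem_iUnion.2 ⟨M, hM⟩
  have hdense := dense_iUnion_interior_of_closed hAc hAU
  obtain ⟨e, he1, he2⟩ := hdense.exists_mem_open (isOpen_Ioo (a := η0 - d) (b := η0 + d))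
    ⟨η0, by constructor <;> linarith⟩
  obtain ⟨N, hN⟩ := Set.mem_iUnion.1 he1
  have hed : |e - η0| ≤ d := by rw [abs_le]; constructor <;> linarith [he2.1, he2.2]
  have hclid : ∀ l ∈ Set.Ioo (η0 - d) (η0 + d), cl l = l := by
    intro l hl
    simp only [cl]
    rw [min_eq_left hl.2.le, max_eq_right hl.1.le]
  have hqc : Tendsto (fun l => q ξ0 l) (𝓝 e) (𝓝 (q ξ0 e)) := by
    obtain ⟨M, hM⟩ := h.CQ ξ0 e (hB _ _ hξ (hbox _ hed))
    have ht := CondP.tend hK hcs (N := N) (z := (e, ξ0)) hM {w | CQ N w} (fun w hw => hw)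
    have hm : Tendsto (fun l => (l, ξ0)) (𝓝 e) (𝓝[{w | CQ N w}] (e, ξ0)) := by
      apply tendsto_nhdsWithin_of_tendsto_nhds_of_eventually_within
      · exact (by fun_prop : Continuous (fun l : ℝ => (l, ξ0))).tendsto e
      · filter_upwards [mem_interior_iff_mem_nhds.1 hN, isOpen_Ioo.mem_nhds he2] with l hl hl2
        have : CQ N (cl l, ξ0) := hl
        rw [hclid l hl2] at this
        exact this
    exact ht.comp hm
  -- p continuous in xi at e
  have hct := h.CT ξ0 e (hB _ _ hξ (hbox _ hed))
  have hqc2 : Tendsto (fun x : ℝ => q ξ0 (e + x)) (𝓝 0) (𝓝 (q ξ0 e)) := by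
    apply hqc.comp
    simpa using (by fun_prop : Continuous (fun x : ℝ => e + x)).tendsto 0
  have hpc : Tendsto (fun x : ℝ => p (ξ0 + x) e) (𝓝 0) (𝓝 (p ξ0 e)) := by
    have hnear : ∀ᶠ x : ℝ in 𝓝 0, |ξ0 + x - ξc| < r ∧ |e + x - ηc| < r := by
      have c1 : Continuous (fun x : ℝ => |ξ0 + x - ξc|) := by fun_prop
      have c2 : Continuous (fun x : ℝ => |e + x - ηc|) := by fun_prop
      have t1 := (c1.tendsto 0).eventually (gt_mem_nhds (b := |ξ0 + 0 - ξc|) (a := r) (by simpa using hξ))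
      have t2 := (c2.tendsto 0).eventually (gt_mem_nhds (b := |e + 0 - ηc|) (a := r) (by simpa using hbox e hed))
      exact t1.and t2
    have t3 : Tendsto (fun x : ℝ => (p (ξ0 + x) (e + x) + q (ξ0 + x) (e + x)) - q ξ0 (e + x)) (𝓝 0)
        (𝓝 (p ξ0 e)) := by
      have := hct.tendsto.sub hqc2
      simpa using this
    have t4 : Tendsto (fun x : ℝ => p (ξ0 + x) e - ((p (ξ0 + x) (e + x) + q (ξ0 + x) (e + x)) - q ξ0 (e + x)))
        (𝓝 0) (𝓝 0) := by
      apply squeeze_zero_norm' (a := fun x => 2 * K * |x|)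
      · filter_upwards [hnear] with x hx
        have h1 := hp (ξ0 + x) e (e + x) hx.1 (hbox e hed) hx.2
        have h2 := hq ξ0 (ξ0 + x) (e + x) hξ hx.1 hx.2
        rw [show e + x - e = x by ring] at h1
        rw [show ξ0 + x - ξ0 = x by ring] at h2
        rw [Real.norm_eq_abs]
        rw [abs_le] at *
        constructor <;> linarith [h1.1, h1.2, h2.1, h2.2]
      · have : Continuous (fun x : ℝ => 2 * K * |x|) := by fun_prop
        simpa using this.tendsto 0
    have := t4.add t3
    simpa using this
  rw [Metric.tendsto_nhds] at hpc
  have hpc2 := hpc (ε / 4) (by linarith)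
  rw [Metric.eventually_nhds_iff] at hpc2
  obtain ⟨δ, hδ, hpc3⟩ := hpc2
  refine ⟨min (min δ d) (r - |ξ0 - ξc|), lt_min (lt_min hδ hd) (by linarith), ?_⟩
  rintro ⟨x, y⟩ hxy
  rw [Prod.dist_eq] at hxy
  simp only at hxy ⊢
  rw [Real.dist_eq, Real.dist_eq, max_lt_iff, lt_min_iff, lt_min_iff, lt_min_iff, lt_min_iff] at hxy
  obtain ⟨⟨⟨x1, x2⟩, x3⟩, ⟨y1, y2⟩, y3⟩ := hxy
  have hxr : |x - ξc| < r := by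
    calc |x - ξc| = |(x - ξ0) + (ξ0 - ξc)| := by ring_nf
      _ ≤ |x - ξ0| + |ξ0 - ξc| := abs_add_le _ _
      _ < r := by linarith
  have g1 := hp x e y hxr (hbox e hed) (hbox y y2.le)
  have g2 := hpc3 (y := x - ξ0) (by simpa [Real.dist_eq] using x1)
  have g3 := hp ξ0 e η0 hξ (hbox e hed) hη
  rw [show ξ0 + (x - ξ0) = x by ring, Real.dist_eq] at g2
  have g4 : |y - e| ≤ 2 * d := by
    rw [abs_le] at hed; rw [abs_lt] at y2; rw [abs_le]; constructor <;> linarith [hed.1, hed.2, y2.1, y2.2]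
  have g5 : |η0 - e| ≤ d := by rw [abs_sub_comm]; exact hed
  have g6 : K * |y - e| ≤ K * (2 * d) := by gcongr
  have g7 : K * |η0 - e| ≤ K * d := by gcongr
  rw [Real.dist_eq]
  rw [abs_le] at g1 g3
  rw [abs_lt] at g2 ⊢
  constructor <;> linarith [g1.1, g1.2, g2.1, g2.2, g3.1, g3.2]


def GoodPt (Ω : Set (ℝ × ℝ)) (K : ℝ) (p q : ℝ → ℝ → ℝ) (z : ℝ × ℝ) : Prop :=
  ∃ r > 0, (∀ ξ η, |ξ - z.1| < r → |η - z.2| < r → (ξ, η) ∈ Ω) ∧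
    (∀ ξ η η', |ξ - z.1| < r → |η - z.2| < r → |η' - z.2| < r → |p ξ η' - p ξ η| ≤ K * |η' - η|) ∧
    (∀ ξ ξ' η, |ξ - z.1| < r → |ξ' - z.1| < r → |η - z.2| < r → |q ξ' η - q ξ η| ≤ K * |ξ' - ξ|)

theorem GoodPt.swap {Ω : Set (ℝ × ℝ)} {K : ℝ} {p q : ℝ → ℝ → ℝ} {z : ℝ × ℝ}
    (h : GoodPt Ω K p q z) :
    GoodPt (Prod.swap ⁻¹' Ω) K (fun a b => q b a) (fun a b => p b a) z.swap := by
  obtain ⟨r, hr, h1, h2, h3⟩ := h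
  exact ⟨r, hr, fun ξ η a b => h1 η ξ b a, fun ξ η η' a b c => h3 η η' ξ b c a,
    fun ξ ξ' η a b c => h2 η ξ ξ' c a b⟩

theorem isOpen_goodPt (Ω : Set (ℝ × ℝ)) (K : ℝ) (p q : ℝ → ℝ → ℝ) : IsOpen {z | GoodPt Ω K p q z} := by
  rw [Metric.isOpen_iff]
  rintro z ⟨r, hr, h1, h2, h3⟩
  refine ⟨r / 2, by linarith, ?_⟩
  intro w hw
  rw [Metric.mem_ball, Prod.dist_eq, max_lt_iff, Real.dist_eq, Real.dist_eq] at hw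
  have e1 : ∀ x, |x - w.1| < r / 2 → |x - z.1| < r := by
    intro x hx
    have := hw.1
    rw [abs_lt] at *; constructor <;> linarith [hx.1, hx.2, this.1, this.2]
  have e2 : ∀ x, |x - w.2| < r / 2 → |x - z.2| < r := by
    intro x hx
    have := hw.2
    rw [abs_lt] at *; constructor <;> linarith [hx.1, hx.2, this.1, this.2]
  exact ⟨r / 2, by linarith, fun ξ η a b => h1 ξ η (e1 _ a) (e2 _ b),
    fun ξ η η' a b c => h2 ξ η η' (e1 _ a) (e2 _ b) (e2 _ c),
    fun ξ ξ' η a b c => h3 ξ ξ' η (e1 _ a) (e1 _ b) (e2 _ c)⟩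

theorem NullReg.good_contP {Ω : Set (ℝ × ℝ)} {K : ℝ} {ψ p q : ℝ → ℝ → ℝ} (h : NullReg Ω K ψ p q)
    {z : ℝ × ℝ} (hz : GoodPt Ω K p q z) : ContinuousAt (fun w : ℝ × ℝ => p w.1 w.2) z := by
  obtain ⟨r, hr, h1, h2, h3⟩ := hz
  exact h.contP h1 h2 h3 (by simpa using hr) (by simpa using hr)

theorem NullReg.good_contQ {Ω : Set (ℝ × ℝ)} {K : ℝ} {ψ p q : ℝ → ℝ → ℝ} (h : NullReg Ω K ψ p q)
    {z : ℝ × ℝ} (hz : GoodPt Ω K p q z) : ContinuousAt (fun w : ℝ × ℝ => q w.1 w.2) z := by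
  have := h.swap.good_contP hz.swap
  exact ContinuousAt.comp (g := fun w : ℝ × ℝ => q w.2 w.1) (f := Prod.swap) this
    continuous_swap.continuousAt

open Topology in
theorem NullReg.good_deriv {Ω : Set (ℝ × ℝ)} {K : ℝ} {ψ p q : ℝ → ℝ → ℝ} (h : NullReg Ω K ψ p q)
    {ξ η : ℝ} (hz : GoodPt Ω K p q (ξ, η)) : HasDerivAt (fun x => ψ x η) (p ξ η) ξ := by
  have hΩ : (ξ, η) ∈ Ω := by
    obtain ⟨r, hr, h1, -, -⟩ := hz
    exact h1 ξ η (by simpa using hr) (by simpa using hr)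
  let L : ℝ × ℝ → ℝ × ℝ := fun v => (v.1 + v.2, v.1 - v.2)
  have hL : Continuous L := by fun_prop
  have hL0 : L ((ξ + η) / 2, (ξ - η) / 2) = (ξ, η) := by simp only [L]; ext <;> simp <;> ring
  have evΩ : ∀ᶠ v in 𝓝 ((ξ + η) / 2, (ξ - η) / 2), L v ∈ Ω := by
    apply hL.continuousAt.eventually_mem
    rw [hL0]
    exact h.op.mem_nhds hΩ
  have cp : ContinuousAt (fun v : ℝ × ℝ => p (v.1 + v.2) (v.1 - v.2)) ((ξ + η) / 2, (ξ - η) / 2) := by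
    refine ContinuousAt.comp (g := fun w : ℝ × ℝ => p w.1 w.2) (f := L) ?_ hL.continuousAt
    rw [hL0]; exact h.good_contP hz
  have cq : ContinuousAt (fun v : ℝ × ℝ => q (v.1 + v.2) (v.1 - v.2)) ((ξ + η) / 2, (ξ - η) / 2) := by
    refine ContinuousAt.comp (g := fun w : ℝ × ℝ => q w.1 w.2) (f := L) ?_ hL.continuousAt
    rw [hL0]; exact h.good_contQ hz
  have key := partial_curve (f := fun s x => ψ (s + x) (s - x))
    (f1 := fun s x => p (s + x) (s - x) + q (s + x) (s - x))
    (f2 := fun s x => p (s + x) (s - x) - q (s + x) (s - x))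
    (g1 := fun y => (y + η) / 2) (g2 := fun y => (y - η) / 2) (g1' := 1 / 2) (g2' := 1 / 2) (τ := ξ)
    (by
      filter_upwards [evΩ] with v hv
      have h1 := h.D1 _ _ hv
      have h2 : HasDerivAt (fun a : ℝ => a - v.1) 1 v.1 := (hasDerivAt_id v.1).sub_const _
      have h3 := HasDerivAt.comp v.1 (by simpa using h1) h2
      rw [mul_one] at h3
      refine h3.congr_of_eventuallyEq (Eventually.of_forall fun a => ?_)
      simp only [Function.comp]
      congr 1 <;> ring)
    (by
      filter_upwards [evΩ] with v hv
      have h1 := h.D2 _ _ hv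
      have h2 : HasDerivAt (fun a : ℝ => a - v.2) 1 v.2 := (hasDerivAt_id v.2).sub_const _
      have h3 := HasDerivAt.comp v.2 (by simpa using h1) h2
      rw [mul_one] at h3
      refine h3.congr_of_eventuallyEq (Eventually.of_forall fun a => ?_)
      simp only [Function.comp]
      congr 1 <;> ring)
    (cp.add cq) (cp.sub cq)
    (by simpa using ((hasDerivAt_id ξ).add_const η).div_const 2)
    (by simpa using ((hasDerivAt_id ξ).sub_const η).div_const 2)
  have e : (fun s => ψ ((s + η) / 2 + (s - η) / 2) ((s + η) / 2 - (s - η) / 2)) = fun x => ψ x η := by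
    ext s
    congr 1 <;> ring
  rw [e, show (ξ + η) / 2 + (ξ - η) / 2 = ξ by ring, show (ξ + η) / 2 - (ξ - η) / 2 = η by ring] at key
  exact key.congr_deriv (by ring)

theorem good_lip {Ω : Set (ℝ × ℝ)} {K : ℝ} {p q : ℝ → ℝ → ℝ} (hK : 0 ≤ K) {ξ η η' : ℝ}
    (hle : η ≤ η') (h : ∀ l ∈ Set.Icc η η', GoodPt Ω K p q (ξ, l)) :
    |p ξ η' - p ξ η| ≤ K * (η' - η) := by
  refine lip_of_local hK (p ξ) hle ?_
  intro l hl
  obtain ⟨r, hr, -, h2, -⟩ := h l hl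
  exact ⟨r, hr, fun x hx => h2 ξ l x (by simpa using hr) (by simpa using hr) hx⟩

theorem exists_box {W : Set (ℝ × ℝ)} (hW : IsOpen W) {z : ℝ × ℝ} (hz : z ∈ W) :
    ∃ r > 0, ∀ ξ η, |ξ - z.1| < r → |η - z.2| < r → (ξ, η) ∈ W := by
  obtain ⟨r, hr, h⟩ := Metric.isOpen_iff.1 hW z hz
  refine ⟨r, hr, fun ξ η a b => h ?_⟩
  rw [Metric.mem_ball, Prod.dist_eq, max_lt_iff, Real.dist_eq, Real.dist_eq]
  exact ⟨a, b⟩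

theorem NullReg.all_good {Ω : Set (ℝ × ℝ)} {K : ℝ} {ψ p q : ℝ → ℝ → ℝ} (h : NullReg Ω K ψ p q)
    {z0 : ℝ × ℝ} (hz0 : z0 ∈ Ω) : GoodPt Ω K p q z0 := by
  by_contra hbad
  have hK := h.hK
  set O : Set (ℝ × ℝ) := {z | GoodPt Ω K p q z} with hOdef
  have hO : IsOpen O := isOpen_goodPt Ω K p q
  obtain ⟨ρ, hρ, hball⟩ := Metric.nhds_basis_closedBall.mem_iff.1 (h.op.mem_nhds hz0)
  set Z : Set (ℝ × ℝ) := closure (Oᶜ ∩ Metric.ball z0 ρ) with hZ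
  have hZ1 : Z ⊆ Metric.closedBall z0 ρ :=
    closure_minimal (Set.inter_subset_right.trans Metric.ball_subset_closedBall) Metric.isClosed_closedBall
  have hZΩ : Z ⊆ Ω := hZ1.trans hball
  have hZc : IsClosed Z := isClosed_closure
  have hzZ : z0 ∈ Z := subset_closure ⟨hbad, Metric.mem_ball_self hρ⟩
  have : Nonempty Z := ⟨⟨z0, hzZ⟩⟩
  have : CompleteSpace Z := hZc.completeSpace_coe
  have hcs := h.swap.cont
  let CP : ℕ → Set (ℝ × ℝ) := fun N => {w | CondP K ψ p N w.1 w.2}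
  let CQ : ℕ → Set (ℝ × ℝ) := fun N => {w | CondP K (fun a b => ψ b a) (fun a b => q b a) N w.2 w.1}
  let A : ℕ × ℕ → Set Z := fun n => {w | (w : ℝ × ℝ) ∈ CP n.1 ∧ (w : ℝ × ℝ) ∈ CQ n.2}
  have hAc : ∀ n, IsClosed (A n) := by
    intro n
    apply isClosed_of_closure_subset
    intro x hx
    have hx1 := image_closure_subset_closure_image (continuous_subtype_val) (s := A n) ⟨x, hx, rfl⟩
    obtain ⟨M, hM⟩ := h.CP _ _ (hZΩ x.2)
    obtain ⟨M', hM'⟩ := h.CQ _ _ (hZΩ x.2)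
    constructor
    · refine CondP.closed hK h.cont hM _ ?_ hx1
      rintro w ⟨l, hl, rfl⟩
      exact hl.1
    · have hx2 := image_closure_subset_closure_image (continuous_swap (X := ℝ) (Y := ℝ)) ⟨(x : ℝ × ℝ), hx1, rfl⟩
      refine CondP.closed hK hcs (z := (x : ℝ × ℝ).swap) hM' _ ?_ hx2
      rintro w ⟨l, ⟨y, hy, rfl⟩, rfl⟩
      exact hy.2
  have hAU : ⋃ n, A n = Set.univ := by
    apply Set.eq_univ_of_forall
    intro x
    obtain ⟨M, hM⟩ := h.CP _ _ (hZΩ x.2)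
    obtain ⟨M', hM'⟩ := h.CQ _ _ (hZΩ x.2)
    exact Set.mem_iUnion.2 ⟨(M, M'), hM, hM'⟩
  obtain ⟨⟨N, M⟩, y, hy⟩ := nonempty_interior_of_iUnion_of_closed hAc hAU
  obtain ⟨U, hUA, hU, hyU⟩ := mem_interior.1 hy
  obtain ⟨V, hV, rfl⟩ := isOpen_induced_iff.1 hU
  obtain ⟨zs, hzsV, hzsO, hzsB⟩ := mem_closure_iff.1 y.2 V hV hyU
  apply hzsO
  obtain ⟨r0, hr0, hbox0⟩ := exists_box (hV.inter Metric.isOpen_ball) (show zs ∈ V ∩ Metric.ball z0 ρ from ⟨hzsV, hzsB⟩)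
  have hN : (0:ℝ) ≤ N := Nat.cast_nonneg N
  have hM : (0:ℝ) ≤ M := Nat.cast_nonneg M
  obtain ⟨r, hr, hr1, hr2⟩ : ∃ r : ℝ, 0 < r ∧ r ≤ r0 ∧ 2 * r * (N + M + 1) < 1 := by
    refine ⟨min r0 (1 / (4 * (N + M + 1))), lt_min hr0 (by positivity), min_le_left _ _, ?_⟩
    have h1 := min_le_right r0 (1 / (4 * ((N:ℝ) + M + 1)))
    have h2 : (1 / (4 * ((N:ℝ) + M + 1))) * (N + M + 1) = 1 / 4 := by field_simp
    have : min r0 (1 / (4 * ((N:ℝ) + M + 1))) * (N + M + 1) ≤ (1 / (4 * ((N:ℝ) + M + 1))) * (N + M + 1) := by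
      gcongr
    linarith
  have hbox : ∀ ξ η, |ξ - zs.1| < r → |η - zs.2| < r → (ξ, η) ∈ V ∩ Metric.ball z0 ρ :=
    fun ξ η a b => hbox0 ξ η (lt_of_lt_of_le a hr1) (lt_of_lt_of_le b hr1)
  have hcond : ∀ ξ η, |ξ - zs.1| < r → |η - zs.2| < r → (ξ, η) ∉ O → (ξ, η) ∈ CP N ∧ (ξ, η) ∈ CQ M := by
    intro ξ η a b c
    have h1 := hbox ξ η a b
    have h2 : (ξ, η) ∈ Z := subset_closure ⟨c, h1.2⟩
    exact hUA (show (⟨(ξ, η), h2⟩ : Z) ∈ Subtype.val ⁻¹' V from h1.1)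
  have lp : ∀ ξ η η', |ξ - zs.1| < r → |η - zs.2| < r → |η' - zs.2| < r → η ≤ η' →
      |p ξ η' - p ξ η| ≤ K * (η' - η) := by
    intro ξ η η' a b c hle
    exact lipP_box hK h.cont O hO (fun ξ η hz => h.good_deriv hz)
      (fun ξ η η' hle hz => good_lip hK hle hz) N zs.1 zs.2 r (by nlinarith)
      (fun ξ η a b c => (hcond ξ η a b c).1) a b c hle
  have lq : ∀ ξ η η', |ξ - zs.2| < r → |η - zs.1| < r → |η' - zs.1| < r → η ≤ η' →
      |q η' ξ - q η ξ| ≤ K * (η' - η) := by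
    intro ξ η η' a b c hle
    exact lipP_box (ψ := fun a b => ψ b a) (p := fun a b => q b a) hK hcs (Prod.swap ⁻¹' O)
      (hO.preimage continuous_swap)
      (fun ξ η hz => h.swap.good_deriv (GoodPt.swap hz))
      (fun ξ η η' hle hz => good_lip (Ω := Prod.swap ⁻¹' Ω) (q := fun a b => p b a) hK hle
        (fun l hl => GoodPt.swap (hz l hl))) M zs.2 zs.1 r (by nlinarith)
      (fun ξ η a b c => (hcond η ξ b a c).2) a b c hle
  refine ⟨r, hr, fun ξ η a b => hball (Metric.ball_subset_closedBall (hbox ξ η a b).2), ?_, ?_⟩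
  · intro ξ η η' a b c
    rcases le_total η η' with hle | hle
    · rw [abs_of_nonneg (by linarith : 0 ≤ η' - η)]; exact lp ξ η η' a b c hle
    · rw [abs_sub_comm, abs_sub_comm η' η, abs_of_nonneg (by linarith : 0 ≤ η - η')]
      exact lp ξ η' η a c b hle
  · intro ξ ξ' η a b c
    rcases le_total ξ ξ' with hle | hle
    · rw [abs_of_nonneg (by linarith : 0 ≤ ξ' - ξ)]; exact lq η ξ ξ' c a b hle
    · rw [abs_sub_comm, abs_sub_comm ξ' ξ, abs_of_nonneg (by linarith : 0 ≤ ξ - ξ')]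
      exact lq η ξ' ξ c b a hle

theorem NullReg.main {Ω : Set (ℝ × ℝ)} {K : ℝ} {ψ p q : ℝ → ℝ → ℝ} (h : NullReg Ω K ψ p q)
    {z : ℝ × ℝ} (hz : z ∈ Ω) : ContinuousAt (fun w : ℝ × ℝ => p w.1 w.2) z ∧
      ContinuousAt (fun w : ℝ × ℝ => q w.1 w.2) z :=
  ⟨h.good_contP (h.all_good hz), h.good_contQ (h.all_good hz)⟩


open Topology in
/-- box inequality -/
theorem box_ineq {H Hs Hx : ℝ → ℝ → ℝ} {s0 : ℝ} (hc : Continuous (fun v : ℝ × ℝ => H v.1 v.2))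
    (hs : ∀ s x, s0 < s → HasDerivAt (fun a => H a x) (Hs s x) s)
    (hx : ∀ s x, s0 < s → HasDerivAt (fun a => H s a) (Hx s x) x)
    (hle : ∀ s x, s0 < s → |Hx s x| ≤ Hs s x) {s x δ : ℝ} (hs0 : s0 ≤ s) (hδ : 0 < δ) :
    0 ≤ (∫ y in x..x+δ, (H (s+δ) y - H s y)) + ∫ σ in s..s+δ, (H σ (x+δ) - H σ x) := by
  have hss : s ≤ s + δ := by linarith
  have hxx : x ≤ x + δ := by linarith
  have hcs : ∀ y, Continuous (fun a => H a y) := fun y => hc.comp (by fun_prop : Continuous (fun a : ℝ => (a, y)))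
  have hcx : ∀ a, Continuous (fun y => H a y) := fun a => hc.comp (by fun_prop : Continuous (fun y : ℝ => (a, y)))
  let D : ℝ × ℝ → ℝ := fun v => deriv (fun a => H a v.2) v.1
  have hD : ∀ σ y, s0 < σ → D (σ, y) = Hs σ y := fun σ y h => (hs σ y h).deriv
  have hD0 : ∀ σ y, s0 < σ → 0 ≤ D (σ, y) := fun σ y h => by
    rw [hD σ y h]; exact (abs_nonneg _).trans (hle σ y h)
  have hDm : Measurable D := by
    have : Continuous (Function.uncurry (fun y a => H a y)) := hc.comp continuous_swap
    exact (measurable_deriv_with_param this).comp measurable_swap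
  set μ : Measure ℝ := volume.restrict (Set.Ioc s (s + δ)) with hμ
  set ν : Measure ℝ := volume.restrict (Set.Ioc x (x + δ)) with hν
  have hint : ∀ y, IntegrableOn (fun σ => D (σ, y)) (Set.Ioc s (s + δ)) := fun y =>
    intervalIntegral.integrableOn_deriv_of_nonneg (hcs y).continuousOn
      (fun σ hσ => by rw [hD σ y (by linarith [hσ.1])]; exact hs σ y (by linarith [hσ.1]))
      (fun σ hσ => hD0 σ y (by linarith [hσ.1]))
  have hval : ∀ y, ∫ σ in Set.Ioc s (s + δ), D (σ, y) = H (s + δ) y - H s y := by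
    intro y
    rw [← intervalIntegral.integral_of_le hss]
    refine intervalIntegral.integral_eq_sub_of_hasDerivAt_of_le hss (hcs y).continuousOn (f := fun a => H a y)
      (fun σ hσ => by rw [hD σ y (by linarith [hσ.1])]; exact hs σ y (by linarith [hσ.1])) ?_
    exact (intervalIntegrable_iff_integrableOn_Ioc_of_le hss).2 (hint y)
  have hnorm : ∀ y, ∫ σ, ‖D (σ, y)‖ ∂μ = H (s + δ) y - H s y := by
    intro y
    rw [← hval y]
    apply setIntegral_congr_fun measurableSet_Ioc
    intro σ hσ
    simp only [Real.norm_eq_abs]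
    exact abs_of_nonneg (hD0 σ y (by linarith [hσ.1]))
  have hprod : Integrable D (μ.prod ν) := by
    rw [integrable_prod_iff' hDm.aestronglyMeasurable]
    refine ⟨Eventually.of_forall fun y => hint y, ?_⟩
    simp_rw [hnorm]
    have : Continuous (fun y => H (s + δ) y - H s y) := (hcx _).sub (hcx _)
    exact (this.integrableOn_Icc (a := x) (b := x + δ)).mono_set Set.Ioc_subset_Icc_self
  have hswap : ∫ y in x..x+δ, (H (s+δ) y - H s y) = ∫ σ, ∫ y, D (σ, y) ∂ν ∂μ := by
    rw [intervalIntegral.integral_of_le hxx]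
    simp_rw [← hval]
    exact (integral_integral_swap (f := fun σ y => D (σ, y)) hprod).symm
  rw [hswap, intervalIntegral.integral_of_le hss, ← integral_add hprod.integral_prod_left]
  · apply integral_nonneg_of_ae
    have h1 := hprod.prod_right_ae
    have h2 : ∀ᵐ σ ∂μ, σ ∈ Set.Ioc s (s + δ) := ae_restrict_mem measurableSet_Ioc
    filter_upwards [h1, h2] with σ hσ1 hσ2
    have hσ0 : s0 < σ := by linarith [hσ2.1]
    have h3 := intervalIntegral.sub_le_integral_of_hasDeriv_right_of_le (g := fun y => - H σ y)
      (g' := fun y => - Hx σ y) (φ := fun y => D (σ, y)) hxx (hcx σ).neg.continuousOn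
      (fun y _ => (hx σ y hσ0).neg.hasDerivWithinAt)
      (by rw [integrableOn_Icc_iff_integrableOn_Ioc]; exact hσ1)
      (fun y _ => by
        rw [hD σ y hσ0]
        have := hle σ y hσ0
        rw [abs_le] at this
        linarith [this.1])
    rw [intervalIntegral.integral_of_le hxx] at h3
    simp only [Pi.zero_apply]
    linarith
  · have : Continuous (fun σ => H σ (x + δ) - H σ x) := (hcs _).sub (hcs _)
    exact (this.integrableOn_Icc (a := s) (b := s + δ)).mono_set Set.Ioc_subset_Icc_self

open Topology in
theorem hasDerivAt_window {g : ℝ → ℝ} (hg : Continuous g) (δ s : ℝ) :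
    HasDerivAt (fun s => ∫ σ in s..s+δ, g σ) (g (s + δ) - g s) s := by
  have h0 : ∀ u, HasDerivAt (fun u => ∫ σ in (0:ℝ)..u, g σ) (g u) u := fun u =>
    intervalIntegral.integral_hasDerivAt_right (hg.intervalIntegrable _ _)
      (hg.stronglyMeasurableAtFilter _ _) hg.continuousAt
  have e : (fun s => ∫ σ in s..s+δ, g σ) = fun s => (∫ σ in (0:ℝ)..(s+δ), g σ) - ∫ σ in (0:ℝ)..s, g σ := by
    ext s
    rw [intervalIntegral.integral_interval_sub_left (hg.intervalIntegrable _ _) (hg.intervalIntegrable _ _)]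
  rw [e]
  have h1 := HasDerivAt.comp s (h0 (s + δ)) ((hasDerivAt_id s).add_const δ)
  rw [mul_one] at h1
  exact h1.sub (h0 s)

open Topology in
theorem mono_null {H Hs Hx : ℝ → ℝ → ℝ} {s0 : ℝ} (hc : Continuous (fun v : ℝ × ℝ => H v.1 v.2))
    (hs : ∀ s x, s0 < s → HasDerivAt (fun a => H a x) (Hs s x) s)
    (hx : ∀ s x, s0 < s → HasDerivAt (fun a => H s a) (Hx s x) x)
    (hle : ∀ s x, s0 < s → |Hx s x| ≤ Hs s x) {s x θ : ℝ} (hs0 : s0 ≤ s) (hθ : 0 ≤ θ) :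
    H s x ≤ H (s + θ) (x + θ) := by
  by_contra hcon
  push Not at hcon
  -- choose delta
  have hcc : Continuous (fun v : ℝ × ℝ => H v.1 v.2 - H (v.1 + θ) (v.2 + θ)) :=
    hc.sub (hc.comp (by fun_prop : Continuous (fun v : ℝ × ℝ => (v.1 + θ, v.2 + θ))))
  obtain ⟨r, hr, hpos⟩ := Metric.isOpen_iff.1 (isOpen_lt continuous_const hcc) (s, x)
    (show (0:ℝ) < _ by simpa using hcon)
  set δ := r / 2 with hδd
  have hδ : 0 < δ := by linarith
  let F : ℝ → ℝ → ℝ := fun s x => ∫ σ in s..s+δ, ∫ y in x..x+δ, H σ y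
  have hF2 : ∀ s x, F s x = ∫ y in x..x+δ, ∫ σ in s..s+δ, H σ y := by
    intro s x
    simp only [F]
    rw [intervalIntegral.integral_of_le (by linarith), intervalIntegral.integral_of_le (by linarith)]
    simp_rw [intervalIntegral.integral_of_le (show s ≤ s + δ by linarith),
      intervalIntegral.integral_of_le (show x ≤ x + δ by linarith)]
    apply integral_integral_swap
    have : IntegrableOn (fun v : ℝ × ℝ => H v.1 v.2) (Set.Icc s (s+δ) ×ˢ Set.Icc x (x+δ)) :=
      hc.continuousOn.integrableOn_compact (isCompact_Icc.prod isCompact_Icc)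
    rw [Measure.prod_restrict]
    exact this.mono_set (Set.prod_mono Set.Ioc_subset_Icc_self Set.Ioc_subset_Icc_self)
  let I1 : ℝ → ℝ → ℝ := fun σ x => ∫ y in x..x+δ, H σ y
  let I2 : ℝ → ℝ → ℝ := fun s y => ∫ σ in s..s+δ, H σ y
  have cI1 : Continuous (fun v : ℝ × ℝ => I1 v.1 v.2) := by
    have e : (fun v : ℝ × ℝ => I1 v.1 v.2) = fun v => ∫ y in (0:ℝ)..δ, H v.1 (v.2 + y) := by
      ext v
      simp only [I1]
      rw [intervalIntegral.integral_comp_add_left (fun y => H v.1 y) v.2]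
      simp
    rw [e]
    apply intervalIntegral.continuous_parametric_intervalIntegral_of_continuous' (f := fun (v : ℝ × ℝ) y => H v.1 (v.2 + y))
    exact hc.comp (by fun_prop : Continuous (fun u : (ℝ × ℝ) × ℝ => (u.1.1, u.1.2 + u.2)))
  have cI2 : Continuous (fun v : ℝ × ℝ => I2 v.1 v.2) := by
    have e : (fun v : ℝ × ℝ => I2 v.1 v.2) = fun v => ∫ y in (0:ℝ)..δ, H (v.1 + y) v.2 := by
      ext v
      simp only [I2]
      rw [intervalIntegral.integral_comp_add_left (fun y => H y v.2) v.1]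
      simp
    rw [e]
    apply intervalIntegral.continuous_parametric_intervalIntegral_of_continuous' (f := fun (v : ℝ × ℝ) y => H (v.1 + y) v.2)
    exact hc.comp (by fun_prop : Continuous (fun u : (ℝ × ℝ) × ℝ => (u.1.1 + u.2, u.1.2)))
  have hmono : ∀ θ, HasDerivAt (fun θ => F (s + θ) (x + θ))
      ((I1 (s + θ + δ) (x + θ) - I1 (s + θ) (x + θ)) * 1 + (I2 (s + θ) (x + θ + δ) - I2 (s + θ) (x + θ)) * 1) θ := by
    intro θ
    refine partial_curve (f := F) (f1 := fun s x => I1 (s + δ) x - I1 s x)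
      (f2 := fun s x => I2 s (x + δ) - I2 s x) (g1 := fun θ => s + θ) (g2 := fun θ => x + θ)
      (Eventually.of_forall fun v => ?_) (Eventually.of_forall fun v => ?_) ?_ ?_
      ((hasDerivAt_id θ).const_add s) ((hasDerivAt_id θ).const_add x)
    · exact hasDerivAt_window (g := fun σ => I1 σ v.2)
        (cI1.comp (by fun_prop : Continuous (fun a : ℝ => (a, v.2)))) δ v.1
    · have := hasDerivAt_window (g := fun y => I2 v.1 y)
        (cI2.comp (by fun_prop : Continuous (fun a : ℝ => (v.1, a)))) δ v.2
      refine this.congr_of_eventuallyEq (Eventually.of_forall fun a => hF2 _ _)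
    · exact ((cI1.comp (by fun_prop : Continuous (fun v : ℝ × ℝ => (v.1 + δ, v.2)))).sub cI1).continuousAt
    · exact ((cI2.comp (by fun_prop : Continuous (fun v : ℝ × ℝ => (v.1, v.2 + δ)))).sub cI2).continuousAt
  have hcs : ∀ y, Continuous (fun a => H a y) := fun y => hc.comp (by fun_prop : Continuous (fun a : ℝ => (a, y)))
  have hcx : ∀ a, Continuous (fun y => H a y) := fun a => hc.comp (by fun_prop : Continuous (fun y : ℝ => (a, y)))
  have hm : MonotoneOn (fun θ => F (s + θ) (x + θ)) (Set.Ici 0) := by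
    apply monotoneOn_of_deriv_nonneg (convex_Ici 0)
    · exact fun θ _ => (hmono θ).continuousAt.continuousWithinAt
    · exact fun θ _ => (hmono θ).differentiableAt.differentiableWithinAt
    · intro θ hθ
      rw [interior_Ici] at hθ
      rw [(hmono θ).deriv]
      have := box_ineq hc hs hx hle (s := s + θ) (x := x + θ) (by have : 0 < θ := hθ; linarith) hδ
      rw [intervalIntegral.integral_sub ((hcx _).intervalIntegrable _ _) ((hcx _).intervalIntegrable _ _),
        intervalIntegral.integral_sub ((hcs _).intervalIntegrable _ _) ((hcs _).intervalIntegrable _ _)] at this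
      simp only [I1, I2]
      linarith
  have h1 := hm (Set.self_mem_Ici) (show θ ∈ Set.Ici 0 from hθ) hθ
  simp only [add_zero] at h1
  have h2 : F (s + θ) (x + θ) < F s x := by
    have e : F (s + θ) (x + θ) = ∫ σ in s..s+δ, ∫ y in x..x+δ, H (σ + θ) (y + θ) := by
      simp only [F]
      rw [show s + θ + δ = (s + δ) + θ by ring, show x + θ + δ = (x + δ) + θ by ring]
      rw [← intervalIntegral.integral_comp_add_right (fun σ => ∫ y in x + θ..x + δ + θ, H σ y) θ]
      congr 1
      ext σ
      rw [← intervalIntegral.integral_comp_add_right (fun y => H (σ + θ) y) θ]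
    rw [e]
    have inner : ∀ σ ∈ Set.Icc s (s + δ), (∫ y in x..x+δ, H (σ + θ) (y + θ)) < ∫ y in x..x+δ, H σ y := by
      intro σ hσ
      have hcθ : Continuous (fun y => H (σ + θ) (y + θ)) := (hcx (σ + θ)).comp (by fun_prop : Continuous (fun y : ℝ => y + θ))
      have hlt : ∀ y ∈ Set.Icc x (x + δ), H (σ + θ) (y + θ) < H σ y := by
        intro y hy
        have : (σ, y) ∈ Metric.ball (s, x) r := by
          rw [Metric.mem_ball, Prod.dist_eq, max_lt_iff, Real.dist_eq, Real.dist_eq, abs_lt, abs_lt]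
          refine ⟨⟨?_, ?_⟩, ?_, ?_⟩ <;> simp only <;> linarith [hσ.1, hσ.2, hy.1, hy.2]
        have := hpos this
        simp only [Set.mem_ofPred_eq] at this
        linarith
      exact intervalIntegral.integral_lt_integral_of_continuousOn_of_le_of_exists_lt (by linarith)
        hcθ.continuousOn (hcx σ).continuousOn (fun y hy => (hlt y ⟨hy.1.le, hy.2⟩).le)
        ⟨x, ⟨le_rfl, by linarith⟩, hlt x ⟨le_rfl, by linarith⟩⟩
    have c1 : Continuous (fun σ => ∫ y in x..x+δ, H σ y) := cI1.comp (by fun_prop : Continuous (fun σ : ℝ => (σ, x)))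
    have c2 : Continuous (fun σ => ∫ y in x..x+δ, H (σ + θ) (y + θ)) := by
      apply intervalIntegral.continuous_parametric_intervalIntegral_of_continuous' (f := fun (σ : ℝ) y => H (σ + θ) (y + θ))
      exact hc.comp (by fun_prop : Continuous (fun u : ℝ × ℝ => (u.1 + θ, u.2 + θ)))
    exact intervalIntegral.integral_lt_integral_of_continuousOn_of_le_of_exists_lt (by linarith)
      c2.continuousOn c1.continuousOn (fun σ hσ => (inner σ ⟨hσ.1.le, hσ.2⟩).le)
      ⟨s, ⟨le_rfl, by linarith⟩, inner s ⟨le_rfl, by linarith⟩⟩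
  linarith

theorem mono_null_left {H Hs Hx : ℝ → ℝ → ℝ} {s0 : ℝ} (hc : Continuous (fun v : ℝ × ℝ => H v.1 v.2))
    (hs : ∀ s x, s0 < s → HasDerivAt (fun a => H a x) (Hs s x) s)
    (hx : ∀ s x, s0 < s → HasDerivAt (fun a => H s a) (Hx s x) x)
    (hle : ∀ s x, s0 < s → |Hx s x| ≤ Hs s x) {s x θ : ℝ} (hs0 : s0 ≤ s) (hθ : 0 ≤ θ) :
    H s x ≤ H (s + θ) (x - θ) := by
  have := mono_null (H := fun s x => H s (-x)) (Hs := fun s x => Hs s (-x)) (Hx := fun s x => - Hx s (-x))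
    (s0 := s0) (hc.comp (by fun_prop : Continuous (fun v : ℝ × ℝ => (v.1, -v.2))))
    (fun s x h => hs s (-x) h)
    (fun s x h => by
      have := HasDerivAt.comp x (hx s (-x) h) (hasDerivAt_neg x)
      exact this.congr_deriv (by ring))
    (fun s x h => by rw [abs_neg]; exact hle s (-x) h) (s := s) (x := -x) hs0 hθ
  simpa [sub_eq_add_neg, add_comm] using this


open Topology in
theorem peano2 {f f' : ℝ → ℝ} {x f2 : ℝ} (hf : ∀ᶠ y in 𝓝 x, HasDerivAt f (f' y) y)
    (h2 : HasDerivAt f' f2 x) {ε : ℝ} (hε : 0 < ε) :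
    ∀ᶠ h in 𝓝 (0:ℝ), |f (x+h) - f x - h * f' x - h^2/2 * f2| ≤ ε * h^2 := by
  have hb := (hasDerivAt_iff_isLittleO.1 h2).def hε
  obtain ⟨δ, hδ, H⟩ := Metric.eventually_nhds_iff.1 (hf.and hb)
  refine Metric.eventually_nhds_iff.2 ⟨δ, hδ, fun {h} hh => ?_⟩
  have hh' : |h| < δ := by simpa [Real.dist_eq] using hh
  have key := (convex_Icc (-|h|) |h|).norm_image_sub_le_of_norm_hasDerivWithin_le
    (f := fun u => f (x+u) - u * f' x - u^2/2 * f2) (f' := fun u => f' (x+u) - f' x - u * f2)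
    (C := ε * |h|) (x := 0) (y := h) ?_ ?_ ?_ ?_
  · have e : (f (x+h) - h * f' x - h^2/2 * f2) - (f (x+0) - 0 * f' x - 0^2/2*f2)
      = f (x+h) - f x - h * f' x - h^2/2 * f2 := by simp; ring
    simp only [Real.norm_eq_abs] at key
    rw [e] at key
    calc _ ≤ _ := key
      _ = ε * h^2 := by rw [sub_zero, mul_assoc, ← sq, sq_abs]
  · intro u hu
    have hu' : |u| ≤ |h| := abs_le.2 hu
    have hd : dist (x+u) x < δ := by simp [Real.dist_eq]; linarith
    have h1 := (H hd).1
    have h1' : HasDerivAt (fun u => f (x+u)) (f' (x+u)) u := by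
      have := HasDerivAt.comp_const_add x u h1
      exact this
    have h3 : HasDerivAt (fun u : ℝ => u * f' x) (f' x) u := by
      simpa using (hasDerivAt_id u).mul_const (f' x)
    have h4 : HasDerivAt (fun u : ℝ => u^2/2 * f2) (u * f2) u := by
      have := (((hasDerivAt_id u).pow 2).div_const 2).mul_const f2
      refine this.congr_deriv ?_
      simp
    exact ((h1'.sub h3).sub h4).hasDerivWithinAt
  · intro u hu
    have hu' : |u| ≤ |h| := abs_le.2 hu
    have hd : dist (x+u) x < δ := by simp [Real.dist_eq]; linarith
    have h1 := (H hd).2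
    simp only [Real.norm_eq_abs, add_sub_cancel_left, smul_eq_mul] at h1
    calc _ ≤ ε * |u| := h1
      _ ≤ _ := by gcongr
  · simp
  · exact ⟨neg_abs_le h, le_abs_self h⟩

open Topology in
theorem peano2' {f f' : ℝ → ℝ} {x : ℝ} (hf : ∀ᶠ y in 𝓝 x, HasDerivAt f (f' y) y)
    (h2 : DifferentiableAt ℝ f' x) :
    ∃ C, 0 ≤ C ∧ ∀ᶠ h in 𝓝 (0:ℝ), |f (x+h) - f x - h * f' x| ≤ C * h^2 := by
  refine ⟨1 + |deriv f' x|/2, by positivity, ?_⟩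
  filter_upwards [peano2 hf h2.hasDerivAt one_pos] with h hh
  have : |h^2/2 * deriv f' x| = h^2 * (|deriv f' x|/2) := by
    rw [abs_mul, abs_of_nonneg (by positivity)]; ring
  have h3 := abs_add_le (f (x+h) - f x - h * f' x - h^2/2 * deriv f' x) (h^2/2 * deriv f' x)
  rw [sub_add_cancel] at h3
  nlinarith

structure SX (m Φ A B : ℝ → ℝ → ℝ) : Prop where
  cm : ContinuousOn (fun v : ℝ × ℝ => m v.1 v.2) {v | 1/2 < v.1}
  cΦ : ContinuousOn (fun v : ℝ × ℝ => Φ v.1 v.2) {v | 1/2 < v.1}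
  ms : ∀ s x, 1/2 < s → HasDerivAt (fun a => m a x) (A s x^2 + B s x^2) s
  mx : ∀ s x, 1/2 < s → HasDerivAt (fun a => m s a) (2 * A s x * B s x) x
  Φs : ∀ s x, 1/2 < s → HasDerivAt (fun a => Φ a x) (A s x / √(2*s)) s
  Φx : ∀ s x, 1/2 < s → HasDerivAt (fun a => Φ s a) (B s x / √(2*s)) x
  dE : ∀ s x, 1/2 < s → DifferentiableAt ℝ (fun a => A a x^2 + B a x^2) s
  dG : ∀ s x, 1/2 < s → DifferentiableAt ℝ (fun y => 2 * A s y * B s y) x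
  wav : ∀ s x, 1/2 < s → ∃ As, HasDerivAt (fun a => A a x) As s ∧
    HasDerivAt (fun y => B s y) (As + A s x / (2*s)) x

theorem SX.reflect {m Φ A B} (h : SX m Φ A B) :
    SX (fun s x => m s (-x)) (fun s x => Φ s (-x)) (fun s x => A s (-x)) (fun s x => - B s (-x)) := by
  have cn : ContinuousOn (fun v : ℝ × ℝ => (v.1, -v.2)) {v : ℝ × ℝ | 1/2 < v.1} := by fun_prop
  have cm : Set.MapsTo (fun v : ℝ × ℝ => (v.1, -v.2)) {v : ℝ × ℝ | 1/2 < v.1} {v : ℝ × ℝ | 1/2 < v.1} :=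
    fun v hv => hv
  refine ⟨h.cm.comp cn cm, h.cΦ.comp cn cm, ?_, ?_, ?_, ?_, ?_, ?_, ?_⟩
  · intro s x hs; simpa using h.ms s (-x) hs
  · intro s x hs
    have := (h.mx s (-x) hs).comp x (hasDerivAt_neg x)
    refine this.congr_deriv ?_; ring
  · intro s x hs; exact h.Φs s (-x) hs
  · intro s x hs
    have := (h.Φx s (-x) hs).comp x (hasDerivAt_neg x)
    refine this.congr_deriv ?_; ring
  · intro s x hs; simpa using h.dE s (-x) hs
  · intro s x hs
    have := ((h.dG s (-x) hs).hasDerivAt.comp x (hasDerivAt_neg x)).neg.differentiableAt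
    refine this.congr_of_eventuallyEq (Eventually.of_forall fun y => ?_)
    simp
  · intro s x hs
    obtain ⟨As, h1, h2⟩ := h.wav s (-x) hs
    refine ⟨As, h1, ?_⟩
    have := (h2.comp x (hasDerivAt_neg x)).neg
    refine this.congr_deriv ?_; ring

/-- The weighted wave function. -/
def psiSX (Φ : ℝ → ℝ → ℝ) (s x : ℝ) : ℝ := √(2*s) * Φ s x

theorem hasDerivAt_sqrt2 {s : ℝ} (hs : 1/2 < s) : HasDerivAt (fun s => √(2*s)) (1/√(2*s)) s := by
  have h1 : HasDerivAt (fun s : ℝ => 2*s) 2 s := by simpa using (hasDerivAt_id s).const_mul 2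
  refine (h1.sqrt (by positivity)).congr_deriv ?_
  field_simp

theorem SX.psi_s {m Φ A B} (h : SX m Φ A B) {s x : ℝ} (hs : 1/2 < s) :
    HasDerivAt (fun a => psiSX Φ a x) (Φ s x / √(2*s) + A s x) s := by
  have hp : 0 < √(2*s) := Real.sqrt_pos.2 (by linarith)
  refine ((hasDerivAt_sqrt2 hs).mul (h.Φs s x hs)).congr_deriv ?_
  field_simp

theorem SX.psi_x {m Φ A B} (h : SX m Φ A B) {s x : ℝ} (hs : 1/2 < s) :
    HasDerivAt (fun a => psiSX Φ s a) (B s x) x := by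
  have hp : 0 < √(2*s) := Real.sqrt_pos.2 (by linarith)
  refine ((h.Φx s x hs).const_mul (√(2*s))).congr_deriv ?_
  field_simp

theorem SX.psi_ss {m Φ A B} (h : SX m Φ A B) {s x As : ℝ} (hs : 1/2 < s)
    (hA : HasDerivAt (fun a => A a x) As s) :
    HasDerivAt (fun a => Φ a x / √(2*a) + A a x) (As + A s x / (2*s) - Φ s x / (√(2*s))^3) s := by
  have hp : 0 < √(2*s) := Real.sqrt_pos.2 (by linarith)
  have hq : √(2*s)^2 = 2*s := Real.sq_sqrt (by linarith)
  refine (((h.Φs s x hs).div (hasDerivAt_sqrt2 hs) hp.ne').add hA).congr_deriv ?_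
  have e : A s x / (2*s) = A s x / √(2*s)^2 := by rw [hq]
  rw [e]
  generalize √(2*s) = q at *
  field_simp
  ring

open Topology in
theorem SX.SO {m Φ A B} (h : SX m Φ A B) {s x K : ℝ} (hs : 1/2 < s) (hK : |Φ s x| + 1 ≤ K) :
    ∀ᶠ k in 𝓝 (0:ℝ), |psiSX Φ (s+k) x - psiSX Φ s (x-k) -
      k * (Φ s x / √(2*s) + A s x + B s x)| ≤ K * k^2 := by
  obtain ⟨As, hA, hB⟩ := h.wav s x hs
  have e1 := peano2 (f := fun a => psiSX Φ a x) (f' := fun a => Φ a x / √(2*a) + A a x)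
    ((lt_mem_nhds hs).mono fun a ha => h.psi_s ha) (h.psi_ss hs hA) (ε := 1/4) (by norm_num)
  have e2 := peano2 (f := fun y => psiSX Φ s y) (f' := fun y => B s y)
    (Eventually.of_forall fun y => h.psi_x hs) hB (ε := 1/4) (by norm_num)
  have e2' := (show Tendsto (fun k : ℝ => -k) (𝓝 0) (𝓝 0) by
    simpa using (continuous_neg (G := ℝ)).tendsto 0).eventually e2
  filter_upwards [e1, e2'] with k h1 h2
  have hp : 1 ≤ √(2*s) := Real.one_le_sqrt.2 (by linarith)
  have hp3 : 1 ≤ √(2*s)^3 := one_le_pow₀ hp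
  have hb : |Φ s x / √(2*s)^3| ≤ |Φ s x| := by
    rw [abs_div, abs_of_pos (by linarith : (0:ℝ) < √(2*s)^3)]
    exact div_le_self (abs_nonneg _) hp3
  rw [abs_le] at h1 h2 hb ⊢
  simp only [neg_sq, ← sub_eq_add_neg] at h2
  generalize Φ s x / √(2*s)^3 = Q at *
  have k2 : 0 ≤ k^2 := sq_nonneg k
  have hq1 : k^2 * Q ≤ k^2 * (K - 1) := by
    apply mul_le_mul_of_nonneg_left _ k2; linarith
  have hq2 : -(k^2 * (K-1)) ≤ k^2 * Q := by
    rw [← mul_neg]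
    apply mul_le_mul_of_nonneg_left _ k2; linarith
  have hK0 : 0 ≤ k^2 * (K-1) := mul_nonneg k2 (by linarith [abs_nonneg (Φ s x)])
  constructor <;> nlinarith [h1.1, h1.2, h2.1, h2.2]


theorem SX.quad {m Φ A B} (h : SX m Φ A B) {s0 s x θ : ℝ} (h0 : 1/2 < s0) (hs : s0 ≤ s) (hθ : 0 ≤ θ)
    (κ : ℝ) : 0 ≤ m (s+θ) (x+θ) - m s x - 2*κ*√(2*s0)*(Φ (s+θ) (x+θ) - Φ s x) + κ^2*θ := by
  have cmx : Continuous (fun v : ℝ × ℝ => (max v.1 s0, v.2)) := by fun_prop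
  have hmx : ∀ v : ℝ × ℝ, (max v.1 s0, v.2) ∈ {v : ℝ × ℝ | 1/2 < v.1} := fun v =>
    lt_of_lt_of_le h0 (le_max_right _ _)
  have c1 : Continuous (fun v : ℝ × ℝ => m (max v.1 s0) v.2) := h.cm.comp_continuous cmx hmx
  have c2 : Continuous (fun v : ℝ × ℝ => Φ (max v.1 s0) v.2) := h.cΦ.comp_continuous cmx hmx
  have key := mono_null (H := fun a y => m (max a s0) y - 2*κ*√(2*s0)*Φ (max a s0) y + κ^2*a)
    (Hs := fun a y => A a y^2 + B a y^2 - 2*κ*√(2*s0)*(A a y / √(2*a)) + κ^2)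
    (Hx := fun a y => 2*A a y*B a y - 2*κ*√(2*s0)*(B a y / √(2*a)))
    (s0 := s0) ((c1.sub (continuous_const.mul c2)).add (continuous_const.mul continuous_fst)) ?_ ?_ ?_ hs hθ (x := x)
  · simp only [max_eq_left hs, max_eq_left (by linarith : s0 ≤ s+θ)] at key
    linarith
  · intro a y ha
    have e : (fun a => max a s0) =ᶠ[nhds a] fun a => a := by
      filter_upwards [lt_mem_nhds ha] with b hb using max_eq_left hb.le
    have d := ((h.ms a y (by linarith)).sub ((h.Φs a y (by linarith)).const_mul (2*κ*√(2*s0)))).add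
      ((hasDerivAt_id a).const_mul (κ^2))
    refine (d.congr_of_eventuallyEq ?_).congr_deriv (by simp)
    filter_upwards [e] with b hb
    simp [hb]
  · intro a y ha
    have d := ((h.mx a y (by linarith)).sub ((h.Φx a y (by linarith)).const_mul (2*κ*√(2*s0)))).add_const
      (κ^2*a)
    simpa [max_eq_left ha.le] using d
  · intro a y ha
    have hp : 0 < √(2*a) := Real.sqrt_pos.2 (by linarith)
    have hle : √(2*s0) ≤ √(2*a) := Real.sqrt_le_sqrt (by linarith)
    have hg0 : 0 ≤ √(2*s0)/√(2*a) := by positivity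
    have hg1 : √(2*s0)/√(2*a) ≤ 1 := (div_le_one hp).2 hle
    have e1 : 2*κ*√(2*s0)*(A a y / √(2*a)) = 2*κ*A a y*(√(2*s0)/√(2*a)) := by ring
    have e2 : 2*κ*√(2*s0)*(B a y / √(2*a)) = 2*κ*B a y*(√(2*s0)/√(2*a)) := by ring
    simp only [e1, e2]
    generalize √(2*s0)/√(2*a) = g at *
    have hg2 : g^2 ≤ 1 := by nlinarith
    have hk : κ^2 * g^2 ≤ κ^2 := by nlinarith [sq_nonneg κ]
    rw [abs_le]
    constructor
    · nlinarith [sq_nonneg (A a y + B a y - κ*g)]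
    · nlinarith [sq_nonneg (A a y - B a y - κ*g)]

theorem disc_le {a b c : ℝ} (hc : 0 ≤ c) (h : ∀ κ : ℝ, 0 ≤ a - 2*κ*b + κ^2*c) : b^2 ≤ c*a := by
  rcases hc.eq_or_lt with h0 | h0
  · subst h0
    have hb : b = 0 := by
      by_contra hb
      have := h ((a+1)/(2*b))
      have e : 2*((a+1)/(2*b))*b = a+1 := by field_simp
      rw [e] at this
      simp at this
      linarith
    simp [hb]
  · have := h (b/c)
    have e : a - 2*(b/c)*b + (b/c)^2*c = a - b^2/c := by field_simp; ring
    rw [e] at this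
    have : b^2/c ≤ a := by linarith
    rw [div_le_iff₀ h0] at this
    linarith

theorem L2_num {t t0 κ C C1 l θ ta tb va vb vz : ℝ} (ht : 1 ≤ t) (hC : 0 ≤ C)
    (hl : 0 ≤ l) (hl1 : l ≤ 1) (hθ : 0 ≤ θ) (hθl : θ ≤ l) (hC1 : 0 ≤ C1)
    (hD : (t0*(vb-va) - κ*θ)^2 ≤ θ*(C1*l^2)) (hta : 1 ≤ ta) (htb : 1 ≤ tb)
    (h1 : |ta - t| ≤ l) (h2 : |tb - t| ≤ l) (h0 : |t0 - t| ≤ l) (hd : (tb-ta)*(tb+ta) = 2*θ)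
    (ha : |va - vz| ≤ C*l) (hb : |vb - vz| ≤ C*l) :
    (tb*vb - ta*va - θ*(κ + vz/t))^2 ≤ (2*C1 + 2*(|vz| + 4*C)^2) * l^3 := by
  have e : tb*vb - ta*va - θ*(κ + vz/t) = (t0*(vb-va) - κ*θ) +
    ((tb - ta - θ/t)*vz + (tb-t0)*(vb-vz) - (ta-t0)*(va-vz)) := by ring
  have hr1 : |tb - ta - θ/t| ≤ l^2 := by
    have e2 : tb - ta - θ/t = θ*(2*t-tb-ta)/(t*(tb+ta)) := by
      have : tb - ta = 2*θ/(tb+ta) := by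
        rw [eq_div_iff (by positivity)]; exact hd
      rw [this]; field_simp; ring
    rw [e2, abs_div, abs_mul, abs_of_nonneg hθ, abs_of_pos (a := t*(tb+ta)) (by positivity),
      div_le_iff₀ (by positivity)]
    have : |2*t-tb-ta| ≤ 2*l := by
      rw [abs_le] at *; constructor <;> linarith [h1.1,h1.2,h2.1,h2.2]
    have h3 : 2 ≤ t*(tb+ta) := by nlinarith
    calc θ * |2*t-tb-ta| ≤ l * (2*l) := by gcongr
      _ = l^2*2 := by ring
      _ ≤ _ := by gcongr
  have hr2 : |tb - t0| ≤ 2*l := by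
    rw [abs_le] at *; constructor <;> linarith [h0.1,h0.2,h2.1,h2.2]
  have hr3 : |ta - t0| ≤ 2*l := by
    rw [abs_le] at *; constructor <;> linarith [h0.1,h0.2,h1.1,h1.2]
  have hR : |(tb - ta - θ/t)*vz + (tb-t0)*(vb-vz) - (ta-t0)*(va-vz)| ≤ l^2*(|vz| + 4*C) := by
    calc _ ≤ |(tb - ta - θ/t)*vz + (tb-t0)*(vb-vz)| + |(ta-t0)*(va-vz)| := abs_sub _ _
      _ ≤ |(tb - ta - θ/t)*vz| + |(tb-t0)*(vb-vz)| + |(ta-t0)*(va-vz)| := by gcongr; exact abs_add_le _ _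
      _ = |tb - ta - θ/t| * |vz| + |tb-t0| * |vb-vz| + |ta-t0| * |va-vz| := by simp [abs_mul]
      _ ≤ l^2*|vz| + (2*l)*(C*l) + (2*l)*(C*l) := by gcongr
      _ = _ := by ring
  rw [e]
  set R := (tb - ta - θ/t)*vz + (tb-t0)*(vb-vz) - (ta-t0)*(va-vz)
  set D := t0*(vb-va) - κ*θ
  have hR2 : R^2 ≤ (|vz| + 4*C)^2 * l^3 := by
    calc R^2 = |R|^2 := (sq_abs R).symm
      _ ≤ (l^2*(|vz| + 4*C))^2 := by gcongr
      _ = (|vz| + 4*C)^2 * (l^3 * l) := by ring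
      _ ≤ (|vz| + 4*C)^2 * (l^3 * 1) := by gcongr
      _ = _ := by ring
  have hD2 : D^2 ≤ C1*l^3 := by
    calc D^2 ≤ θ*(C1*l^2) := hD
      _ ≤ l*(C1*l^2) := by gcongr
      _ = _ := by ring
  nlinarith [sq_nonneg (D - R)]

/-- 1D abstract part: from the quadratic inequality on a segment. -/
theorem L2_seg {u v : ℝ → ℝ} {l t0 κ E : ℝ} (hl : 0 ≤ l)
    (hQ : ∀ α β, -l ≤ α → α ≤ β → β ≤ l → ∀ κ : ℝ, 0 ≤ u β - u α - 2*κ*t0*(v β - v α) + κ^2*((β-α)/2))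
    (hE : u l - u (-l) - 2*κ*t0*(v l - v (-l)) + κ^2*l ≤ E)
    {α β : ℝ} (h1 : -l ≤ α) (h2 : α ≤ β) (h3 : β ≤ l) :
    (t0*(v β - v α) - κ*((β-α)/2))^2 ≤ ((β-α)/2) * E := by
  have := disc_le (a := u β - u α - 2*κ*t0*(v β - v α) + κ^2*((β-α)/2)) (b := t0*(v β - v α) - κ*((β-α)/2))
    (c := (β-α)/2) (by linarith) (fun κ' => by
      have := hQ α β h1 h2 h3 (κ + κ')
      linarith)
  refine this.trans ?_
  apply mul_le_mul_of_nonneg_left _ (by linarith)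
  have a1 := hQ (-l) α le_rfl h1 (h2.trans h3) κ
  have a2 := hQ β l (h1.trans h2) h3 le_rfl κ
  nlinarith


theorem sqrt2_one_le {s : ℝ} (hs : 1/2 ≤ s) : 1 ≤ √(2*s) := Real.one_le_sqrt.2 (by linarith)

theorem sqrt2_diff {s s' : ℝ} (hs : 1/2 ≤ s) (hs' : 1/2 ≤ s') :
    (√(2*s) - √(2*s'))*(√(2*s) + √(2*s')) = 2*(s-s') := by
  have h1 : √(2*s)^2 = 2*s := Real.sq_sqrt (by linarith)
  have h2 : √(2*s')^2 = 2*s' := Real.sq_sqrt (by linarith)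
  nlinarith

theorem sqrt2_lip {s s' : ℝ} (hs : 1/2 ≤ s) (hs' : 1/2 ≤ s') : |√(2*s) - √(2*s')| ≤ |s - s'| := by
  have h1 := sqrt2_one_le hs
  have h2 := sqrt2_one_le hs'
  have h3 := congrArg abs (sqrt2_diff hs hs')
  rw [abs_mul, abs_mul, abs_of_nonneg (by linarith : 0 ≤ √(2*s) + √(2*s')), abs_two] at h3
  nlinarith [abs_nonneg (√(2*s) - √(2*s'))]

theorem E_num {k l t t0 κ C0 dm dv e1 e2 : ℝ} (hl : 0 ≤ l) (ht : 1 ≤ t) (h0 : 0 ≤ t0) (h01 : t0 ≤ t)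
    (hd : t - t0 ≤ l) (hC0 : 0 ≤ C0) (he1 : |e1| ≤ 2*C0*l^2) (he2 : |e2| ≤ 2*C0*l^2)
    (hm : dm = l*κ^2 + e1) (hv : dv = l*κ/t + e2) :
    dm - 2*κ*t0*dv + κ^2*l ≤ (2*κ^2 + 2*C0 + 4*|κ| * t*C0)*l^2 := by
  have e : dm - 2*κ*t0*dv + κ^2*l = 2*l*κ^2*((t-t0)/t) + e1 - 2*κ*t0*e2 := by
    rw [hm, hv]; field_simp; ring
  have h1 : (t-t0)/t ≤ l := (div_le_self (by linarith) ht).trans hd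
  have h2 : 2*l*κ^2*((t-t0)/t) ≤ 2*l*κ^2*l := by gcongr
  have h3 : |2*κ*t0*e2| ≤ 2*|κ| * t*(2*C0*l^2) := by
    rw [abs_mul, abs_mul, abs_mul, abs_two, abs_of_nonneg h0]
    gcongr
  have h4 := abs_le.1 he1
  have h5 := abs_le.1 h3
  rw [e]
  nlinarith

open Topology in
set_option maxHeartbeats 800000 in
theorem SX.L2 {m Φ A B} (h : SX m Φ A B) {s x : ℝ} (hs : 1/2 < s) :
    ∃ N0, ∀ᶠ k in 𝓝 (0:ℝ), ∀ α β, |α| ≤ |k| → |β| ≤ |k| →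
      (psiSX Φ (s+(β+k)/2) (x+(β-k)/2) - psiSX Φ (s+(α+k)/2) (x+(α-k)/2)
        - (β-α)*((Φ s x / √(2*s) + A s x + B s x)/2))^2 ≤ N0*|k|^3 := by
  obtain ⟨C1, hC1, e1⟩ := peano2' (f := fun a => m a x) (f' := fun a => A a x^2 + B a x^2)
    ((lt_mem_nhds hs).mono fun a ha => h.ms a x ha) (h.dE s x hs)
  obtain ⟨C2, hC2, e2⟩ := peano2' (f := fun a => m s a) (f' := fun a => 2 * A s a * B s a)
    (Eventually.of_forall fun a => h.mx s a hs) (h.dG s x hs)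
  obtain ⟨As, hA, hB⟩ := h.wav s x hs
  have hp : 0 < √(2*s) := Real.sqrt_pos.2 (by linarith)
  obtain ⟨C3, hC3, e3⟩ := peano2' (f := fun a => Φ a x) (f' := fun a => A a x / √(2*a))
    ((lt_mem_nhds hs).mono fun a ha => h.Φs a x ha)
    (hA.div (hasDerivAt_sqrt2 hs) hp.ne').differentiableAt
  obtain ⟨C4, hC4, e4⟩ := peano2' (f := fun a => Φ s a) (f' := fun a => B s a / √(2*s))
    (Eventually.of_forall fun a => h.Φx s a hs) (hB.div_const _).differentiableAt
  have tn : Tendsto (fun k : ℝ => -k) (𝓝 0) (𝓝 0) := by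
    simpa using (continuous_neg (G := ℝ)).tendsto 0
  have e2' := tn.eventually e2
  have e4' := tn.eventually e4
  set C0 := C1 + C2 + C3 + C4 with hC0d
  have hC0 : 0 ≤ C0 := by positivity
  set t := √(2*s) with htd
  have ht : 1 ≤ t := sqrt2_one_le hs.le
  set κ := A s x + B s x with hκ
  set C5 := 2*κ^2 + 2*C0 + 4*|κ| * t*C0 with hC5d
  have hC5 : 0 ≤ C5 := by positivity
  set C := √C5 + |κ| + C0 + |A s x| + |B s x| with hCd
  have hC : 0 ≤ C := by positivity
  refine ⟨2*C5 + 2*(|Φ s x| + 4*C)^2, ?_⟩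
  have small : ∀ᶠ k in 𝓝 (0:ℝ), |k| < min 1 (s - 1/2) := by
    have := (continuous_abs (G := ℝ)).tendsto 0
    rw [abs_zero] at this
    exact this.eventually (gt_mem_nhds (lt_min one_pos (by linarith)))
  filter_upwards [e1, e2', e3, e4', small] with k h1 h2 h3 h4 hk
  simp only [neg_sq, ← sub_eq_add_neg] at h2 h4
  have hk1 : |k| < 1 := hk.trans_le (min_le_left _ _)
  have hks : |k| < s - 1/2 := hk.trans_le (min_le_right _ _)
  set l := |k| with hl
  have hl0 : 0 ≤ l := abs_nonneg k
  have hkl : -l ≤ k ∧ k ≤ l := abs_le.1 hl.ge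
  have hl2 : l^2 = k^2 := sq_abs k
  set u : ℝ → ℝ := fun β => m (s+(β+k)/2) (x+(β-k)/2) with hu
  set v : ℝ → ℝ := fun β => Φ (s+(β+k)/2) (x+(β-k)/2) with hv
  set s0 := s + (k-l)/2 with hs0
  have hs0' : 1/2 < s0 := by linarith [hkl.1]
  set t0 := √(2*s0) with ht0
  have ht01 : 1 ≤ t0 := sqrt2_one_le hs0'.le
  have ht0t : t0 ≤ t := Real.sqrt_le_sqrt (by linarith [hkl.2])
  have ht0d : |t0 - t| ≤ l := (sqrt2_lip hs0'.le hs.le).trans (by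
    rw [abs_le]; constructor <;> linarith [hkl.1, hkl.2])
  have hQ : ∀ α β, -l ≤ α → α ≤ β → β ≤ l → ∀ κ : ℝ,
      0 ≤ u β - u α - 2*κ*t0*(v β - v α) + κ^2*((β-α)/2) := by
    intro α β ha hab hb κ
    have := h.quad hs0' (s := s+(α+k)/2) (x := x+(α-k)/2) (θ := (β-α)/2) (by linarith) (by linarith) κ
    have q1 : s+(α+k)/2 + (β-α)/2 = s+(β+k)/2 := by ring
    have q2 : x+(α-k)/2 + (β-α)/2 = x+(β-k)/2 := by ring
    rw [q1, q2] at this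
    exact this
  have ub : ∀ c, c ≤ C0 → c * k^2 ≤ C0 * l^2 := by
    intro c hc; rw [hl2]; gcongr
  have b1 := (abs_le.1 (h1.trans (ub C1 (by linarith))))
  have b2 := (abs_le.1 (h2.trans (ub C2 (by linarith))))
  have b3 := (abs_le.1 (h3.trans (ub C3 (by linarith))))
  have b4 := (abs_le.1 (h4.trans (ub C4 (by linarith))))
  have hl22 : l^2 ≤ l := by nlinarith
  have hC0l : C0 * l^2 ≤ C0 * l := by gcongr
  have hAt : |A s x / t| ≤ |A s x| := by
    rw [abs_div, abs_of_pos hp]; exact div_le_self (abs_nonneg _) ht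
  have hBt : |B s x / t| ≤ |B s x| := by
    rw [abs_div, abs_of_pos hp]; exact div_le_self (abs_nonneg _) ht
  have hkA : |k * (A s x / t)| ≤ l * |A s x| := by
    rw [abs_mul]; gcongr
  have hkB : |k * (B s x / t)| ≤ l * |B s x| := by
    rw [abs_mul]; gcongr
  have hEE : u l - u (-l) - 2*κ*t0*(v l - v (-l)) + κ^2*l ≤ C5*l^2 ∧
      |v (-l) - Φ s x| ≤ (C0 + |A s x| + |B s x|)*l := by
    rcases le_total 0 k with k0 | k0
    · have el : l = k := abs_of_nonneg k0
      have u1 : s + (l+k)/2 = s+k := by rw [el]; ring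
      have u2 : x + (l-k)/2 = x := by rw [el]; ring
      have u3 : s + (-l+k)/2 = s := by rw [el]; ring
      have u4 : x + (-l-k)/2 = x-k := by rw [el]; ring
      simp only [hu, hv, u1, u2, u3, u4]
      constructor
      · refine E_num (k := k) (e1 := m (s+k) x - m s (x-k) - l*κ^2)
          (e2 := Φ (s+k) x - Φ s (x-k) - l*κ/t) hl0 ht (by linarith) ht0t ?_ hC0 ?_ ?_ (by ring) (by ring)
        · linarith [(abs_le.1 ht0d).1]
        · have : l*κ^2 = (k*(A s x^2 + B s x^2) + k*(2 * A s x * B s x)) := by rw [hκ, el]; ring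
          rw [this, abs_le]
          constructor <;> linarith [b1.1, b1.2, b2.1, b2.2]
        · have : l*κ/t = k*(A s x/t) + k*(B s x/t) := by rw [hκ, el]; ring
          rw [this, abs_le]
          constructor <;> linarith [b3.1, b3.2, b4.1, b4.2]
      · rw [abs_le] at hkA hkB ⊢
        have := mul_nonneg hl0 (abs_nonneg (A s x))
        constructor <;> linarith [b4.1, b4.2]
    · have el : l = -k := abs_of_nonpos k0
      have u1 : s + (l+k)/2 = s := by rw [el]; ring
      have u2 : x + (l-k)/2 = x-k := by rw [el]; ring
      have u3 : s + (-l+k)/2 = s+k := by rw [el]; ring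
      have u4 : x + (-l-k)/2 = x := by rw [el]; ring
      simp only [hu, hv, u1, u2, u3, u4]
      constructor
      · refine E_num (k := k) (e1 := m s (x-k) - m (s+k) x - l*κ^2)
          (e2 := Φ s (x-k) - Φ (s+k) x - l*κ/t) hl0 ht (by linarith) ht0t ?_ hC0 ?_ ?_ (by ring) (by ring)
        · linarith [(abs_le.1 ht0d).1]
        · have : l*κ^2 = -(k*(A s x^2 + B s x^2) + k*(2 * A s x * B s x)) := by rw [hκ, el]; ring
          rw [this, abs_le]
          constructor <;> linarith [b1.1, b1.2, b2.1, b2.2]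
        · have : l*κ/t = -(k*(A s x/t) + k*(B s x/t)) := by rw [hκ, el]; ring
          rw [this, abs_le]
          constructor <;> linarith [b3.1, b3.2, b4.1, b4.2]
      · rw [abs_le] at hkA hkB ⊢
        have := mul_nonneg hl0 (abs_nonneg (B s x))
        constructor <;> linarith [b3.1, b3.2]
  obtain ⟨hE, hend⟩ := hEE
  have hseg := fun {α β : ℝ} => L2_seg (u := u) (v := v) (κ := κ) (α := α) (β := β) hl0 hQ hE
  have hv1 : ∀ α, |α| ≤ l → |v α - Φ s x| ≤ C*l := by
    intro α hα
    rw [abs_le] at hα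
    have hD := hseg le_rfl hα.1 hα.2
    set D := t0*(v α - v (-l)) - κ*((α - -l)/2) with hDd
    have hD2 : D^2 ≤ (√C5*l)^2 := by
      rw [mul_pow, Real.sq_sqrt hC5]
      calc D^2 ≤ _ := hD
        _ ≤ 1 * (C5*l^2) := by gcongr; linarith
        _ = _ := by ring
    have hD3 : |D| ≤ √C5*l := abs_le_of_sq_le_sq hD2 (by positivity)
    have hD4 : |t0*(v α - v (-l))| ≤ √C5*l + |κ| * l := by
      have : t0*(v α - v (-l)) = D + κ*((α - -l)/2) := by rw [hDd]; ring
      rw [this]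
      refine (abs_add_le _ _).trans ?_
      rw [abs_mul, abs_of_nonneg (by linarith : 0 ≤ (α - -l)/2)]
      gcongr
      linarith
    have hD5 : |v α - v (-l)| ≤ √C5*l + |κ| * l := by
      rw [abs_mul, abs_of_pos (by linarith : 0 < t0)] at hD4
      exact (le_mul_of_one_le_left (abs_nonneg _) ht01).trans hD4
    calc |v α - Φ s x| ≤ |v α - v (-l)| + |v (-l) - Φ s x| := abs_sub_le _ _ _
      _ ≤ (√C5*l + |κ| * l) + (C0 + |A s x| + |B s x|)*l := add_le_add hD5 hend
      _ = _ := by rw [hCd]; ring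
  have main : ∀ α β, |α| ≤ l → |β| ≤ l → α ≤ β →
      (psiSX Φ (s+(β+k)/2) (x+(β-k)/2) - psiSX Φ (s+(α+k)/2) (x+(α-k)/2)
        - (β-α)*((Φ s x / t + A s x + B s x)/2))^2 ≤ (2*C5 + 2*(|Φ s x| + 4*C)^2)*l^3 := by
    intro α β ha hb hab
    have ha' := abs_le.1 ha
    have hb' := abs_le.1 hb
    have sa : 1/2 ≤ s+(α+k)/2 := by linarith [ha'.1, hkl.1]
    have sb : 1/2 ≤ s+(β+k)/2 := by linarith [hb'.1, hkl.1]
    have := L2_num (t := t) (t0 := t0) (κ := κ) (C := C) (C1 := C5) (l := l) (θ := (β-α)/2)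
      (ta := √(2*(s+(α+k)/2))) (tb := √(2*(s+(β+k)/2))) (va := v α) (vb := v β) (vz := Φ s x)
      ht hC hl0 hk1.le (by linarith) (by linarith [ha'.1, hb'.2]) hC5
      (hseg ha'.1 hab hb'.2) (sqrt2_one_le sa) (sqrt2_one_le sb)
      ((sqrt2_lip sa hs.le).trans (by rw [abs_le]; constructor <;> linarith [ha'.1, ha'.2, hkl.1, hkl.2]))
      ((sqrt2_lip sb hs.le).trans (by rw [abs_le]; constructor <;> linarith [hb'.1, hb'.2, hkl.1, hkl.2]))
      ht0d (by rw [sqrt2_diff sb sa]; ring) (hv1 α ha) (hv1 β hb)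
    have e : psiSX Φ (s+(β+k)/2) (x+(β-k)/2) - psiSX Φ (s+(α+k)/2) (x+(α-k)/2)
        - (β-α)*((Φ s x / t + A s x + B s x)/2) =
        √(2*(s+(β+k)/2)) * v β - √(2*(s+(α+k)/2)) * v α - (β-α)/2 * (κ + Φ s x/t) := by
      simp only [psiSX, hv, hκ]; ring
    rw [e]; exact this
  intro α β ha hb
  rcases le_total α β with hab | hab
  · exact main α β ha hb hab
  · have := main β α hb ha hab
    have e : ∀ a b c : ℝ, (a - b - (β-α)*c)^2 = (b - a - (α-β)*c)^2 := fun a b c => by ring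
    rw [e]; exact this


/-- Clamped wave function in null coordinates. -/
def nPsi (σ : ℝ) (Φ : ℝ → ℝ → ℝ) (ξ η : ℝ) : ℝ := psiSX Φ (max ((ξ+η)/2) σ) ((ξ-η)/2)

/-- Null derivative. -/
def nP (Φ A B : ℝ → ℝ → ℝ) (ξ η : ℝ) : ℝ :=
  (Φ ((ξ+η)/2) ((ξ-η)/2) / √(2*((ξ+η)/2)) + A ((ξ+η)/2) ((ξ-η)/2) + B ((ξ+η)/2) ((ξ-η)/2))/2

/-- Other null derivative. -/
def nQ (Φ A B : ℝ → ℝ → ℝ) (ξ η : ℝ) : ℝ :=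
  (Φ ((ξ+η)/2) ((ξ-η)/2) / √(2*((ξ+η)/2)) + A ((ξ+η)/2) ((ξ-η)/2) - B ((ξ+η)/2) ((ξ-η)/2))/2

open Topology in
theorem SX.condP {m Φ A B} (h : SX m Φ A B) {σ ξ η K : ℝ} (hσ : 1/2 < σ) (hs : σ < (ξ+η)/2)
    (hK : |Φ ((ξ+η)/2) ((ξ-η)/2)| + 1 ≤ K) : ∃ N, CondP K (nPsi σ Φ) (nP Φ A B) N ξ η := by
  obtain ⟨N0, h2⟩ := h.L2 (s := (ξ+η)/2) (x := (ξ-η)/2) (by linarith)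
  have h1 := h.SO (s := (ξ+η)/2) (x := (ξ-η)/2) (by linarith) hK
  have small : ∀ᶠ k in 𝓝 (0:ℝ), |k| < (ξ+η)/2 - σ := by
    have := (continuous_abs (G := ℝ)).tendsto 0
    rw [abs_zero] at this
    exact this.eventually (gt_mem_nhds (by linarith))
  obtain ⟨δ, hδ, H⟩ := Metric.eventually_nhds_iff.1 (h1.and (h2.and small))
  obtain ⟨N, hN⟩ := exists_nat_ge (max N0 (1/δ))
  refine ⟨N, fun k hk => ?_⟩
  have hN0 : N0 ≤ N := (le_max_left _ _).trans hN
  have hNd : 1/δ ≤ N := (le_max_right _ _).trans hN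
  have hkd : |k| < δ := by
    have : 1 ≤ N * δ := by rwa [div_le_iff₀ hδ] at hNd
    by_contra hc
    push Not at hc
    have hn : (0:ℝ) ≤ N := Nat.cast_nonneg N
    nlinarith
  obtain ⟨g1, g2, g3⟩ := H (y := k) (by simpa [Real.dist_eq] using hkd)
  have hka := abs_le.1 g3.le
  constructor
  · have e1 : nPsi σ Φ (ξ+k) (η+k) = psiSX Φ ((ξ+η)/2+k) ((ξ-η)/2) := by
      unfold nPsi
      rw [max_eq_left (by linarith [hka.1])]
      congr 1 <;> ring
    have e2 : nPsi σ Φ (ξ-k) (η+k) = psiSX Φ ((ξ+η)/2) ((ξ-η)/2-k) := by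
      unfold nPsi
      rw [max_eq_left (by linarith [hka.1])]
      congr 1 <;> ring
    have e3 : 2*k*nP Φ A B ξ η = k*(Φ ((ξ+η)/2) ((ξ-η)/2) / √(2*((ξ+η)/2)) + A ((ξ+η)/2) ((ξ-η)/2) + B ((ξ+η)/2) ((ξ-η)/2)) := by
      unfold nP; ring
    rw [e1, e2, e3]; exact g1
  · intro α β ha hb
    have e : ∀ β, |β| ≤ |k| → nPsi σ Φ (ξ+β) (η+k) = psiSX Φ ((ξ+η)/2+(β+k)/2) ((ξ-η)/2+(β-k)/2) := by
      intro β hb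
      have hb' := abs_le.1 hb
      have : -|k| ≤ k := neg_abs_le k
      unfold nPsi
      rw [max_eq_left (by linarith [hb'.1])]
      congr 1 <;> ring
    rw [e β hb, e α ha]
    refine (g2 α β ha hb).trans ?_
    gcongr

open Topology in
theorem SX.nullReg {m Φ A B} (h : SX m Φ A B) {s1 x1 : ℝ} (h1 : 1/2 < s1) :
    ∃ Ω K, (s1+x1, s1-x1) ∈ Ω ∧ NullReg Ω K (nPsi ((s1+1/2)/2) Φ) (nP Φ A B) (nQ Φ A B) := by
  set σ := (s1+1/2)/2 with hσd
  have hσ : 1/2 < σ := by linarith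
  have hσ1 : σ < s1 := by linarith
  have hcomp : IsCompact (Set.Icc σ (s1+1) ×ˢ Set.Icc (x1-1) (x1+1)) := isCompact_Icc.prod isCompact_Icc
  obtain ⟨C, hC⟩ := hcomp.exists_bound_of_continuousOn (f := fun v : ℝ × ℝ => Φ v.1 v.2)
    (h.cΦ.mono (fun v hv => lt_of_lt_of_le hσ hv.1.1))
  have hbd : ∀ s x, σ < s → s < s1 + 1 → x1 - 1 < x → x < x1+1 → |Φ s x| + 1 ≤ |C| + 1 := by
    intro s x a b c d
    have := hC (s,x) ⟨⟨a.le, b.le⟩, ⟨c.le, d.le⟩⟩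
    simp only [Real.norm_eq_abs] at this
    linarith [le_abs_self C]
  refine ⟨{w | σ < (w.1+w.2)/2 ∧ (w.1+w.2)/2 < s1+1 ∧ x1-1 < (w.1-w.2)/2 ∧ (w.1-w.2)/2 < x1+1}, |C|+1,
    ⟨by simp only; linarith, by simp only; linarith, by simp only; linarith, by simp only; linarith⟩, ?_⟩
  have cl : ∀ ξ η : ℝ, σ < (ξ+η)/2 → ∀ᶠ h in 𝓝 (0:ℝ), σ < (ξ+η)/2 + h := by
    intro ξ η hh
    have : Tendsto (fun h : ℝ => (ξ+η)/2+h) (𝓝 0) (𝓝 ((ξ+η)/2)) := by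
      simpa using (continuous_const_add ((ξ+η)/2)).tendsto 0
    exact this.eventually (lt_mem_nhds hh)
  refine ⟨?_, by positivity, ?_, ?_, ?_, ?_, ?_, ?_⟩
  · have c1 : Continuous (fun w : ℝ × ℝ => (w.1+w.2)/2) := by fun_prop
    have c2 : Continuous (fun w : ℝ × ℝ => (w.1-w.2)/2) := by fun_prop
    exact (isOpen_lt continuous_const c1).inter ((isOpen_lt c1 continuous_const).inter
      ((isOpen_lt continuous_const c2).inter (isOpen_lt c2 continuous_const)))
  · have cmx : Continuous (fun v : ℝ × ℝ => (max ((v.1+v.2)/2) σ, (v.1-v.2)/2)) := by fun_prop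
    have := h.cΦ.comp_continuous cmx (fun v => lt_of_lt_of_le hσ (le_max_right _ _))
    unfold nPsi psiSX
    exact (by fun_prop : Continuous (fun z : ℝ × ℝ => √(2 * max ((z.1+z.2)/2) σ))).mul this
  · intro ξ η hw
    have hs : 1/2 < (ξ+η)/2 := by linarith [hw.1]
    have d := h.psi_s (s := (ξ+η)/2) (x := (ξ-η)/2) hs
    have d2 : HasDerivAt (fun h => psiSX Φ ((ξ+η)/2+h) ((ξ-η)/2))
        (Φ ((ξ+η)/2) ((ξ-η)/2) / √(2*((ξ+η)/2)) + A ((ξ+η)/2) ((ξ-η)/2)) 0 := by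
      have := HasDerivAt.comp_const_add ((ξ+η)/2) 0 (f := fun a => psiSX Φ a ((ξ-η)/2)) (by rw [add_zero]; exact d)
      exact this
    refine (d2.congr_of_eventuallyEq ?_).congr_deriv (by unfold nP nQ; ring)
    filter_upwards [cl ξ η hw.1] with u hu
    unfold nPsi
    rw [max_eq_left (by linarith)]
    congr 1 <;> ring
  · intro ξ η hw
    have hs : 1/2 < (ξ+η)/2 := by linarith [hw.1]
    have d := h.psi_x (s := (ξ+η)/2) (x := (ξ-η)/2) hs
    have d2 : HasDerivAt (fun h => psiSX Φ ((ξ+η)/2) ((ξ-η)/2+h)) (B ((ξ+η)/2) ((ξ-η)/2)) 0 := by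
      have := HasDerivAt.comp_const_add ((ξ-η)/2) 0 (f := fun a => psiSX Φ ((ξ+η)/2) a) (by simpa using d)
      exact this
    refine (d2.congr_of_eventuallyEq ?_).congr_deriv (by unfold nP nQ; ring)
    filter_upwards with u
    unfold nPsi
    rw [max_eq_left (by linarith [hw.1])]
    congr 1 <;> ring
  · intro ξ η hw
    have hs : 1/2 < (ξ+η)/2 := by linarith [hw.1]
    obtain ⟨As, hA, -⟩ := h.wav ((ξ+η)/2) ((ξ-η)/2) hs
    have c := (h.psi_ss hs hA).continuousAt
    have c2 : ContinuousAt (fun u : ℝ => (ξ+η)/2 + u) 0 := by fun_prop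
    have c3 := ContinuousAt.comp (f := fun u : ℝ => (ξ+η)/2 + u)
      (g := fun a => Φ a ((ξ-η)/2) / √(2*a) + A a ((ξ-η)/2)) (x := (0:ℝ)) (by simpa using c) c2
    refine c3.congr (Eventually.of_forall fun u => ?_)
    have e1 : (ξ + u + (η + u))/2 = (ξ+η)/2 + u := by ring
    have e2 : (ξ + u - (η + u))/2 = (ξ-η)/2 := by ring
    simp only [nP, nQ, Function.comp_apply, e1, e2]
    ring
  · intro ξ η hw
    exact h.condP hσ hw.1 (hbd _ _ hw.1 hw.2.1 hw.2.2.1 hw.2.2.2)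
  · intro ξ η hw
    have e1 : (η+ξ)/2 = (ξ+η)/2 := by ring
    have e2 : -((η-ξ)/2) = (ξ-η)/2 := by ring
    have := h.reflect.condP (ξ := η) (η := ξ) (K := |C|+1) hσ (by rw [e1]; exact hw.1)
      (by rw [e1, e2]; exact hbd _ _ hw.1 hw.2.1 hw.2.2.1 hw.2.2.2)
    have f1 : (fun a b => nPsi σ Φ b a) = nPsi σ (fun s x => Φ s (-x)) := by
      funext a b
      have g1 : (b+a)/2 = (a+b)/2 := by ring
      have g2 : -((a-b)/2) = (b-a)/2 := by ring
      simp only [nPsi, psiSX, g1, g2]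
    have f2 : (fun a b => nQ Φ A B b a) = nP (fun s x => Φ s (-x)) (fun s x => A s (-x)) (fun s x => -B s (-x)) := by
      funext a b
      have g1 : (b+a)/2 = (a+b)/2 := by ring
      have g2 : -((a-b)/2) = (b-a)/2 := by ring
      simp only [nP, nQ, g1, g2]; ring
    rw [f1, f2]; exact this

open Topology in
theorem SX.main {m Φ A B} (h : SX m Φ A B) {s1 x1 : ℝ} (h1 : 1/2 < s1) :
    ContinuousAt (fun v : ℝ × ℝ => A v.1 v.2) (s1, x1) ∧ ContinuousAt (fun v : ℝ × ℝ => B v.1 v.2) (s1, x1) := by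
  obtain ⟨Ω, K, hz, hN⟩ := h.nullReg (x1 := x1) h1
  obtain ⟨cp, cq⟩ := hN.main hz
  have cmap : ContinuousAt (fun v : ℝ × ℝ => (v.1+v.2, v.1-v.2)) (s1, x1) := by fun_prop
  have cp' := ContinuousAt.comp (f := fun v : ℝ × ℝ => (v.1+v.2, v.1-v.2)) (x := (s1,x1)) cp cmap
  have cq' := ContinuousAt.comp (f := fun v : ℝ × ℝ => (v.1+v.2, v.1-v.2)) (x := (s1,x1)) cq cmap
  have cΦ : ContinuousAt (fun v : ℝ × ℝ => Φ v.1 v.2) (s1, x1) :=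
    h.cΦ.continuousAt ((isOpen_lt continuous_const continuous_fst).mem_nhds h1)
  have hp : √(2*s1) ≠ 0 := (Real.sqrt_pos.2 (by linarith)).ne'
  have cR : ContinuousAt (fun v : ℝ × ℝ => Φ v.1 v.2 / √(2*v.1)) (s1, x1) := cΦ.div (by fun_prop) hp
  constructor
  · refine ((cp'.add cq').sub cR).congr (Eventually.of_forall fun v => ?_)
    have g1 : (v.1+v.2+(v.1-v.2))/2 = v.1 := by ring
    have g2 : (v.1+v.2-(v.1-v.2))/2 = v.2 := by ring
    simp only [Function.comp_apply, nP, nQ, g1, g2, Pi.add_apply, Pi.sub_apply]; ring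
  · refine (cp'.sub cq').congr (Eventually.of_forall fun v => ?_)
    have g1 : (v.1+v.2+(v.1-v.2))/2 = v.1 := by ring
    have g2 : (v.1+v.2-(v.1-v.2))/2 = v.2 := by ring
    simp only [Function.comp_apply, nP, nQ, g1, g2, Pi.sub_apply]; ring


theorem inDom_top {t : ℝ} (ht : 1 ≤ t) : InDom ⊤ t := ⟨ht, EReal.coe_lt_top t⟩

section EVS
variable {lam mu phi : ℝ → ℝ → ℝ}

/-- The time-independent function. -/
def cfun (lam mu : ℝ → ℝ → ℝ) (r : ℝ) : ℝ := lam 1 r - mu 1 r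

theorem evs_mut (h : IsEVS 0 ⊤ lam mu phi (fun _ _ _ _ => 0)) {t : ℝ} (r : ℝ) (ht : 1 ≤ t) :
    ptd mu t r = 1/(2*t) + 2*π*t*(ptd phi t r^2 + exp (2*mu t r - 2*lam t r) * prd phi t r^2) := by
  have := h.ee2 t r (inDom_top ht)
  simp only [pres, mul_zero, integral_zero, zero_add, sub_zero] at this
  have e1 : exp (2*mu t r - 2*lam t r) = exp (2*mu t r) * exp (-2*lam t r) := by
    rw [← exp_add]; ring_nf
  have e2 : exp (2*mu t r) * exp (-2*mu t r) = 1 := by rw [← exp_add]; simp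
  have t0 : 0 < t := by linarith
  have k := congrArg (fun z => exp (2*mu t r) * z) this
  have k2 : 2*t*ptd mu t r - 1 = 4*π*t^2*(ptd phi t r^2 + exp (2*mu t r - 2*lam t r) * prd phi t r^2) := by
    rw [e1]
    linear_combination k + (-(2*t*ptd mu t r - 1) + 4*π*t^2*ptd phi t r^2) * e2
  have k3 : ptd mu t r = (1 + 4*π*t^2*(ptd phi t r^2 + exp (2*mu t r - 2*lam t r) * prd phi t r^2))/(2*t) := by
    rw [eq_div_iff (by positivity)]; linarith
  rw [k3]; field_simp; ring

theorem evs_lamt (h : IsEVS 0 ⊤ lam mu phi (fun _ _ _ _ => 0)) {t : ℝ} (r : ℝ) (ht : 1 ≤ t) :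
    ptd lam t r = ptd mu t r - 1/t := by
  have a1 := h.ee1 t r (inDom_top ht)
  have a2 := h.ee2 t r (inDom_top ht)
  simp only [pres, rho, mul_zero, integral_zero, zero_add, sub_zero, add_zero] at a1 a2
  have t0 : 0 < t := by linarith
  have k : 2*t*ptd lam t r + 1 = 2*t*ptd mu t r - 1 :=
    mul_left_cancel₀ (exp_pos (-2*mu t r)).ne' (a1.trans a2.symm)
  field_simp
  linarith

theorem evs_mur (h : IsEVS 0 ⊤ lam mu phi (fun _ _ _ _ => 0)) {t : ℝ} (r : ℝ) (ht : 1 ≤ t) :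
    prd mu t r = 4*π*t*ptd phi t r*prd phi t r := by
  have a := h.ee3 t r (inDom_top ht)
  simp only [jmom, mul_zero, integral_zero, zero_sub] at a
  have e2 : exp (lam t r + mu t r) * exp (-(lam t r + mu t r)) = 1 := by rw [← exp_add]; simp
  linear_combination a + 4*π*t*ptd phi t r*prd phi t r * e2

theorem evs_c (h : IsEVS 0 ⊤ lam mu phi (fun _ _ _ _ => 0)) {t : ℝ} (r : ℝ) (ht : 1 ≤ t) :
    lam t r = mu t r - log t + cfun lam mu r := by
  have key := (convex_Ici (1:ℝ)).norm_image_sub_le_of_norm_hasDerivWithin_le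
    (f := fun t => lam t r - mu t r + log t) (f' := fun _ => 0) (C := 0) (x := 1) (y := t)
    ?_ (by simp) (by simp) ht
  · simp only [log_one, zero_mul, norm_le_zero_iff] at key
    unfold cfun; linarith
  · intro s hs
    have hs1 : (1:ℝ) ≤ s := hs
    have d1 := (h.reg_lam_t s r (inDom_top hs1)).hasDerivAt
    have d2 := (h.reg_mu_t s r (inDom_top hs1)).hasDerivAt
    have d3 := Real.hasDerivAt_log (by linarith : s ≠ 0)
    refine (((d1.sub d2).add d3).congr_deriv ?_).hasDerivWithinAt
    have := evs_lamt h r hs1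
    unfold ptd at this
    rw [this]; field_simp; ring

theorem evs_exp (h : IsEVS 0 ⊤ lam mu phi (fun _ _ _ _ => 0)) {t : ℝ} (r : ℝ) (ht : 1 ≤ t) :
    exp (mu t r - lam t r) = t * exp (-cfun lam mu r) := by
  have : mu t r - lam t r = log t + - cfun lam mu r := by rw [evs_c h r ht]; ring
  rw [this, exp_add, exp_log (by linarith)]

theorem evs_exp2 (h : IsEVS 0 ⊤ lam mu phi (fun _ _ _ _ => 0)) {t : ℝ} (r : ℝ) (ht : 1 ≤ t) :
    exp (2*mu t r - 2*lam t r) = (t * exp (-cfun lam mu r))^2 := by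
  rw [← evs_exp h r ht, ← exp_nat_mul]; congr 1; push_cast; ring

theorem evs_cd (h : IsEVS 0 ⊤ lam mu phi (fun _ _ _ _ => 0)) {t : ℝ} (r : ℝ) (ht : 1 ≤ t) :
    HasDerivAt (cfun lam mu) (prd lam t r - prd mu t r) r := by
  have d1 := (h.reg_lam_r t r (inDom_top ht)).hasDerivAt
  have d2 := (h.reg_mu_r t r (inDom_top ht)).hasDerivAt
  refine ((d1.sub d2).add_const (log t)).congr_of_eventuallyEq (Eventually.of_forall fun y => ?_)
  simp only [evs_c h y ht, Pi.sub_apply]; ring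

theorem evs_wave (h : IsEVS 0 ⊤ lam mu phi (fun _ _ _ _ => 0)) {t : ℝ} (r : ℝ) (ht : 1 ≤ t) :
    (t * exp (-cfun lam mu r))^2 * (deriv (fun x => prd phi t x) r - (prd lam t r - prd mu t r) * prd phi t r)
     = deriv (fun s => ptd phi s r) t + ptd phi t r / t := by
  have a := h.wave t r (inDom_top ht)
  rw [evs_lamt h r ht] at a
  rw [← evs_exp2 h r ht]
  have e1 : exp (2*mu t r - 2*lam t r) = exp (2*mu t r) * exp (-2*lam t r) := by
    rw [← exp_add]; ring_nf
  have e2 : exp (2*mu t r) * exp (-2*mu t r) = 1 := by rw [← exp_add]; simp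
  have e3 : ptd phi t r * (2/t) = 2 * (ptd phi t r / t) := by ring
  have e4 : ptd phi t r * (1/t) = (ptd phi t r / t) := by ring
  rw [e1]
  linear_combination exp (2*mu t r) * a + (deriv (fun s => ptd phi s r) t + ptd phi t r / t) * e2
    + exp (2*mu t r) * exp (-2*mu t r) * e3 - exp (2*mu t r) * exp (-2*mu t r) * e4

open Topology in
theorem cont_of_mono {g : ℝ → ℝ → ℝ} (hm : ∀ r, Monotone fun t => g t r)
    (h1 : ∀ r, Continuous fun t => g t r) (h2 : ∀ t, Continuous fun r => g t r) :
    Continuous (fun v : ℝ × ℝ => g v.1 v.2) := by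
  rw [continuous_iff_continuousAt]
  rintro ⟨t0, r0⟩
  rw [Metric.continuousAt_iff']
  intro ε hε
  obtain ⟨δ, hδ, H⟩ := Metric.continuousAt_iff.1 ((h1 r0).continuousAt (x := t0)) (ε/2) (by linarith)
  have a1 := H (x := t0 + δ/2) (by simp [abs_of_pos hδ]; linarith)
  have a2 := H (x := t0 - δ/2) (by simp [abs_of_pos hδ]; linarith)
  have b1 := Metric.continuousAt_iff'.1 ((h2 (t0+δ/2)).continuousAt (x := r0)) (ε/2) (by linarith)
  have b2 := Metric.continuousAt_iff'.1 ((h2 (t0-δ/2)).continuousAt (x := r0)) (ε/2) (by linarith)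
  have c1 : ∀ᶠ t in 𝓝 t0, t0-δ/2 < t ∧ t < t0 + δ/2 :=
    Ioo_mem_nhds (by linarith) (by linarith)
  rw [nhds_prod_eq]
  filter_upwards [c1.prod_mk (b1.and b2)] with v hv
  obtain ⟨⟨p1, p2⟩, q1, q2⟩ := hv
  have m1 := hm v.2 p1.le
  have m2 := hm v.2 p2.le
  simp only [Real.dist_eq, abs_lt] at *
  constructor <;> linarith [a1.1,a1.2,a2.1,a2.2,q1.1,q1.2,q2.1,q2.2]

/-- Clamped potential. -/
def Nfun (mu : ℝ → ℝ → ℝ) (t r : ℝ) : ℝ := (mu t r - log t / 2) / (2*π)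

theorem evs_Nt (h : IsEVS 0 ⊤ lam mu phi (fun _ _ _ _ => 0)) {t : ℝ} (r : ℝ) (ht : 1 ≤ t) :
    HasDerivAt (fun s => Nfun mu s r) (t*(ptd phi t r^2 + (t*exp (-cfun lam mu r)*prd phi t r)^2)) t := by
  have d2 := (h.reg_mu_t t r (inDom_top ht)).hasDerivAt
  have d3 := (Real.hasDerivAt_log (by linarith : t ≠ 0)).div_const 2
  refine ((d2.sub d3).div_const (2*π)).congr_deriv ?_
  have := evs_mut h r ht
  unfold ptd at this
  rw [this, evs_exp2 h r ht]
  have := pi_pos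
  have : 0 < t := by linarith
  unfold ptd
  field_simp
  ring

theorem mono_clamp {g g' : ℝ → ℝ} (hg : ∀ t, 1 ≤ t → HasDerivAt g (g' t) t) (h0 : ∀ t, 1 ≤ t → 0 ≤ g' t) :
    MonotoneOn g (Set.Ici 1) := by
  apply monotoneOn_of_deriv_nonneg (convex_Ici 1)
  · exact fun t ht => (hg t ht).continuousAt.continuousWithinAt
  · intro t ht
    rw [interior_Ici] at ht
    exact (hg t ht.le).differentiableAt.differentiableWithinAt
  · intro t ht
    rw [interior_Ici] at ht
    rw [(hg t ht.le).deriv]; exact h0 t ht.le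

theorem evs_Nmono (h : IsEVS 0 ⊤ lam mu phi (fun _ _ _ _ => 0)) (r : ℝ) :
    MonotoneOn (fun t => Nfun mu t r) (Set.Ici 1) :=
  mono_clamp (fun t ht => evs_Nt h r ht) (fun t ht => by positivity)

theorem cont_clamp {g : ℝ → ℝ} (hg : ∀ t, 1 ≤ t → ContinuousAt g t) : Continuous fun t => g (max t 1) := by
  rw [continuous_iff_continuousAt]
  intro t
  exact ContinuousAt.comp (f := fun t : ℝ => max t 1) (hg _ (le_max_right _ _)) (by fun_prop)

theorem evs_Ncont (h : IsEVS 0 ⊤ lam mu phi (fun _ _ _ _ => 0)) :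
    Continuous (fun v : ℝ × ℝ => Nfun mu (max v.1 1) v.2) := by
  apply cont_of_mono (g := fun t r => Nfun mu (max t 1) r)
  · intro r t t' htt
    exact evs_Nmono h r (Set.mem_Ici.2 (le_max_right t 1)) (Set.mem_Ici.2 (le_max_right t' 1)) (max_le_max_right 1 htt)
  · intro r
    exact cont_clamp (fun t ht => (evs_Nt h r ht).continuousAt)
  · intro t
    rw [continuous_iff_continuousAt]
    intro r
    have := (h.reg_mu_r (max t 1) r (inDom_top (le_max_right _ _))).continuousAt
    unfold Nfun
    fun_prop

theorem evs_mucont (h : IsEVS 0 ⊤ lam mu phi (fun _ _ _ _ => 0)) :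
    Continuous (fun v : ℝ × ℝ => mu (max v.1 1) v.2) := by
  have := evs_Ncont h
  have c : Continuous fun v : ℝ × ℝ => log (max v.1 1) / 2 := by
    refine (Continuous.log (by fun_prop) (fun v => ?_)).div_const 2
    have := le_max_right v.1 1
    linarith
  refine ((this.mul (continuous_const (y := 2*π))).add c).congr (fun v => ?_)
  simp only [Nfun, Pi.add_apply, Pi.mul_apply]
  have := pi_pos
  field_simp
  ring

theorem evs_phidiff (h : IsEVS 0 ⊤ lam mu phi (fun _ _ _ _ => 0)) (r : ℝ) {t t' : ℝ} (ht : 1 ≤ t) (htt : t ≤ t') :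
    (phi t' r - phi t r)^2 ≤ (t'-t)*(Nfun mu t' r - Nfun mu t r) := by
  apply disc_le (by linarith)
  intro κ
  have := mono_clamp (g := fun t => Nfun mu t r - 2*κ*phi t r + κ^2*t)
    (fun t ht => ((evs_Nt h r ht).sub ((h.reg_phi_t t r (inDom_top ht)).hasDerivAt.const_mul (2*κ))).add
      ((hasDerivAt_id t).const_mul (κ^2))) ?_ ht (ht.trans htt) htt
  · simp only at this; nlinarith
  · intro t ht
    have hp : (0:ℝ) ≤ ptd phi t r^2 := sq_nonneg _
    have hq : (0:ℝ) ≤ (t*exp (-cfun lam mu r)*prd phi t r)^2 := sq_nonneg _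
    have : ptd phi t r^2 ≤ t*(ptd phi t r^2 + (t*exp (-cfun lam mu r)*prd phi t r)^2) := by nlinarith
    have h3 := sq_nonneg (ptd phi t r - κ)
    have e : deriv (fun s => phi s r) t = ptd phi t r := rfl
    rw [e]
    nlinarith

open Topology in
theorem evs_phicont (h : IsEVS 0 ⊤ lam mu phi (fun _ _ _ _ => 0)) :
    Continuous (fun v : ℝ × ℝ => phi (max v.1 1) v.2) := by
  rw [continuous_iff_continuousAt]
  rintro ⟨t0, r0⟩
  have hN := evs_Ncont h
  set t1 := max t0 1 with ht1
  have c1 : Continuous (fun v : ℝ × ℝ => |max v.1 1 - t1| * |Nfun mu (max v.1 1) v.2 - Nfun mu t1 v.2|) := by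
    have : Continuous (fun v : ℝ × ℝ => Nfun mu t1 v.2) :=
      hN.comp (by fun_prop : Continuous fun v : ℝ × ℝ => (t0, v.2))
    exact (by fun_prop : Continuous fun v : ℝ × ℝ => |max v.1 1 - t1|).mul (hN.sub this).abs
  have c2 : Continuous (fun r => phi t1 r) := by
    rw [continuous_iff_continuousAt]
    exact fun r => (h.reg_phi_r t1 r (inDom_top (le_max_right _ _))).continuousAt
  have c3 : Tendsto (fun v : ℝ × ℝ => √(|max v.1 1 - t1| * |Nfun mu (max v.1 1) v.2 - Nfun mu t1 v.2|))
      (𝓝 (t0,r0)) (𝓝 0) := by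
    have := (c1.sqrt).tendsto (t0, r0)
    simpa [← ht1] using this
  have c4 : Tendsto (fun v : ℝ × ℝ => phi (max v.1 1) v.2 - phi t1 v.2) (𝓝 (t0,r0)) (𝓝 0) := by
    refine squeeze_zero_norm (fun v => ?_) c3
    rw [Real.norm_eq_abs]
    apply Real.abs_le_sqrt
    rcases le_total (max v.1 1) t1 with hh | hh
    · have := evs_phidiff h v.2 (le_max_right _ _) hh
      calc _ = (phi t1 v.2 - phi (max v.1 1) v.2)^2 := by ring
        _ ≤ _ := this
        _ ≤ |t1 - max v.1 1| * |Nfun mu t1 v.2 - Nfun mu (max v.1 1) v.2| := by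
          rw [← abs_mul]; exact le_abs_self _
        _ = _ := by rw [abs_sub_comm, abs_sub_comm (Nfun mu t1 v.2)]
    · have := evs_phidiff h v.2 (le_max_right _ _) hh
      refine this.trans ?_
      rw [← abs_mul]; exact le_abs_self _
  have c5 : Tendsto (fun v : ℝ × ℝ => phi t1 v.2) (𝓝 (t0,r0)) (𝓝 (phi t1 r0)) :=
    (c2.comp continuous_snd).tendsto (t0,r0)
  have := c4.add c5
  simpa [ContinuousAt] using this

end EVS


section EVS
variable {lam mu phi : ℝ → ℝ → ℝ}

theorem evs_ccont (h : IsEVS 0 ⊤ lam mu phi (fun _ _ _ _ => 0)) : Continuous (cfun lam mu) :=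
  continuous_iff_continuousAt.2 fun r => (evs_cd h r le_rfl).continuousAt

theorem evs_cper (h : IsEVS 0 ⊤ lam mu phi (fun _ _ _ _ => 0)) : Function.Periodic (cfun lam mu) 1 := by
  intro r; simp [cfun, h.per_lam, h.per_mu]

theorem per_bdd {c : ℝ → ℝ} (hc : Continuous c) (hp : Function.Periodic c 1) : ∃ C, ∀ r, |c r| ≤ C := by
  obtain ⟨C, hC⟩ := isCompact_Icc.exists_bound_of_continuousOn (s := Set.Icc (0:ℝ) 1) hc.continuousOn
  refine ⟨C, fun r => ?_⟩
  have := hC (Int.fract r) ⟨Int.fract_nonneg r, (Int.fract_lt_one r).le⟩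
  have e : c (Int.fract r) = c r := by
    have := hp.sub_zsmul_eq (x := r) ⌊r⌋
    rw [zsmul_one] at this
    exact this
  rw [e] at this
  exact this

open Topology in
/-- existence of a chart inverse -/
theorem chart_exists {c : ℝ → ℝ} (hc : Continuous c) (hp : Function.Periodic c 1) :
    ∃ X Y : ℝ → ℝ, (∀ r, HasDerivAt X (exp (c r)) r) ∧ (∀ r, Y (X r) = r) ∧ (∀ x, X (Y x) = x) ∧
      ∀ x, HasDerivAt Y (exp (-c (Y x))) x := by
  obtain ⟨C, hC⟩ := per_bdd hc hp
  set X : ℝ → ℝ := fun r => ∫ y in (0:ℝ)..r, exp (c y) with hX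
  have hec : Continuous fun y => exp (c y) := by fun_prop
  have hd : ∀ r, HasDerivAt X (exp (c r)) r := fun r =>
    intervalIntegral.integral_hasDerivAt_right (hec.intervalIntegrable _ _)
      (hec.stronglyMeasurableAtFilter _ _) hec.continuousAt
  have hXc : Continuous X := continuous_iff_continuousAt.2 fun r => (hd r).continuousAt
  have hXm : StrictMono X := strictMono_of_deriv_pos fun r => by rw [(hd r).deriv]; exact exp_pos _
  have hlow : ∀ a b, a ≤ b → exp (-C) * (b - a) ≤ X b - X a := by
    intro a b hab
    have : Monotone fun r => X r - exp (-C) * r := by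
      apply monotone_of_deriv_nonneg
      · exact fun r => ((hd r).sub ((hasDerivAt_id r).const_mul _)).differentiableAt
      · intro r
        have := ((hd r).sub ((hasDerivAt_id r).const_mul (exp (-C)))).deriv
        rw [show deriv (fun r => X r - exp (-C) * r) r = _ from this]
        have : exp (-C) ≤ exp (c r) := exp_le_exp.2 (abs_le.1 (hC r)).1
        simpa using this
    have := this hab
    simp only at this
    linarith
  have X0 : X 0 = 0 := by simp [hX]
  have hsurj : Function.Surjective X := by
    apply hXc.surjective
    · apply tendsto_atTop_mono' atTop (f₁ := fun r => exp (-C) * r)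
      · filter_upwards [eventually_ge_atTop 0] with r hr
        have := hlow 0 r hr
        rw [X0] at this; linarith
      · exact tendsto_id.const_mul_atTop (exp_pos _)
    · apply tendsto_atBot_mono' atBot (f₁ := fun r => exp (-C) * r) (f₂ := X)
      · filter_upwards [eventually_le_atBot 0] with r hr
        have := hlow r 0 hr
        rw [X0] at this; linarith
      · exact tendsto_id.const_mul_atBot (exp_pos _)
  set e := StrictMono.orderIsoOfSurjective X hXm hsurj with he
  have heX : ∀ r, e r = X r := fun r => rfl
  refine ⟨X, e.symm, hd, fun r => by rw [← heX]; simp, fun x => by rw [← heX]; simp, fun x => ?_⟩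
  have := HasDerivAt.of_local_left_inverse (f := X) (g := e.symm) (f' := exp (c (e.symm x))) (a := x)
    e.symm.continuous.continuousAt (hd _) (exp_pos _).ne'
    (Eventually.of_forall fun y => by rw [← heX]; simp)
  rwa [← Real.exp_neg] at this

open Topology in
theorem evs_SX (h : IsEVS 0 ⊤ lam mu phi (fun _ _ _ _ => 0)) {Y : ℝ → ℝ}
    (hY : ∀ x, HasDerivAt Y (exp (-cfun lam mu (Y x))) x) :
    SX (fun s x => Nfun mu √(2*s) (Y x)) (fun s x => phi √(2*s) (Y x))
      (fun s x => ptd phi √(2*s) (Y x))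
      (fun s x => √(2*s) * exp (-cfun lam mu (Y x)) * prd phi √(2*s) (Y x)) := by
  have hYc : Continuous Y := continuous_iff_continuousAt.2 fun x => (hY x).continuousAt
  have one : ∀ {s : ℝ}, 1/2 < s → 1 ≤ √(2*s) := fun hs => sqrt2_one_le hs.le
  have cmap : Continuous fun v : ℝ × ℝ => (√(2*v.1), Y v.2) := by fun_prop
  have hcY : ∀ s x, 1/2 < s → HasDerivAt (fun x => exp (-cfun lam mu (Y x)))
      (-(exp (-cfun lam mu (Y x)))^2 * (prd lam √(2*s) (Y x) - prd mu √(2*s) (Y x))) x := by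
    intro s x hs
    have := (((evs_cd h (Y x) (one hs)).comp x (hY x)).neg).exp
    refine this.congr_deriv ?_
    simp only [Pi.neg_apply, Function.comp_apply]; ring
  refine ⟨?_, ?_, ?_, ?_, ?_, ?_, ?_, ?_, ?_⟩
  · refine ((evs_Ncont h).comp cmap).continuousOn.congr fun v hv => ?_
    simp only [Function.comp_apply, max_eq_left (one hv)]
  · refine ((evs_phicont h).comp cmap).continuousOn.congr fun v hv => ?_
    simp only [Function.comp_apply, max_eq_left (one hv)]
  · intro s x hs
    have hp := one hs
    refine ((evs_Nt h (Y x) hp).comp s (hasDerivAt_sqrt2 hs)).congr_deriv ?_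
    field_simp
  · intro s x hs
    have hp := one hs
    have d : HasDerivAt (fun r => Nfun mu √(2*s) r) (prd mu √(2*s) (Y x) / (2*π)) (Y x) :=
      ((h.reg_mu_r _ (Y x) (inDom_top hp)).hasDerivAt.sub_const _).div_const _
    refine (d.comp x (hY x)).congr_deriv ?_
    rw [evs_mur h _ hp]
    have := pi_pos
    field_simp
    ring
  · intro s x hs
    have hp := one hs
    refine ((h.reg_phi_t _ (Y x) (inDom_top hp)).hasDerivAt.comp s (hasDerivAt_sqrt2 hs)).congr_deriv ?_
    unfold ptd; ring
  · intro s x hs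
    have hp := one hs
    refine ((h.reg_phi_r _ (Y x) (inDom_top hp)).hasDerivAt.comp x (hY x)).congr_deriv ?_
    unfold prd; field_simp
  · intro s x hs
    have hp := one hs
    have d1 : DifferentiableAt ℝ (fun s => ptd lam √(2*s) (Y x)) s :=
      ((h.reg_lam_tt _ (Y x) (inDom_top hp)).hasDerivAt.comp s (hasDerivAt_sqrt2 hs)).differentiableAt
    have d2 := (hasDerivAt_sqrt2 hs).differentiableAt
    have hp0 : √(2*s) ≠ 0 := by linarith
    have d3 : DifferentiableAt ℝ (fun s => (ptd lam √(2*s) (Y x) + 1/(2*√(2*s)))/(2*π*√(2*s))) s :=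
      (d1.add ((differentiableAt_const _).div (d2.const_mul 2) (by positivity))).div (d2.const_mul _)
        (by have := pi_pos; positivity)
    refine d3.congr_of_eventuallyEq ?_
    filter_upwards [lt_mem_nhds hs] with a ha
    have hpa := one ha
    rw [evs_lamt h _ hpa, evs_mut h _ hpa, evs_exp2 h _ hpa]
    have := pi_pos
    field_simp
    ring
  · intro s x hs
    have hp := one hs
    have d1 : DifferentiableAt ℝ (fun x => prd mu √(2*s) (Y x)) x :=
      ((h.reg_mu_rr _ (Y x) (inDom_top hp)).hasDerivAt.comp x (hY x)).differentiableAt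
    have d3 : DifferentiableAt ℝ (fun x => prd mu √(2*s) (Y x) * exp (-cfun lam mu (Y x)) / (2*π)) x :=
      (d1.mul (hcY s x hs).differentiableAt).div_const _
    refine d3.congr_of_eventuallyEq (Eventually.of_forall fun y => ?_)
    simp only
    rw [evs_mur h _ hp]
    have := pi_pos
    field_simp
    ring
  · intro s x hs
    have hp := one hs
    have hq : √(2*s)^2 = 2*s := Real.sq_sqrt (by linarith)
    refine ⟨_, (h.reg_phi_tt _ (Y x) (inDom_top hp)).hasDerivAt.comp s (hasDerivAt_sqrt2 hs), ?_⟩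
    have d1 : HasDerivAt (fun x => prd phi √(2*s) (Y x)) _ x :=
      (h.reg_phi_rr _ (Y x) (inDom_top hp)).hasDerivAt.comp x (hY x)
    refine (((hcY s x hs).const_mul √(2*s)).mul d1).congr_deriv ?_
    have w := evs_wave h (Y x) hp
    have hq' : ptd phi √(2*s) (Y x) / (2*s) = ptd phi √(2*s) (Y x) / √(2*s)^2 := by rw [hq]
    rw [hq']
    generalize √(2*s) = t at *
    have t0 : 0 < t := by linarith
    generalize deriv (fun s => ptd phi s (Y x)) t = p1 at *
    generalize deriv (fun y => prd phi t y) (Y x) = p2 at *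
    have e : p1 * (1/t) + ptd phi t (Y x) / t^2 = (p1 + ptd phi t (Y x)/t)/t := by
      field_simp
    rw [e, ← w]
    field_simp
    ring

open Topology in
theorem evs_phi_C1 (h : IsEVS 0 ⊤ lam mu phi (fun _ _ _ _ => 0)) {t r : ℝ} (ht : 1 < t) :
    ContinuousAt (fun v : ℝ × ℝ => ptd phi v.1 v.2) (t, r) ∧
    ContinuousAt (fun v : ℝ × ℝ => prd phi v.1 v.2) (t, r) := by
  obtain ⟨X, Y, hX, hYX, hXY, hY⟩ := chart_exists (evs_ccont h) (evs_cper h)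
  have hs : 1/2 < t^2/2 := by nlinarith
  obtain ⟨cA, cB⟩ := (evs_SX h hY).main (s1 := t^2/2) (x1 := X r) hs
  have hXc : Continuous X := continuous_iff_continuousAt.2 fun x => (hX x).continuousAt
  have cmap : ContinuousAt (fun v : ℝ × ℝ => (v.1^2/2, X v.2)) (t, r) := by fun_prop
  have cA' := ContinuousAt.comp (f := fun v : ℝ × ℝ => (v.1^2/2, X v.2)) (x := (t,r)) cA cmap
  have cB' := ContinuousAt.comp (f := fun v : ℝ × ℝ => (v.1^2/2, X v.2)) (x := (t,r)) cB cmap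
  have ev : ∀ᶠ v : ℝ × ℝ in 𝓝 (t, r), 1 < v.1 :=
    continuous_fst.continuousAt.eventually (lt_mem_nhds ht)
  have sq : ∀ u : ℝ, 1 < u → √(2*(u^2/2)) = u := by
    intro u hu
    rw [show 2*(u^2/2) = u^2 by ring]; exact Real.sqrt_sq (by linarith)
  have hcc := evs_ccont h
  constructor
  · refine cA'.congr ?_
    filter_upwards [ev] with v hv
    simp only [Function.comp_apply, hYX, sq _ hv]
  · have c2 : ContinuousAt (fun v : ℝ × ℝ => v.1 * exp (-cfun lam mu v.2)) (t, r) := by fun_prop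
    refine (cB'.div c2 (by positivity)).congr ?_
    filter_upwards [ev] with v hv
    have : v.1 ≠ 0 := by linarith
    simp only [Function.comp_apply, hYX, sq _ hv, Pi.div_apply]
    field_simp

end EVS


section Peano
variable {E : Type*} [NormedAddCommGroup E] [NormedSpace ℝ E]

/-- Euler polygon nodes. -/
def euler (f : E → E) (x0 : E) (h : ℝ) : ℕ → E
  | 0 => x0
  | (k+1) => euler f x0 h k + h • f (euler f x0 h k)

theorem euler_bd {f : E → E} {x0 : E} {h C : ℝ} (hh : 0 ≤ h) (hb : ∀ x, ‖f x‖ ≤ C) (i d : ℕ) :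
    ‖euler f x0 h (i+d) - euler f x0 h i‖ ≤ C * (d * h) := by
  induction d with
  | zero => simp
  | succ d ih =>
    have e : euler f x0 h (i+(d+1)) - euler f x0 h i =
      (euler f x0 h (i+d) - euler f x0 h i) + h • f (euler f x0 h (i+d)) := by
      rw [← add_assoc, euler]; abel
    rw [e]
    refine (norm_add_le _ _).trans ?_
    rw [norm_smul, Real.norm_of_nonneg hh]
    have := mul_le_mul_of_nonneg_left (hb (euler f x0 h (i+d))) hh
    push_cast
    nlinarith

theorem euler_est {f : E → E} {x0 : E} {h C ε δ : ℝ} (hh : 0 ≤ h) (hC : 0 ≤ C) (hb : ∀ x, ‖f x‖ ≤ C)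
    (hu : ∀ x y, ‖x - y‖ < δ → ‖f x - f y‖ ≤ ε) (i d : ℕ) (hd : C * (d * h) < δ) :
    ‖euler f x0 h (i+d) - euler f x0 h i - (d*h) • f (euler f x0 h i)‖ ≤ ε * (d * h) := by
  induction d with
  | zero => simp
  | succ d ih =>
    have hd2 : C * (d*h) < δ := by
      refine lt_of_le_of_lt ?_ hd
      push_cast
      gcongr
      linarith
    have i1 := ih hd2
    have e : euler f x0 h (i+(d+1)) - euler f x0 h i - ((d+1 : ℕ)*h) • f (euler f x0 h i) =
      (euler f x0 h (i+d) - euler f x0 h i - (d*h) • f (euler f x0 h i))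
       + h • (f (euler f x0 h (i+d)) - f (euler f x0 h i)) := by
      rw [← add_assoc, euler]; push_cast; module
    rw [e]
    refine (norm_add_le _ _).trans ?_
    rw [norm_smul, Real.norm_of_nonneg hh]
    have := mul_le_mul_of_nonneg_left (hu _ _ (lt_of_le_of_lt (euler_bd hh hb i d) hd2) :
      ‖f (euler f x0 h (i+d)) - f (euler f x0 h i)‖ ≤ ε) hh
    push_cast
    nlinarith

open Topology in
theorem floor_tend (t : ℝ) (ht : 0 ≤ t) :
    Tendsto (fun n : ℕ => (⌊t*((n:ℝ)+1)⌋₊ : ℝ) * (1/((n:ℝ)+1))) atTop (𝓝 t) := by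
  have h1 : Tendsto (fun n : ℕ => t - 1/((n:ℝ)+1)) atTop (𝓝 t) := by
    simpa using tendsto_const_nhds.sub (tendsto_one_div_add_atTop_nhds_zero_nat (𝕜 := ℝ)) (a := t)
  refine tendsto_of_tendsto_of_tendsto_of_le_of_le h1 tendsto_const_nhds (fun n => ?_) (fun n => ?_)
  · have hn : (0:ℝ) < n + 1 := by positivity
    have := Nat.lt_floor_add_one (t*((n:ℝ)+1))
    simp only
    rw [mul_one_div, sub_le_iff_le_add, ← add_div, le_div_iff₀ hn]
    exact this.le
  · have hn : (0:ℝ) < n + 1 := by positivity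
    have := Nat.floor_le (by positivity : 0 ≤ t*((n:ℝ)+1))
    simp only
    rw [mul_one_div, div_le_iff₀ hn]
    exact this

open Topology in
theorem peano_exists [ProperSpace E] {f : E → E} (hf : UniformContinuous f) {C : ℝ}
    (hb : ∀ x, ‖f x‖ ≤ C) (x0 : E) :
    ∃ y : ℝ → E, y 0 = x0 ∧ ∀ s, 0 ≤ s → HasDerivWithinAt y (f (y s)) (Set.Ici 0) s := by
  have hC : 0 ≤ C := (norm_nonneg _).trans (hb x0)
  set u : ℕ → ℝ → E := fun n t => euler f x0 (1/((n:ℝ)+1)) ⌊t*((n:ℝ)+1)⌋₊ with hu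
  have hh : ∀ n : ℕ, 0 ≤ 1/((n:ℝ)+1) := fun n => by positivity
  have lim : ∀ t, ∃ z, 0 ≤ t → Tendsto (fun n => u n t) (hyperfilter ℕ : Filter ℕ) (𝓝 z) := by
    intro t
    by_cases ht : 0 ≤ t
    swap
    · exact ⟨x0, fun h => absurd h ht⟩
    have hm : ∀ n, u n t ∈ Metric.closedBall x0 (C*t) := by
      intro n
      rw [Metric.mem_closedBall, dist_eq_norm]
      have := euler_bd (x0 := x0) (hh n) hb 0 ⌊t*((n:ℝ)+1)⌋₊
      rw [zero_add] at this
      refine this.trans ?_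
      gcongr
      have hn : (0:ℝ) < n + 1 := by positivity
      have := Nat.floor_le (by positivity : 0 ≤ t*((n:ℝ)+1))
      rw [mul_one_div, div_le_iff₀ hn]
      exact this
    obtain ⟨z, -, hz⟩ := (isCompact_closedBall x0 (C*t)).ultrafilter_le_nhds
      ((hyperfilter ℕ).map (fun n => u n t)) (by
        rw [le_principal_iff]
        exact Filter.mem_map.2 (Filter.univ_mem' hm))
    exact ⟨z, fun _ => hz⟩
  choose y hy using lim
  have hle : (hyperfilter ℕ : Filter ℕ) ≤ atTop := Nat.hyperfilter_le_atTop
  have hy0 : y 0 = x0 := by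
    have h1 := hy 0 le_rfl
    have h2 : (fun n => u n 0) = fun _ => x0 := by
      funext n; simp [hu, euler]
    rw [h2] at h1
    exact tendsto_nhds_unique h1 tendsto_const_nhds
  have hfc : Continuous f := hf.continuous
  have dlim : ∀ s t, 0 ≤ s → s ≤ t → Tendsto (fun n : ℕ =>
      ((⌊t*((n:ℝ)+1)⌋₊ - ⌊s*((n:ℝ)+1)⌋₊ : ℕ) : ℝ) * (1/((n:ℝ)+1))) (hyperfilter ℕ : Filter ℕ) (𝓝 (t-s)) := by
    intro s t hs hst
    have := ((floor_tend t (hs.trans hst)).sub (floor_tend s hs)).mono_left hle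
    refine this.congr fun n => ?_
    have : ⌊s*((n:ℝ)+1)⌋₊ ≤ ⌊t*((n:ℝ)+1)⌋₊ := Nat.floor_mono (by gcongr)
    rw [Nat.cast_sub this]; ring
  have hadd : ∀ s t, 0 ≤ s → s ≤ t → ∀ n : ℕ, ⌊s*((n:ℝ)+1)⌋₊ + (⌊t*((n:ℝ)+1)⌋₊ - ⌊s*((n:ℝ)+1)⌋₊) = ⌊t*((n:ℝ)+1)⌋₊ := by
    intro s t hs hst n
    have : ⌊s*((n:ℝ)+1)⌋₊ ≤ ⌊t*((n:ℝ)+1)⌋₊ := Nat.floor_mono (by gcongr)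
    omega
  have lip : ∀ s t, 0 ≤ s → s ≤ t → ‖y t - y s‖ ≤ C*(t-s) := by
    intro s t hs hst
    have l1 := ((hy t (hs.trans hst)).sub (hy s hs)).norm
    have l2 := (dlim s t hs hst).const_mul C
    refine le_of_tendsto_of_tendsto' l1 l2 fun n => ?_
    have := euler_bd (x0 := x0) (hh n) hb ⌊s*((n:ℝ)+1)⌋₊ (⌊t*((n:ℝ)+1)⌋₊ - ⌊s*((n:ℝ)+1)⌋₊)
    rw [hadd s t hs hst n] at this
    exact this
  refine ⟨y, hy0, fun s hs => ?_⟩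
  rw [hasDerivWithinAt_iff_isLittleO, Asymptotics.isLittleO_iff]
  intro ε hε
  obtain ⟨δ, hδ, hfδ⟩ := Metric.uniformContinuous_iff.1 hf (ε/2) (by linarith)
  have hu' : ∀ x y, ‖x - y‖ < δ → ‖f x - f y‖ ≤ ε/2 := by
    intro x y hxy
    rw [← dist_eq_norm] at hxy ⊢
    exact (hfδ hxy).le
  have est : ∀ s t, 0 ≤ s → s ≤ t → C*(t-s) < δ → ‖y t - y s - (t-s) • f (y s)‖ ≤ ε/2*(t-s) := by
    intro s t hs hst hd
    have l0 := dlim s t hs hst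
    have l1 := (((hy t (hs.trans hst)).sub (hy s hs)).sub (l0.smul ((hfc.tendsto (y s)).comp (hy s hs)))).norm
    have l2 := l0.const_mul (ε/2)
    refine le_of_tendsto_of_tendsto l1 l2 ?_
    filter_upwards [(l0.const_mul C).eventually (gt_mem_nhds hd)] with n hn
    have := euler_est (x0 := x0) (hh n) hC hb hu' ⌊s*((n:ℝ)+1)⌋₊ (⌊t*((n:ℝ)+1)⌋₊ - ⌊s*((n:ℝ)+1)⌋₊) hn
    rw [hadd s t hs hst n] at this
    exact this
  have ev : ∀ᶠ t in 𝓝[Set.Ici 0] s, C*|t - s| < δ ∧ 0 ≤ t := by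
    refine Filter.Eventually.and ?_ self_mem_nhdsWithin
    apply mem_nhdsWithin_of_mem_nhds
    have : Tendsto (fun t => C*|t-s|) (𝓝 s) (𝓝 0) := by
      have : Continuous fun t => C*|t-s| := by fun_prop
      simpa using this.tendsto s
    exact this.eventually (gt_mem_nhds hδ)
  filter_upwards [ev] with t ht
  rw [Real.norm_eq_abs]
  rcases le_total s t with hst | hst
  · rw [abs_of_nonneg (by linarith)] at ht ⊢
    refine (est s t hs hst ht.1).trans ?_
    nlinarith
  · rw [abs_of_nonpos (by linarith), neg_sub] at ht ⊢
    have a1 := est t s ht.2 hst ht.1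
    have a2 := hu' (y s) (y t) (lt_of_le_of_lt (lip t s ht.2 hst) ht.1)
    have e : y t - y s - (t-s) • f (y s) = -(y s - y t - (s-t) • f (y t)) + (s-t) • (f (y s) - f (y t)) := by
      module
    rw [e]
    refine (norm_add_le _ _).trans ?_
    rw [norm_neg, norm_smul, Real.norm_of_nonneg (by linarith)]
    have := mul_le_mul_of_nonneg_left a2 (by linarith : 0 ≤ s - t)
    linarith
end Peano


open Topology in
theorem ode_extend {E : Type*} [NormedAddCommGroup E] [NormedSpace ℝ E] [ProperSpace E] {f : E → E}
    (hf : UniformContinuous f) {C : ℝ} (hb : ∀ x, ‖f x‖ ≤ C) {x : ℝ → E} {α β : ℝ} (hαβ : α < β)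
    (hx : ∀ s, α ≤ s → s < β → HasDerivAt x (f (x s)) s) :
    ∃ z : ℝ → E, (∀ s, s < β → z s = x s) ∧ ∀ s, α < s → HasDerivAt z (f (z s)) s := by
  have hC : 0 ≤ C := (norm_nonneg _).trans (hb (x α))
  have hlip : LipschitzOnWith (Real.toNNReal C) x (Set.Ico α β) := by
    apply (convex_Ico α β).lipschitzOnWith_of_nnnorm_hasDerivWithin_le (f' := fun s => f (x s))
    · intro s hs; exact (hx s hs.1 hs.2).hasDerivWithinAt
    · intro s hs
      have := hb (x s)
      rw [← NNReal.coe_le_coe, coe_nnnorm, Real.coe_toNNReal _ hC]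
      exact this
  obtain ⟨L, hL⟩ : ∃ L, Tendsto x (𝓝[<] β) (𝓝 L) := by
    have hc : Cauchy (Filter.map x (𝓝[Set.Ico α β] β)) := by
      have : (𝓝[Set.Ico α β] β).NeBot := by
        rw [← mem_closure_iff_nhdsWithin_neBot, closure_Ico hαβ.ne]
        exact ⟨hαβ.le, le_rfl⟩
      have hc0 : Cauchy (𝓝[Set.Ico α β] β) := cauchy_nhds.mono nhdsWithin_le_nhds
      exact hc0.map_of_le hlip.uniformContinuousOn inf_le_right
    obtain ⟨L, hL⟩ := CompleteSpace.complete hc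
    refine ⟨L, ?_⟩
    rw [nhdsWithin_Ico_eq_nhdsLT hαβ] at hL
    exact hL
  obtain ⟨y, hy0, hy⟩ := peano_exists hf hb L
  set z : ℝ → E := fun s => if s < β then x s else y (s - β) with hz
  have z1 : ∀ s, s < β → z s = x s := fun s hs => by simp [hz, hs]
  have z2 : ∀ s, β ≤ s → z s = y (s - β) := fun s hs => by simp [hz, not_lt.2 hs]
  have zβ : z β = L := by rw [z2 β le_rfl, sub_self, hy0]
  have e1 : ∀ s, s < β → z =ᶠ[𝓝 s] x := fun s hs => by
    filter_upwards [Iio_mem_nhds hs] with u hu using z1 u hu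
  have e2 : ∀ s, β ≤ s → HasDerivWithinAt z (f (z s)) (Set.Ici β) s := fun s hs => by
    have hd := hy (s - β) (by linarith)
    have h2 : HasDerivWithinAt (fun s : ℝ => s - β) 1 (Set.Ici β) s := ((hasDerivAt_id s).sub_const β).hasDerivWithinAt
    have := hd.scomp s h2 (fun u hu => by simpa using hu)
    rw [one_smul] at this
    rw [z2 s hs]
    exact this.congr (fun u hu => z2 u hu) (z2 s hs)
  refine ⟨z, z1, fun s hs => ?_⟩
  rcases lt_trichotomy s β with h | h | h
  · rw [z1 s h]
    exact (hx s hs.le h).congr_of_eventuallyEq (e1 s h)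
  · subst h
    have hzt : Tendsto z (𝓝[<] s) (𝓝 (z s)) := by
      rw [zβ]; refine hL.congr' ?_
      filter_upwards [self_mem_nhdsWithin] with u hu using (z1 u hu).symm
    have hl : HasDerivWithinAt z (f (z s)) (Set.Iic s) s := by
      apply hasDerivWithinAt_Iic_of_tendsto_deriv (s := Set.Ioo α s)
      · intro u hu
        exact ((hx u hu.1.le hu.2).congr_of_eventuallyEq (e1 u hu.2)).differentiableAt.differentiableWithinAt
      · exact hzt.mono_left (nhdsWithin_mono _ (fun u hu => hu.2))
      · exact Ioo_mem_nhdsLT hs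
      · refine ((hf.continuous.tendsto (z s)).comp hzt).congr' ?_
        filter_upwards [Ioo_mem_nhdsLT hs] with u hu
        simp only [Function.comp]
        rw [((hx u hu.1.le hu.2).congr_of_eventuallyEq (e1 u hu.2)).deriv, z1 u hu.2]
    have := hl.union (e2 s le_rfl)
    rwa [Set.Iic_union_Ici, hasDerivWithinAt_univ] at this
  · exact (e2 s h.le).hasDerivAt (Ici_mem_nhds h)

section EVS
variable {lam mu phi : ℝ → ℝ → ℝ}

open Topology in
theorem evs_muC1 (h : IsEVS 0 ⊤ lam mu phi (fun _ _ _ _ => 0)) {t r : ℝ} (ht : 1 < t) :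
    ContinuousAt (fun v : ℝ × ℝ => mu v.1 v.2) (t, r) ∧
    ContinuousAt (fun v : ℝ × ℝ => lam v.1 v.2) (t, r) ∧
    ContinuousAt (fun v : ℝ × ℝ => ptd mu v.1 v.2) (t, r) ∧
    ContinuousAt (fun v : ℝ × ℝ => ptd lam v.1 v.2) (t, r) ∧
    ContinuousAt (fun v : ℝ × ℝ => prd mu v.1 v.2) (t, r) := by
  obtain ⟨c1, c2⟩ := evs_phi_C1 h (r := r) ht
  have hev : ∀ᶠ v : ℝ × ℝ in 𝓝 (t, r), 1 < v.1 :=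
    (continuous_fst.tendsto (t, r)).eventually (lt_mem_nhds ht)
  have cf : ContinuousAt (fun v : ℝ × ℝ => v.1) (t, r) := continuousAt_fst
  have t0 : t ≠ 0 := by linarith
  have cc : ContinuousAt (fun v : ℝ × ℝ => cfun lam mu v.2) (t, r) :=
    ((evs_ccont h).comp continuous_snd).continuousAt
  have m0 : ContinuousAt (fun v : ℝ × ℝ => mu v.1 v.2) (t, r) := by
    refine (evs_mucont h).continuousAt.congr ?_
    filter_upwards [hev] with v hv
    rw [max_eq_left hv.le]
  have mt : ContinuousAt (fun v : ℝ × ℝ => ptd mu v.1 v.2) (t, r) := by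
    have : ContinuousAt (fun v : ℝ × ℝ => 1/(2*v.1) + 2*π*v.1*(ptd phi v.1 v.2^2 + (v.1 * exp (-cfun lam mu v.2))^2 * prd phi v.1 v.2^2)) (t, r) := by
      have : ContinuousAt (fun v : ℝ × ℝ => 1/(2*v.1)) (t, r) :=
        continuousAt_const.div (continuousAt_const.mul cf) (by simpa using t0)
      fun_prop
    refine this.congr ?_
    filter_upwards [hev] with v hv
    rw [evs_mut h v.2 hv.le, evs_exp2 h v.2 hv.le]
  refine ⟨m0, ?_, mt, ?_, ?_⟩
  · have : ContinuousAt (fun v : ℝ × ℝ => mu v.1 v.2 - log v.1 + cfun lam mu v.2) (t, r) :=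
      (m0.sub (cf.log t0)).add cc
    refine this.congr ?_
    filter_upwards [hev] with v hv
    rw [evs_c h v.2 hv.le]
  · have : ContinuousAt (fun v : ℝ × ℝ => ptd mu v.1 v.2 - 1/v.1) (t, r) :=
      mt.sub (continuousAt_const.div cf t0)
    refine this.congr ?_
    filter_upwards [hev] with v hv
    rw [evs_lamt h v.2 hv.le]
  · have : ContinuousAt (fun v : ℝ × ℝ => 4*π*v.1*ptd phi v.1 v.2*prd phi v.1 v.2) (t, r) := by
      fun_prop
    refine this.congr ?_
    filter_upwards [hev] with v hv
    rw [evs_mur h v.2 hv.le]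

open Topology in
theorem evs_mu_curve (h : IsEVS 0 ⊤ lam mu phi (fun _ _ _ _ => 0)) {g1 g2 : ℝ → ℝ} {g1' g2' τ : ℝ}
    (ht : 1 < g1 τ) (h1 : HasDerivAt g1 g1' τ) (h2 : HasDerivAt g2 g2' τ) :
    HasDerivAt (fun s => mu (g1 s) (g2 s)) (ptd mu (g1 τ) (g2 τ) * g1' + prd mu (g1 τ) (g2 τ) * g2') τ := by
  obtain ⟨_, _, c1, _, c2⟩ := evs_muC1 h (r := g2 τ) ht
  have hev : ∀ᶠ v : ℝ × ℝ in 𝓝 (g1 τ, g2 τ), 1 < v.1 :=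
    (continuous_fst.tendsto (g1 τ, g2 τ)).eventually (lt_mem_nhds ht)
  refine partial_curve ?_ ?_ c1 c2 h1 h2
  · filter_upwards [hev] with v hv using (h.reg_mu_t v.1 v.2 (inDom_top hv.le)).hasDerivAt
  · filter_upwards [hev] with v hv using (h.reg_mu_r v.1 v.2 (inDom_top hv.le)).hasDerivAt

/-- Bound on mu over compact time ranges. -/
theorem evs_mubdd (h : IsEVS 0 ⊤ lam mu phi (fun _ _ _ _ => 0)) (T : ℝ) :
    ∃ C, ∀ t r, 1 ≤ t → t ≤ T → |mu t r| ≤ C ∧ |lam t r| ≤ C := by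
  obtain ⟨C, hC⟩ := (isCompact_Icc.prod isCompact_Icc).exists_bound_of_continuousOn
    (s := Set.Icc (1:ℝ) T ×ˢ Set.Icc (0:ℝ) 1) (evs_mucont h).continuousOn
  obtain ⟨D, hD⟩ := per_bdd (evs_ccont h) (evs_cper h)
  have D0 : 0 ≤ D := (abs_nonneg _).trans (hD 0)
  have key : ∀ t r, 1 ≤ t → t ≤ T → |mu t r| ≤ C := fun t r h1 h2 => by
    have := hC (t, Int.fract r) ⟨⟨h1, h2⟩, Int.fract_nonneg r, (Int.fract_lt_one r).le⟩
    simp only [max_eq_left h1] at this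
    have hp : Function.Periodic (mu t) 1 := h.per_mu t
    have e : mu t (Int.fract r) = mu t r := by
      have := hp.sub_zsmul_eq (x := r) ⌊r⌋
      rw [zsmul_eq_mul, mul_one] at this
      exact this
    rwa [e] at this
  refine ⟨C + |log T| + D, fun t r h1 h2 => ?_⟩
  have k := key t r h1 h2
  have l1 : 0 ≤ log t := log_nonneg h1
  have l2 : log t ≤ log T := log_le_log (by linarith) h2
  have l3 := le_abs_self (log T)
  have := hD r
  refine ⟨by have := abs_nonneg (log T); linarith, ?_⟩
  rw [evs_c h r h1]
  rw [abs_le] at *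
  constructor <;> linarith [this.1, this.2, k.1, k.2]
end EVS


section GEO
variable {lam mu phi : ℝ → ℝ → ℝ} {m F : ℝ} {a b : EReal} {tt rr ww : ℝ → ℝ} {τ₀ : ℝ}

theorem lift_mem {a b : EReal} {τ₀ c τ : ℝ} (ha : a < (τ₀ : EReal)) (hc : (c : EReal) < b) (h1 : τ₀ ≤ τ) (h2 : τ ≤ c) :
    a < (τ : EReal) ∧ (τ : EReal) < b :=
  ⟨ha.trans_le (EReal.coe_le_coe_iff.2 h1), (EReal.coe_le_coe_iff.2 h2).trans_lt hc⟩

theorem geo_tt_mono (hg : GeoSys lam mu m F a b tt rr ww) (ha : a < (τ₀ : EReal)) {c : ℝ} (hc : (c : EReal) < b) :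
    MonotoneOn tt (Set.Icc τ₀ c) := by
  have key : ∀ τ ∈ Set.Icc τ₀ c, HasDerivAt tt _ τ := fun τ hτ =>
    (hg τ (lift_mem ha hc hτ.1 hτ.2).1 (lift_mem ha hc hτ.1 hτ.2).2).1
  apply monotoneOn_of_deriv_nonneg (convex_Icc _ _)
  · exact fun τ hτ => (key τ hτ).continuousAt.continuousWithinAt
  · exact fun τ hτ => (key τ (interior_subset hτ)).differentiableAt.differentiableWithinAt
  · intro τ hτ
    rw [(key τ (interior_subset hτ)).deriv]; positivity

theorem geo_tt_ge (hg : GeoSys lam mu m F a b tt rr ww) (ha : a < (τ₀ : EReal)) (ht0 : tt τ₀ = 1)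
    {c : ℝ} (h1 : τ₀ ≤ c) (hc : (c : EReal) < b) : 1 ≤ tt c := by
  have := geo_tt_mono hg ha hc ⟨le_rfl, h1⟩ ⟨h1, le_rfl⟩ h1
  rwa [ht0] at this

open Topology in
theorem geo_tt_gt (hg : GeoSys lam mu m F a b tt rr ww) (ha : a < (τ₀ : EReal)) (ht0 : tt τ₀ = 1)
    (hV : 0 < m^2 + ww τ₀^2 + F / tt τ₀^2)
    {c : ℝ} (h1 : τ₀ < c) (hc : (c : EReal) < b) : 1 < tt c := by
  by_contra hn
  push Not at hn
  have mono := geo_tt_mono hg ha hc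
  have e : ∀ τ ∈ Set.Icc τ₀ c, tt τ = 1 := fun τ hτ =>
    le_antisymm ((mono hτ ⟨h1.le, le_rfl⟩ hτ.2).trans hn)
      (geo_tt_ge hg ha ht0 hτ.1 (lift_mem ha hc hτ.1 hτ.2).2)
  have d1 := (hg τ₀ ha (lift_mem ha hc le_rfl h1.le).2).1.hasDerivWithinAt (s := Set.Ici τ₀)
  have d2 : HasDerivWithinAt tt 0 (Set.Ici τ₀) τ₀ := by
    refine (hasDerivWithinAt_const τ₀ (Set.Ici τ₀) (1:ℝ)).congr_of_eventuallyEq ?_ ht0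
    filter_upwards [Icc_mem_nhdsGE h1] with u hu using e u hu
  have := (uniqueDiffWithinAt_Ici τ₀).eq_deriv _ d1 d2
  have p1 := exp_pos (-(mu (tt τ₀) (rr τ₀)))
  have p2 := Real.sqrt_pos.2 hV
  have := mul_pos p1 p2
  linarith

theorem evs_My (h : IsEVS 0 ⊤ lam mu phi (fun _ _ _ _ => 0)) {t : ℝ} (r : ℝ) (ht : 1 ≤ t) :
    |exp (mu t r - lam t r) * prd mu t r| ≤ ptd mu t r - 1/(2*t) := by
  rw [evs_mut h r ht, evs_mur h r ht, evs_exp2 h r ht, evs_exp h r ht]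
  have hp := pi_pos
  generalize t * exp (-cfun lam mu r) = q
  have k : 0 < 2*π*t := by positivity
  rw [abs_le]
  constructor
  · nlinarith [mul_nonneg k.le (sq_nonneg (ptd phi t r + q * prd phi t r))]
  · nlinarith [mul_nonneg k.le (sq_nonneg (ptd phi t r - q * prd phi t r))]

/-- normalized derivatives along a geodesic -/
theorem geo_derivs (h : IsEVS 0 ⊤ lam mu phi (fun _ _ _ _ => 0)) (hm : 0 ≤ m) (hF : 0 ≤ F)
    (hg : GeoSys lam mu m F a b tt rr ww) {τ : ℝ}
    (h1 : a < (τ : EReal)) (h2 : (τ : EReal) < b) (ht : 1 < tt τ) :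
    ∃ E S M y : ℝ, 0 < E ∧ 0 ≤ S ∧ S^2 = m^2 + ww τ^2 + F / tt τ^2 ∧ |y| ≤ M ∧
      HasDerivAt tt (E * S) τ ∧
      HasDerivAt ww (-(E * ((M - 1/(2 * tt τ)) * S * ww τ + y * S^2))) τ ∧
      HasDerivAt (fun s => mu (tt s) (rr s)) (E * (S * (M + 1/(2 * tt τ)) + y * ww τ)) τ := by
  obtain ⟨d1, d2, d3⟩ := hg τ h1 h2
  have d4 := evs_mu_curve h ht d1 d2
  have hl := evs_lamt h (rr τ) ht.le
  have hM := evs_My h (rr τ) ht.le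
  have t0 : 0 < tt τ := by linarith
  have hS : √(m^2 + ww τ^2 + F / tt τ^2)^2 = m^2 + ww τ^2 + F / tt τ^2 := Real.sq_sqrt (by positivity)
  have x1 : exp (2 * mu (tt τ) (rr τ) - lam (tt τ) (rr τ)) * exp (-(mu (tt τ) (rr τ)))
      = exp (mu (tt τ) (rr τ) - lam (tt τ) (rr τ)) := by rw [← exp_add]; ring_nf
  have x2 : exp (mu (tt τ) (rr τ) - lam (tt τ) (rr τ)) * exp (-(mu (tt τ) (rr τ)))
      = exp (-(lam (tt τ) (rr τ))) := by rw [← exp_add]; ring_nf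
  refine ⟨exp (-(mu (tt τ) (rr τ))), √(m^2 + ww τ^2 + F / tt τ^2), ptd mu (tt τ) (rr τ) - 1/(2*tt τ),
    exp (mu (tt τ) (rr τ) - lam (tt τ) (rr τ)) * prd mu (tt τ) (rr τ), exp_pos _, Real.sqrt_nonneg _, hS, hM, d1, ?_, ?_⟩
  · refine d3.congr_deriv ?_
    rw [hl]
    generalize √(m^2 + ww τ^2 + F / tt τ^2) = S at *
    have e : 1 / tt τ = 1/(2*tt τ) + 1/(2*tt τ) := by field_simp; norm_num
    rw [e, ← x1]; ring
  · refine d4.congr_deriv ?_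
    rw [← x2]; ring

theorem geo_H (h : IsEVS 0 ⊤ lam mu phi (fun _ _ _ _ => 0)) (hm : 0 ≤ m) (hF : 0 ≤ F)
    (hg : GeoSys lam mu m F a b tt rr ww) {τ : ℝ}
    (h1 : a < (τ : EReal)) (h2 : (τ : EReal) < b) (ht : 1 < tt τ) :
    (∃ d, d ≤ 0 ∧ HasDerivAt (fun s => exp (-2 * mu (tt s) (rr s)) * (m^2 + ww s^2 + F / tt s^2)) d τ) ∧
    (∃ d, 0 ≤ d ∧ HasDerivAt (fun s => exp (2 * mu (tt s) (rr s)) * (m^2 + ww s^2 + F / tt s^2) * tt s) d τ) := by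
  obtain ⟨E, S, M, y, hE, hS, hS2, hy, d1, d2, d3⟩ := geo_derivs h hm hF hg h1 h2 ht
  have t0 : 0 < tt τ := by linarith
  have dV : HasDerivAt (fun s => m^2 + ww s^2 + F / tt s^2)
      (-2*E*((M - 1/(2 * tt τ)) * S * ww τ^2 + y * ww τ * S^2 + F * S / tt τ^3)) τ := by
    have q1 := (d2.pow 2).const_add (m^2)
    have q2 := (hasDerivAt_const τ F).div (d1.pow 2) (by simp only [Pi.pow_apply]; positivity)
    refine (q1.add q2).congr_deriv ?_
    simp only [Pi.pow_apply]
    push_cast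
    field_simp
    ring
  have eS : ∀ x, x * S^2 = x * (m^2 + ww τ^2 + F / tt τ^2) := fun x => by rw [hS2]
  have hyM := abs_le.1 hy
  have hM : 0 ≤ M := (abs_nonneg _).trans hy
  have wS : 0 ≤ S^2 - ww τ^2 := by rw [hS2]; have : 0 ≤ F / tt τ^2 := by positivity
                                   nlinarith [sq_nonneg m]
  have FS : F / tt τ^2 ≤ S^2 := by rw [hS2]; nlinarith [sq_nonneg m, sq_nonneg (ww τ)]
  have key : 0 ≤ M * (ww τ^2 + S^2) + 2 * y * (ww τ * S) := by
    nlinarith [mul_nonneg (by linarith [hyM.1] : 0 ≤ M + y) (sq_nonneg (ww τ + S)),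
      mul_nonneg (by linarith [hyM.2] : 0 ≤ M - y) (sq_nonneg (ww τ - S))]
  constructor
  · refine ⟨_, ?_, ((d3.const_mul (-2)).exp.mul dV)⟩
    rw [← hS2]
    have : exp (-2 * mu (tt τ) (rr τ)) * (-2 * (E * (S * (M + 1/(2 * tt τ)) + y * ww τ))) * S^2 +
      exp (-2 * mu (tt τ) (rr τ)) * (-2*E*((M - 1/(2 * tt τ)) * S * ww τ^2 + y * ww τ * S^2 + F * S / tt τ^3))
      = -(2 * exp (-2 * mu (tt τ) (rr τ)) * E * S) * ((M * (ww τ^2 + S^2) + 2 * y * (ww τ * S))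
        + (S^2 - ww τ^2)/(2 * tt τ) + F / tt τ^3) := by
      field_simp; ring
    rw [this]
    have : 0 ≤ (2 * exp (-2 * mu (tt τ) (rr τ)) * E * S) * ((M * (ww τ^2 + S^2) + 2 * y * (ww τ * S))
        + (S^2 - ww τ^2)/(2 * tt τ) + F / tt τ^3) := by positivity
    linarith
  · refine ⟨_, ?_, ((d3.const_mul 2).exp.mul dV).mul d1⟩
    simp only [Pi.mul_apply]
    rw [← hS2]
    have : (exp (2 * mu (tt τ) (rr τ)) * (2 * (E * (S * (M + 1/(2 * tt τ)) + y * ww τ))) * S^2 +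
      exp (2 * mu (tt τ) (rr τ)) * (-2*E*((M - 1/(2 * tt τ)) * S * ww τ^2 + y * ww τ * S^2 + F * S / tt τ^3))) * tt τ
      + exp (2 * mu (tt τ) (rr τ)) * S^2 * (E * S)
      = (exp (2 * mu (tt τ) (rr τ)) * E * S) * (2 * tt τ * M * (S^2 - ww τ^2) + ww τ^2 + 2 * (S^2 - F / tt τ^2)) := by
      field_simp; ring
    rw [this]
    have : 0 ≤ S^2 - F / tt τ^2 := by linarith
    positivity

open Topology in
/-- monotone quantities along a geodesic -/
theorem geo_mono (h : IsEVS 0 ⊤ lam mu phi (fun _ _ _ _ => 0)) (hm : 0 ≤ m) (hF : 0 ≤ F)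
    (hg : GeoSys lam mu m F a b tt rr ww) (ha : a < (τ₀ : EReal)) (ht0 : tt τ₀ = 1)
    (hV : 0 < m^2 + ww τ₀^2 + F / tt τ₀^2) {c : ℝ} (h1 : τ₀ ≤ c) (hc : (c : EReal) < b) :
    exp (-2 * mu (tt c) (rr c)) * (m^2 + ww c^2 + F / tt c^2)
      ≤ exp (-2 * mu (tt τ₀) (rr τ₀)) * (m^2 + ww τ₀^2 + F / tt τ₀^2) ∧
    exp (2 * mu (tt τ₀) (rr τ₀)) * (m^2 + ww τ₀^2 + F / tt τ₀^2) * tt τ₀ ≤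
     exp (2 * mu (tt c) (rr c)) * (m^2 + ww c^2 + F / tt c^2) * tt c := by
  have lm : ∀ τ ∈ Set.Icc τ₀ c, a < (τ : EReal) ∧ (τ : EReal) < b := fun τ hτ => lift_mem ha hc hτ.1 hτ.2
  have ge1 : ∀ τ ∈ Set.Icc τ₀ c, 1 ≤ tt τ := fun τ hτ => geo_tt_ge hg ha ht0 hτ.1 (lm τ hτ).2
  have ct : ContinuousOn tt (Set.Icc τ₀ c) := fun τ hτ =>
    (hg τ (lm τ hτ).1 (lm τ hτ).2).1.continuousAt.continuousWithinAt
  have cr : ContinuousOn rr (Set.Icc τ₀ c) := fun τ hτ =>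
    (hg τ (lm τ hτ).1 (lm τ hτ).2).2.1.continuousAt.continuousWithinAt
  have cw : ContinuousOn ww (Set.Icc τ₀ c) := fun τ hτ =>
    (hg τ (lm τ hτ).1 (lm τ hτ).2).2.2.continuousAt.continuousWithinAt
  have cmu : ContinuousOn (fun s => mu (tt s) (rr s)) (Set.Icc τ₀ c) := by
    have := (evs_mucont h).comp_continuousOn (ct.prodMk cr)
    refine this.congr (fun τ hτ => ?_)
    simp only [Function.comp, max_eq_left (ge1 τ hτ)]
  have cV : ContinuousOn (fun s => m^2 + ww s^2 + F / tt s^2) (Set.Icc τ₀ c) := by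
    have : ContinuousOn (fun s => F / tt s^2) (Set.Icc τ₀ c) :=
      continuousOn_const.div (ct.pow 2) (fun τ hτ => by have := ge1 τ hτ; positivity)
    fun_prop
  have hd : ∀ τ ∈ interior (Set.Icc τ₀ c), _ := fun τ hτ => by
    rw [interior_Icc] at hτ
    exact geo_H h hm hF hg (lm τ ⟨hτ.1.le, hτ.2.le⟩).1 (lm τ ⟨hτ.1.le, hτ.2.le⟩).2
      (geo_tt_gt hg ha ht0 hV hτ.1 (lm τ ⟨hτ.1.le, hτ.2.le⟩).2)
  constructor
  · refine antitoneOn_of_deriv_nonpos (f := fun s => exp (-2 * mu (tt s) (rr s)) * (m^2 + ww s^2 + F / tt s^2))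
      (convex_Icc τ₀ c) ?_ ?_ ?_ ⟨le_rfl, h1⟩ ⟨h1, le_rfl⟩ h1
    · exact (cmu.const_mul (-2)).rexp.mul cV
    · intro τ hτ; obtain ⟨⟨d, _, hd⟩, _⟩ := hd τ hτ
      exact hd.differentiableAt.differentiableWithinAt
    · intro τ hτ; obtain ⟨⟨d, h0, hd⟩, _⟩ := hd τ hτ
      rw [hd.deriv]; exact h0
  · refine monotoneOn_of_deriv_nonneg (f := fun s => exp (2 * mu (tt s) (rr s)) * (m^2 + ww s^2 + F / tt s^2) * tt s)
      (convex_Icc τ₀ c) ?_ ?_ ?_ ⟨le_rfl, h1⟩ ⟨h1, le_rfl⟩ h1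
    · exact ((cmu.const_mul 2).rexp.mul cV).mul ct
    · intro τ hτ; obtain ⟨_, ⟨d, _, hd⟩⟩ := hd τ hτ
      exact hd.differentiableAt.differentiableWithinAt
    · intro τ hτ; obtain ⟨_, ⟨d, h0, hd⟩⟩ := hd τ hτ
      rw [hd.deriv]; exact h0
end GEO


/-- the geodesic vector field -/
def geoF (lam mu : ℝ → ℝ → ℝ) (m F : ℝ) (v : ℝ × ℝ × ℝ) : ℝ × ℝ × ℝ :=
  (Real.exp (-(mu v.1 v.2.1)) * Real.sqrt (m ^ 2 + v.2.2 ^ 2 + F / v.1 ^ 2),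
    Real.exp (-(lam v.1 v.2.1)) * v.2.2,
    -(ptd lam v.1 v.2.1)
          * (Real.exp (-(mu v.1 v.2.1))
              * Real.sqrt (m ^ 2 + v.2.2 ^ 2 + F / v.1 ^ 2)) * v.2.2
        - Real.exp (2 * mu v.1 v.2.1 - lam v.1 v.2.1) * prd mu v.1 v.2.1
          * (Real.exp (-(mu v.1 v.2.1))
              * Real.sqrt (m ^ 2 + v.2.2 ^ 2 + F / v.1 ^ 2)) ^ 2)

/-- clamp -/
def clp (x y s : ℝ) : ℝ := max x (min y s)

theorem clp_mem {x y s : ℝ} (h : x ≤ y) : clp x y s ∈ Set.Icc x y :=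
  ⟨le_max_left _ _, max_le h (min_le_left _ _)⟩

theorem clp_eq {x y s : ℝ} (h1 : x ≤ s) (h2 : s ≤ y) : clp x y s = s := by
  simp [clp, h1, h2]

theorem clp_uc (x y : ℝ) : UniformContinuous (clp x y) := by
  have : LipschitzWith 1 (fun s => clp x y s) := by
    unfold clp
    exact (LipschitzWith.id.const_min y).const_max x
  exact this.uniformContinuous

section GEO
variable {lam mu phi : ℝ → ℝ → ℝ} {m F : ℝ} {a b : EReal} {tt rr ww : ℝ → ℝ} {τ₀ : ℝ}

theorem geoF_cont (h : IsEVS 0 ⊤ lam mu phi (fun _ _ _ _ => 0)) {v : ℝ × ℝ × ℝ} (hv : 1 < v.1) :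
    ContinuousAt (geoF lam mu m F) v := by
  obtain ⟨c1, c2, c3, c4, c5⟩ := evs_muC1 h (r := v.2.1) hv
  have pr : ContinuousAt (fun v : ℝ × ℝ × ℝ => (v.1, v.2.1)) v := by fun_prop
  have k1 : ContinuousAt (fun v : ℝ × ℝ × ℝ => mu v.1 v.2.1) v := ContinuousAt.comp (f := fun v : ℝ × ℝ × ℝ => (v.1, v.2.1)) c1 pr
  have k2 : ContinuousAt (fun v : ℝ × ℝ × ℝ => lam v.1 v.2.1) v := ContinuousAt.comp (f := fun v : ℝ × ℝ × ℝ => (v.1, v.2.1)) c2 pr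
  have k4 : ContinuousAt (fun v : ℝ × ℝ × ℝ => ptd lam v.1 v.2.1) v := ContinuousAt.comp (f := fun v : ℝ × ℝ × ℝ => (v.1, v.2.1)) c4 pr
  have k5 : ContinuousAt (fun v : ℝ × ℝ × ℝ => prd mu v.1 v.2.1) v := ContinuousAt.comp (f := fun v : ℝ × ℝ × ℝ => (v.1, v.2.1)) c5 pr
  have kw : ContinuousAt (fun v : ℝ × ℝ × ℝ => v.2.2) v := by fun_prop
  have kS : ContinuousAt (fun v : ℝ × ℝ × ℝ => √(m ^ 2 + v.2.2 ^ 2 + F / v.1 ^ 2)) v := by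
    have : ContinuousAt (fun v : ℝ × ℝ × ℝ => F / v.1 ^ 2) v :=
      continuousAt_const.div (by fun_prop) (by positivity)
    exact ((continuousAt_const.add (kw.pow 2)).add this).sqrt
  have kp := k1.neg.rexp.mul kS
  unfold geoF
  refine kp.prodMk ((k2.neg.rexp.mul kw).prodMk ?_)
  exact ((k4.neg.mul kp).mul kw).sub ((((k1.const_mul 2).sub k2).rexp.mul k5).mul (kp.pow 2))

theorem geoF_clamp (h : IsEVS 0 ⊤ lam mu phi (fun _ _ _ _ => 0)) {t1 T Rm W : ℝ} (ht : 1 < t1) (hT : t1 ≤ T)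
    (hR : 0 ≤ Rm) (hW : 0 ≤ W) : ∃ f : ℝ × ℝ × ℝ → ℝ × ℝ × ℝ, UniformContinuous f ∧ (∃ C, ∀ v, ‖f v‖ ≤ C) ∧
      ∀ v : ℝ × ℝ × ℝ, t1 ≤ v.1 → v.1 ≤ T → |v.2.1| ≤ Rm → |v.2.2| ≤ W → f v = geoF lam mu m F v := by
  set K : Set (ℝ × ℝ × ℝ) := Set.Icc t1 T ×ˢ (Set.Icc (-Rm) Rm ×ˢ Set.Icc (-W) W) with hK
  have Kc : IsCompact K := isCompact_Icc.prod (isCompact_Icc.prod isCompact_Icc)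
  have fc : ContinuousOn (geoF lam mu m F) K := fun v hv =>
    (geoF_cont h (lt_of_lt_of_le ht hv.1.1)).continuousWithinAt
  set g : ℝ × ℝ × ℝ → ℝ × ℝ × ℝ := fun v => (clp t1 T v.1, clp (-Rm) Rm v.2.1, clp (-W) W v.2.2) with hg
  have gK : ∀ v, g v ∈ K := fun v => ⟨clp_mem hT, clp_mem (by linarith), clp_mem (by linarith)⟩
  have gu : UniformContinuous g :=
    ((clp_uc _ _).comp uniformContinuous_fst).prodMk
      (((clp_uc _ _).comp (uniformContinuous_fst.comp uniformContinuous_snd)).prodMk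
      ((clp_uc _ _).comp (uniformContinuous_snd.comp uniformContinuous_snd)))
  refine ⟨fun v => geoF lam mu m F (g v), ?_, ?_, ?_⟩
  · have := Kc.uniformContinuousOn_of_continuous fc
    rw [← uniformContinuousOn_univ] at gu ⊢
    exact this.comp gu (fun v _ => gK v)
  · obtain ⟨C, hC⟩ := Kc.exists_bound_of_continuousOn fc
    exact ⟨C, fun v => hC _ (gK v)⟩
  · intro v h1 h2 h3 h4
    rw [abs_le] at h3 h4
    simp only [hg, clp_eq h1 h2, clp_eq h3.1 h3.2, clp_eq h4.1 h4.2]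

theorem geo_V0 (ht0 : tt τ₀ = 1)
    (hcausal : 0 < m ∨ (m = 0 ∧
      0 < Real.exp (-(mu 1 (rr τ₀))) * Real.sqrt (ww τ₀ ^ 2 + F))) (hF : 0 ≤ F) :
    0 < m^2 + ww τ₀^2 + F / tt τ₀^2 := by
  rw [ht0]
  rcases hcausal with hm | ⟨hm, h2⟩
  · positivity
  · have := (pos_iff_pos_of_mul_pos h2).1 (exp_pos _)
    have := Real.sqrt_pos.1 this
    subst hm; simpa using this

/-- the basic bounds -/
theorem geo_bds (h : IsEVS 0 ⊤ lam mu phi (fun _ _ _ _ => 0)) (hm : 0 ≤ m) (hF : 0 ≤ F)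
    (hg : GeoSys lam mu m F a b tt rr ww) (ha : a < (τ₀ : EReal)) (ht0 : tt τ₀ = 1)
    (hV : 0 < m^2 + ww τ₀^2 + F / tt τ₀^2) : ∃ P κ : ℝ, 0 < P ∧ 0 < κ ∧ ∀ c : ℝ, τ₀ ≤ c → (c : EReal) < b →
      exp (-(mu (tt c) (rr c))) * √(m^2 + ww c^2 + F / tt c^2) ≤ P ∧
      κ ≤ exp (2 * mu (tt c) (rr c)) * (m^2 + ww c^2 + F / tt c^2) * tt c ∧
      0 < m^2 + ww c^2 + F / tt c^2 := by
  refine ⟨exp (-(mu (tt τ₀) (rr τ₀))) * √(m^2 + ww τ₀^2 + F / tt τ₀^2),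
    exp (2 * mu (tt τ₀) (rr τ₀)) * (m^2 + ww τ₀^2 + F / tt τ₀^2) * tt τ₀,
    mul_pos (exp_pos _) (Real.sqrt_pos.2 hV), by rw [ht0] at *; positivity, fun c h1 hc => ?_⟩
  obtain ⟨k1, k2⟩ := geo_mono h hm hF hg ha ht0 hV h1 hc
  have hκ : 0 < exp (2 * mu (tt τ₀) (rr τ₀)) * (m^2 + ww τ₀^2 + F / tt τ₀^2) * tt τ₀ :=
    mul_pos (mul_pos (exp_pos _) hV) (by rw [ht0]; norm_num)
  have tc := geo_tt_ge hg ha ht0 h1 hc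
  have Vc : 0 < m^2 + ww c^2 + F / tt c^2 := by
    have := hκ.trans_le k2
    have := pos_of_mul_pos_left this (by linarith)
    exact (pos_iff_pos_of_mul_pos this).1 (exp_pos _)
  refine ⟨?_, k2, Vc⟩
  have e : ∀ x V : ℝ, 0 ≤ V → (exp (-x) * √V)^2 = exp (-2 * x) * V := fun x V hV => by
    rw [mul_pow, Real.sq_sqrt hV, ← exp_nat_mul]; push_cast; ring_nf
  rw [← e _ _ Vc.le, ← e _ _ hV.le] at k1
  exact (pow_le_pow_iff_left₀ (by positivity) (by positivity) (by norm_num)).1 k1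

theorem geo_lin (h : IsEVS 0 ⊤ lam mu phi (fun _ _ _ _ => 0))
    (hg : GeoSys lam mu m F a b tt rr ww) (ha : a < (τ₀ : EReal)) {P : ℝ}
    (hP : ∀ c : ℝ, τ₀ ≤ c → (c : EReal) < b →
      exp (-(mu (tt c) (rr c))) * √(m^2 + ww c^2 + F / tt c^2) ≤ P) {c : ℝ} (h1 : τ₀ ≤ c) (hc : (c : EReal) < b) :
    tt c - tt τ₀ ≤ P * (c - τ₀) := by
  have lm : ∀ τ ∈ Set.Icc τ₀ c, a < (τ : EReal) ∧ (τ : EReal) < b := fun τ hτ => lift_mem ha hc hτ.1 hτ.2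
  have d : ∀ τ ∈ Set.Icc τ₀ c, HasDerivAt tt _ τ := fun τ hτ => (hg τ (lm τ hτ).1 (lm τ hτ).2).1
  refine (convex_Icc τ₀ c).image_sub_le_mul_sub_of_deriv_le ?_ ?_ ?_ τ₀ ⟨le_rfl, h1⟩ c ⟨h1, le_rfl⟩ h1
  · exact fun τ hτ => (d τ hτ).continuousAt.continuousWithinAt
  · exact fun τ hτ => (d τ (interior_subset hτ)).differentiableAt.differentiableWithinAt
  · intro τ hτ
    have hτ := interior_subset hτ
    rw [(d τ hτ).deriv]
    exact hP τ hτ.1 (lm τ hτ).2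
end GEO


section GEO
variable {lam mu phi : ℝ → ℝ → ℝ} {m F : ℝ} {a b : EReal} {tt rr ww : ℝ → ℝ} {τ₀ : ℝ}

open Topology in
theorem geo_btop (h : IsEVS 0 ⊤ lam mu phi (fun _ _ _ _ => 0)) (hm : 0 ≤ m) (hF : 0 ≤ F)
    (hgeo : GeoRightMax lam mu m F a b tt rr ww) (ha : a < (τ₀ : EReal)) (hb : (τ₀ : EReal) < b) (ht0 : tt τ₀ = 1)
    (hV : 0 < m^2 + ww τ₀^2 + F / tt τ₀^2) : b = ⊤ := by
  by_contra hbt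
  obtain ⟨β, rfl⟩ : ∃ β : ℝ, b = (β : EReal) := by
    induction b with
    | bot => exact absurd hb (by simp)
    | top => exact absurd rfl hbt
    | coe β => exact ⟨β, rfl⟩
  have hβ : τ₀ < β := EReal.coe_lt_coe_iff.1 hb
  obtain ⟨hg, hmax⟩ := hgeo
  obtain ⟨P, κ, hP, hκ, hbd⟩ := geo_bds h hm hF hg ha ht0 hV
  have lb : ∀ c : ℝ, c < β → (c : EReal) < (β : EReal) := fun c hc => EReal.coe_lt_coe_iff.2 hc
  have la : ∀ c : ℝ, τ₀ ≤ c → a < (c : EReal) := fun c hc => ha.trans_le (EReal.coe_le_coe_iff.2 hc)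
  set T := 1 + P * (β - τ₀) with hT
  have ttT : ∀ c, τ₀ ≤ c → c < β → tt c ≤ T := fun c h1 h2 => by
    have := geo_lin h hg ha (fun c h1 h2 => (hbd c h1 h2).1) h1 (lb c h2)
    rw [ht0] at this
    nlinarith
  have tt1 : ∀ c, τ₀ ≤ c → c < β → 1 ≤ tt c := fun c h1 h2 => geo_tt_ge hg ha ht0 h1 (lb c h2)
  obtain ⟨C, hC⟩ := evs_mubdd h T
  set W0 := exp C * P with hW0
  have W0p : 0 < W0 := by positivity
  have wW : ∀ c, τ₀ ≤ c → c < β → |ww c| ≤ W0 := fun c h1 h2 => by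
    obtain ⟨k1, k2, k3⟩ := hbd c h1 (lb c h2)
    have hc := (abs_le.1 (hC (tt c) (rr c) (tt1 c h1 h2) (ttT c h1 h2)).1).2
    have s1 : |ww c| ≤ √(m^2 + ww c^2 + F / tt c^2) := by
      apply Real.le_sqrt_of_sq_le
      have : 0 ≤ F / tt c^2 := by positivity
      rw [sq_abs]; nlinarith [sq_nonneg m]
    refine s1.trans ?_
    have e : √(m^2 + ww c^2 + F / tt c^2) = exp (mu (tt c) (rr c)) * (exp (-(mu (tt c) (rr c))) * √(m^2 + ww c^2 + F / tt c^2)) := by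
      rw [← mul_assoc, ← exp_add]; simp
    rw [e]
    exact mul_le_mul (exp_le_exp.2 hc) k1 (by positivity) (by positivity)
  set R0 := |rr τ₀| + exp C * W0 * (β - τ₀) with hR0
  have rR : ∀ c, τ₀ ≤ c → c < β → |rr c| ≤ R0 := fun c h1 h2 => by
    have := (convex_Icc τ₀ c).norm_image_sub_le_of_norm_hasDerivWithin_le (f := rr)
      (f' := fun τ => exp (-(lam (tt τ) (rr τ))) * ww τ) (C := exp C * W0) (x := τ₀) (y := c)
      (fun τ hτ => (hg τ (la τ hτ.1) (lb τ (hτ.2.trans_lt h2))).2.1.hasDerivWithinAt)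
      (fun τ hτ => by
        have hc := (abs_le.1 (hC (tt τ) (rr τ) (tt1 τ hτ.1 (hτ.2.trans_lt h2)) (ttT τ hτ.1 (hτ.2.trans_lt h2))).2).1
        rw [norm_mul, Real.norm_eq_abs, Real.norm_eq_abs, abs_exp]
        exact mul_le_mul (exp_le_exp.2 (by linarith)) (wW τ hτ.1 (hτ.2.trans_lt h2)) (abs_nonneg _) (by positivity))
      ⟨le_rfl, h1⟩ ⟨h1, le_rfl⟩
    rw [Real.norm_eq_abs, Real.norm_eq_abs, abs_of_nonneg (by linarith : 0 ≤ c - τ₀)] at this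
    have k : exp C * W0 * (c - τ₀) ≤ exp C * W0 * (β - τ₀) :=
      mul_le_mul_of_nonneg_left (by linarith) (by positivity)
    have := abs_sub_abs_le_abs_sub (rr c) (rr τ₀)
    linarith
  have R0p : 0 ≤ R0 := (abs_nonneg _).trans (rR τ₀ le_rfl hβ)
  set τ₁ := (τ₀ + β)/2 with hτ1
  have o1 : τ₀ < τ₁ := by linarith
  have o2 : τ₁ < β := by linarith
  have tt2 : ∀ c, τ₁ ≤ c → c < β → tt τ₁ ≤ tt c := fun c h1 h2 =>
    geo_tt_mono hg ha (lb c h2) ⟨o1.le, h1⟩ ⟨o1.le.trans h1, le_rfl⟩ h1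
  have tg := geo_tt_gt hg ha ht0 hV o1 (lb τ₁ o2)
  set t1 := (1 + tt τ₁)/2 with ht1
  have q1 : 1 < t1 := by linarith
  have q2 : t1 < tt τ₁ := by linarith
  have q3 := ttT τ₁ o1.le o2
  obtain ⟨f, fu, ⟨Cf, fb⟩, fe⟩ := geoF_clamp (m := m) (F := F) h q1 (by linarith : t1 ≤ T + 1)
    (by linarith : 0 ≤ R0 + 1) (by linarith : 0 ≤ W0 + 1)
  set x : ℝ → ℝ × ℝ × ℝ := fun s => (tt s, rr s, ww s) with hx
  have hxd : ∀ s, τ₁ ≤ s → s < β → HasDerivAt x (f (x s)) s := fun s h1 h2 => by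
    have h1' := o1.le.trans h1
    have := tt2 s h1 h2
    rw [fe (x s) (by simp only [hx]; linarith) (by simp only [hx]; linarith [ttT s h1' h2])
      (by simp only [hx]; linarith [rR s h1' h2]) (by simp only [hx]; linarith [wW s h1' h2])]
    obtain ⟨d1, d2, d3⟩ := hg s (la s h1') (lb s h2)
    exact d1.prodMk (d2.prodMk d3)
  obtain ⟨z, z1, z2⟩ := ode_extend fu fb o2 hxd
  have zc : ContinuousAt z β := (z2 β o2).continuousAt
  have zl : ∀ᶠ s in 𝓝[<] β, τ₁ < s ∧ s < β := Ioo_mem_nhdsLT o2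
  have ztend : Tendsto z (𝓝[<] β) (𝓝 (z β)) := zc.tendsto.mono_left nhdsWithin_le_nhds
  have c1 : ContinuousAt (fun s => (z s).1) β := continuousAt_fst.comp zc
  have c2 : ContinuousAt (fun s => |(z s).2.1|) β := (ContinuousAt.comp (f := z) (g := fun v : ℝ × ℝ × ℝ => |v.2.1|) (by fun_prop) zc)
  have c3 : ContinuousAt (fun s => |(z s).2.2|) β := (ContinuousAt.comp (f := z) (g := fun v : ℝ × ℝ × ℝ => |v.2.2|) (by fun_prop) zc)
  have b1 : tt τ₁ ≤ (z β).1 := ge_of_tendsto (c1.tendsto.mono_left (nhdsWithin_le_nhds (s := Set.Iio β))) (by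
    filter_upwards [zl] with s hs
    rw [z1 s hs.2]; exact tt2 s hs.1.le hs.2)
  have b2 : (z β).1 ≤ T := le_of_tendsto (c1.tendsto.mono_left (nhdsWithin_le_nhds (s := Set.Iio β))) (by
    filter_upwards [zl] with s hs
    rw [z1 s hs.2]; exact ttT s (o1.le.trans hs.1.le) hs.2)
  have b3 : |(z β).2.1| ≤ R0 := le_of_tendsto (c2.tendsto.mono_left (nhdsWithin_le_nhds (s := Set.Iio β))) (by
    filter_upwards [zl] with s hs
    rw [z1 s hs.2]; exact rR s (o1.le.trans hs.1.le) hs.2)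
  have b4 : |(z β).2.2| ≤ W0 := le_of_tendsto (c3.tendsto.mono_left (nhdsWithin_le_nhds (s := Set.Iio β))) (by
    filter_upwards [zl] with s hs
    rw [z1 s hs.2]; exact wW s (o1.le.trans hs.1.le) hs.2)
  have hev : ∀ᶠ s in 𝓝 β, t1 ≤ (z s).1 ∧ (z s).1 ≤ T + 1 ∧ |(z s).2.1| ≤ R0 + 1 ∧ |(z s).2.2| ≤ W0 + 1 := by
    filter_upwards [c1.tendsto.eventually (lt_mem_nhds (by linarith : t1 < (z β).1)),
      c1.tendsto.eventually (gt_mem_nhds (by linarith : (z β).1 < T + 1)),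
      c2.tendsto.eventually (gt_mem_nhds (by linarith : |(z β).2.1| < R0 + 1)),
      c3.tendsto.eventually (gt_mem_nhds (by linarith : |(z β).2.2| < W0 + 1))] with s e1 e2 e3 e4
    exact ⟨e1.le, e2.le, e3.le, e4.le⟩
  obtain ⟨ε, hε, hball⟩ := Metric.eventually_nhds_iff.1 hev
  refine hmax ((β + ε : ℝ) : EReal) (fun s => (z s).1) (fun s => (z s).2.1) (fun s => (z s).2.2)
    (EReal.coe_lt_coe_iff.2 (by linarith)) ?_ ?_
  · intro τ h1 h2
    have h2 := EReal.coe_lt_coe_iff.1 h2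
    by_cases hlt : τ < β
    · obtain ⟨d1, d2, d3⟩ := hg τ h1 (lb τ hlt)
      have ev : ∀ᶠ s in 𝓝 τ, z s = x s := by
        filter_upwards [Iio_mem_nhds hlt] with s hs using z1 s hs
      have ez : z τ = (tt τ, rr τ, ww τ) := z1 τ hlt
      simp only [ez]
      refine ⟨d1.congr_of_eventuallyEq (ev.mono fun s hs => ?_), d2.congr_of_eventuallyEq (ev.mono fun s hs => ?_),
        d3.congr_of_eventuallyEq (ev.mono fun s hs => ?_)⟩ <;> simp only [hs, hx]
    · push Not at hlt
      obtain ⟨e1, e2, e3, e4⟩ := hball (y := τ) (by rw [Real.dist_eq, abs_of_nonneg (by linarith)]; linarith)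
      have d := z2 τ (o2.trans_le hlt)
      rw [fe _ e1 e2 e3 e4] at d
      have hd1 : HasDerivAt (fun s => (z s).1) (geoF lam mu m F (z τ)).1 τ := d.fst
      have hd2 : HasDerivAt (fun s => (z s).2.1) (geoF lam mu m F (z τ)).2.1 τ := d.snd.fst
      have hd3 : HasDerivAt (fun s => (z s).2.2) (geoF lam mu m F (z τ)).2.2 τ := d.snd.snd
      exact ⟨hd1, hd2, hd3⟩
  · intro τ h1 h2
    have ez : z τ = (tt τ, rr τ, ww τ) := z1 τ (EReal.coe_lt_coe_iff.1 h2)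
    simp only [ez, and_self]

open Topology in
theorem geo_tend (h : IsEVS 0 ⊤ lam mu phi (fun _ _ _ _ => 0)) (hm : 0 ≤ m) (hF : 0 ≤ F)
    (hg : GeoSys lam mu m F a ⊤ tt rr ww) (ha : a < (τ₀ : EReal)) (ht0 : tt τ₀ = 1)
    (hV : 0 < m^2 + ww τ₀^2 + F / tt τ₀^2) : Tendsto tt atTop atTop := by
  obtain ⟨P, κ, hP, hκ, hbd⟩ := geo_bds h hm hF hg ha ht0 hV
  have lb : ∀ c : ℝ, (c : EReal) < ⊤ := fun c => EReal.coe_lt_top c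
  have la : ∀ c : ℝ, τ₀ ≤ c → a < (c : EReal) := fun c hc => ha.trans_le (EReal.coe_le_coe_iff.2 hc)
  have mono : ∀ s c, τ₀ ≤ s → s ≤ c → tt s ≤ tt c := fun s c h1 h2 =>
    geo_tt_mono hg ha (lb c) ⟨h1, h2⟩ ⟨h1.trans h2, le_rfl⟩ h2
  have tt1 : ∀ c, τ₀ ≤ c → 1 ≤ tt c := fun c h1 => geo_tt_ge hg ha ht0 h1 (lb c)
  rw [tendsto_atTop]
  intro T
  suffices ∃ c, τ₀ ≤ c ∧ T ≤ tt c by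
    obtain ⟨c, h1, h2⟩ := this
    filter_upwards [eventually_ge_atTop c] with s hs using h2.trans (mono c s h1 hs)
  by_contra hn
  push Not at hn
  obtain ⟨C, hC⟩ := evs_mubdd h T
  have T0 : 0 < T := by linarith [hn τ₀ le_rfl, tt1 τ₀ le_rfl]
  set q := exp (-C) * √(κ / (exp (2*C) * T)) with hq
  have q0 : 0 < q := mul_pos (exp_pos _) (Real.sqrt_pos.2 (by positivity))
  have low : ∀ c, τ₀ ≤ c → q ≤ exp (-(mu (tt c) (rr c))) * √(m^2 + ww c^2 + F / tt c^2) := fun c h1 => by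
    obtain ⟨k1, k2, k3⟩ := hbd c h1 (lb c)
    have hc := (abs_le.1 (hC (tt c) (rr c) (tt1 c h1) (hn c h1).le).1).2
    refine mul_le_mul (exp_le_exp.2 (by linarith)) (Real.sqrt_le_sqrt ?_) (Real.sqrt_nonneg _) (exp_pos _).le
    rw [div_le_iff₀ (by positivity)]
    refine k2.trans ?_
    have e1 : exp (2 * mu (tt c) (rr c)) ≤ exp (2*C) := exp_le_exp.2 (by linarith)
    have := mul_le_mul e1 (hn c h1).le (by linarith [tt1 c h1]) (exp_pos _).le
    nlinarith
  have key : ∀ c, τ₀ ≤ c → q * (c - τ₀) ≤ tt c - tt τ₀ := fun c h1 => by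
    have d : ∀ τ ∈ Set.Icc τ₀ c, HasDerivAt tt _ τ := fun τ hτ => (hg τ (la τ hτ.1) (lb τ)).1
    refine (convex_Icc τ₀ c).mul_sub_le_image_sub_of_le_deriv ?_ ?_ ?_ τ₀ ⟨le_rfl, h1⟩ c ⟨h1, le_rfl⟩ h1
    · exact fun τ hτ => (d τ hτ).continuousAt.continuousWithinAt
    · exact fun τ hτ => (d τ (interior_subset hτ)).differentiableAt.differentiableWithinAt
    · intro τ hτ
      have hτ := interior_subset hτ
      rw [(d τ hτ).deriv]
      exact low τ hτ.1
  have := key (τ₀ + T/q) (by have : 0 < T/q := by positivity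
                             linarith)
  have e : q * (τ₀ + T/q - τ₀) = T := by field_simp; ring
  rw [e, ht0] at this
  have := hn (τ₀ + T/q) (by have : 0 < T/q := by positivity
                            linarith)
  linarith

open Topology in
theorem geo_int (h : IsEVS 0 ⊤ lam mu phi (fun _ _ _ _ => 0)) (hm : 0 ≤ m) (hF : 0 ≤ F)
    (hg : GeoSys lam mu m F a ⊤ tt rr ww) (ha : a < (τ₀ : EReal)) (ht0 : tt τ₀ = 1)
    (hV : 0 < m^2 + ww τ₀^2 + F / tt τ₀^2) (htend : Tendsto tt atTop atTop) (R W : ℝ → ℝ)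
    (hRW : ∀ τ : ℝ, τ₀ ≤ τ → R (tt τ) = rr τ ∧ W (tt τ) = ww τ) :
    Tendsto (fun x => ∫ t in (1 : ℝ)..x,
            Real.exp (mu t (R t)) / Real.sqrt (m ^ 2 + W t ^ 2 + F / t ^ 2)) atTop atTop := by
  obtain ⟨P, κ, hP, hκ, hbd⟩ := geo_bds h hm hF hg ha ht0 hV
  have lb : ∀ c : ℝ, (c : EReal) < ⊤ := fun c => EReal.coe_lt_top c
  have la : ∀ c : ℝ, τ₀ ≤ c → a < (c : EReal) := fun c hc => ha.trans_le (EReal.coe_le_coe_iff.2 hc)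
  have tt1 : ∀ c, τ₀ ≤ c → 1 ≤ tt c := fun c h1 => geo_tt_ge hg ha ht0 h1 (lb c)
  have d : ∀ τ, τ₀ ≤ τ → HasDerivAt tt _ τ := fun τ hτ => (hg τ (la τ hτ) (lb τ)).1
  have ttc : ContinuousOn tt (Set.Ici τ₀) := fun τ hτ => (d τ hτ).continuousAt.continuousWithinAt
  have smono : StrictMonoOn tt (Set.Ici τ₀) := by
    apply strictMonoOn_of_deriv_pos (convex_Ici _) ttc
    intro τ hτ
    have hτ := interior_subset hτ
    rw [(d τ hτ).deriv]
    exact mul_pos (exp_pos _) (Real.sqrt_pos.2 (hbd τ hτ (lb τ)).2.2)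
  set Tx : ℝ → ℝ := fun τ => if τ ≤ τ₀ then 1 + (τ - τ₀) else tt τ with hTx
  have T1 : ∀ τ, τ ≤ τ₀ → Tx τ = 1 + (τ - τ₀) := fun τ hτ => by simp [hTx, hτ]
  have T2 : ∀ τ, τ₀ ≤ τ → Tx τ = tt τ := fun τ hτ => by
    rcases hτ.eq_or_lt with e | e
    · subst e; simp [hTx, ht0]
    · simp [hTx, not_le.2 e]
  have Tc : Continuous Tx := by
    have c1 : Continuous fun τ => tt (max τ τ₀) := by
      rw [continuous_iff_continuousAt]
      intro τ
      exact ContinuousAt.comp (f := fun τ : ℝ => max τ τ₀) (d _ (le_max_right _ _)).continuousAt (by fun_prop)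
    have c2 : Continuous fun τ => tt (max τ τ₀) + min (τ - τ₀) 0 := c1.add (by fun_prop)
    refine c2.congr (fun τ => ?_)
    rcases le_total τ τ₀ with hle | hle
    · rw [T1 τ hle, max_eq_right hle, ht0, min_eq_left (by linarith)]
    · rw [T2 τ hle, max_eq_left hle, min_eq_right (by linarith), add_zero]
  have Tm : StrictMono Tx := by
    have s1 : StrictMonoOn Tx (Set.Iic τ₀) := fun u hu v hv huv => by
      rw [T1 u hu, T1 v hv]; linarith
    have s2 : StrictMonoOn Tx (Set.Ici τ₀) := fun u hu v hv huv => by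
      rw [T2 u hu, T2 v hv]; exact smono hu hv huv
    exact s1.Iic_union_Ici s2
  have Ts : Function.Surjective Tx := by
    apply Tc.surjective
    · refine htend.congr' ?_
      filter_upwards [eventually_ge_atTop τ₀] with s hs using (T2 s hs).symm
    · have : Tendsto (fun τ : ℝ => 1 + (τ - τ₀)) atBot atBot :=
        tendsto_atBot_add_const_left _ _ (tendsto_atBot_add_const_right _ (-τ₀) tendsto_id)
      refine this.congr' ?_
      filter_upwards [eventually_le_atBot τ₀] with s hs using (T1 s hs).symm
  set e := (StrictMono.orderIsoOfSurjective Tx Tm Ts) with he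
  have e1 : ∀ τ, e τ = Tx τ := fun τ => rfl
  set σ : ℝ → ℝ := fun t => e.symm t with hσ
  have σc : Continuous σ := e.symm.continuous
  have Tσ : ∀ t, Tx (σ t) = t := fun t => by rw [← e1]; exact e.apply_symm_apply t
  have σ0 : ∀ t, 1 ≤ t → τ₀ ≤ σ t := fun t ht => by
    by_contra hn; push Not at hn
    have := T1 (σ t) hn.le
    rw [Tσ] at this; linarith
  have tσ : ∀ t, 1 ≤ t → tt (σ t) = t := fun t ht => by rw [← T2 _ (σ0 t ht), Tσ]
  have hR : ∀ t, 1 ≤ t → R t = rr (σ t) ∧ W t = ww (σ t) := fun t ht => by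
    have := hRW (σ t) (σ0 t ht)
    rwa [tσ t ht] at this
  set g : ℝ → ℝ := fun t => exp (mu t (R t)) / √(m ^ 2 + W t ^ 2 + F / t ^ 2) with hgdef
  have Rc : ContinuousOn R (Set.Ici 1) := by
    refine ContinuousOn.congr (f := fun t => rr (σ t)) ?_ (fun t ht => (hR t ht).1)
    intro t ht
    exact (ContinuousAt.comp (g := rr) (f := σ) ((hg _ (la _ (σ0 t ht)) (lb _)).2.1.continuousAt) σc.continuousAt).continuousWithinAt
  have Wc : ContinuousOn W (Set.Ici 1) := by
    refine ContinuousOn.congr (f := fun t => ww (σ t)) ?_ (fun t ht => (hR t ht).2)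
    intro t ht
    exact (ContinuousAt.comp (g := ww) (f := σ) ((hg _ (la _ (σ0 t ht)) (lb _)).2.2.continuousAt) σc.continuousAt).continuousWithinAt
  have mc : ContinuousOn (fun t => mu t (R t)) (Set.Ici 1) := by
    have := (evs_mucont h).comp_continuousOn (continuousOn_id.prodMk Rc)
    refine this.congr (fun t ht => ?_)
    simp only [Function.comp, id, max_eq_left (Set.mem_Ici.1 ht)]
  have Vp : ∀ t, 1 ≤ t → 0 < m ^ 2 + W t ^ 2 + F / t ^ 2 := fun t ht => by
    have := (hbd (σ t) (σ0 t ht) (lb _)).2.2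
    rwa [tσ t ht, ← (hR t ht).2] at this
  have gc : ContinuousOn g (Set.Ici 1) := by
    refine mc.rexp.div (ContinuousOn.sqrt ?_) (fun t ht => (Real.sqrt_pos.2 (Vp t ht)).ne')
    refine (continuousOn_const.add (Wc.pow 2)).add (continuousOn_const.div (continuousOn_id.pow 2) (fun t ht => ?_))
    have : (1:ℝ) ≤ t := ht
    show t^2 ≠ 0
    positivity
  have glow : ∀ t, 1 ≤ t → 1/P ≤ g t := fun t ht => by
    have := (hbd (σ t) (σ0 t ht) (lb _)).1
    rw [tσ t ht, ← (hR t ht).2, ← (hR t ht).1] at this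
    have s0 := Real.sqrt_pos.2 (Vp t ht)
    rw [hgdef, div_le_div_iff₀ hP s0, one_mul]
    calc √(m ^ 2 + W t ^ 2 + F / t ^ 2) = exp (mu t (R t)) * (exp (-(mu t (R t))) * √(m ^ 2 + W t ^ 2 + F / t ^ 2)) := by
          rw [← mul_assoc, ← exp_add]; simp
      _ ≤ _ := mul_le_mul_of_nonneg_left this (exp_pos _).le
  have hlow : Tendsto (fun x : ℝ => (x - 1) * (1/P)) atTop atTop :=
    (tendsto_atTop_add_const_right _ (-1) tendsto_id).atTop_mul_const (by positivity)
  refine tendsto_atTop_mono' _ ?_ hlow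
  filter_upwards [eventually_ge_atTop 1] with x hx
  have := intervalIntegral.integral_mono_on (μ := volume) (f := fun _ => 1/P) (g := g) hx
    (by simp) ((gc.mono (by rw [Set.uIcc_of_le hx]; exact Set.Icc_subset_Ici_self)).intervalIntegrable)
    (fun t ht => glow t ht.1)
  simpa using this
end GEO


/-- Theorem 3: the plane symmetric Einstein–scalar field spacetime
(`f ≡ 0`) is future timelike and null geodesically complete: along any maximally
extended future-directed timelike or null geodesic starting at `t = 1`, the
coordinate time tends to infinity, the proper time integral diverges, and
`τ₊ = +∞`. -/
theorem geodesic_completeness_plane_scalar (lam mu phi : ℝ → ℝ → ℝ)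
    (h : IsEVS 0 ⊤ lam mu phi (fun _ _ _ _ => 0))
    (m F : ℝ) (hm : 0 ≤ m) (hF : 0 ≤ F)
    (a b : EReal) (tt rr ww : ℝ → ℝ) (τ₀ : ℝ)
    (hτ₀ : a < (τ₀ : EReal) ∧ (τ₀ : EReal) < b)
    (hgeo : GeoRightMax lam mu m F a b tt rr ww)
    (ht0 : tt τ₀ = 1)
    (hcausal : 0 < m ∨ (m = 0 ∧
      0 < Real.exp (-(mu 1 (rr τ₀))) * Real.sqrt (ww τ₀ ^ 2 + F))) :
    b = ⊤
    ∧ Filter.Tendsto tt Filter.atTop Filter.atTop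
    ∧ ∀ R W : ℝ → ℝ,
        (∀ τ : ℝ, a < (τ : EReal) → (τ : EReal) < b →
          R (tt τ) = rr τ ∧ W (tt τ) = ww τ) →
        Filter.Tendsto (fun x => ∫ t in (1 : ℝ)..x,
            Real.exp (mu t (R t)) / Real.sqrt (m ^ 2 + W t ^ 2 + F / t ^ 2))
          Filter.atTop Filter.atTop := by
  have hV := geo_V0 ht0 hcausal hF
  have hb := geo_btop h hm hF hgeo hτ₀.1 hτ₀.2 ht0 hV
  subst hb
  have htd := geo_tend h hm hF hgeo.1 hτ₀.1 ht0 hV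
  exact ⟨rfl, htd, fun R W hRW => geo_int h hm hF hgeo.1 hτ₀.1 ht0 hV htd R W (fun τ hτ =>
    hRW τ (hτ₀.1.trans_le (EReal.coe_le_coe_iff.2 hτ)) (EReal.coe_lt_top τ))⟩
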